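/- arXiv:1712.01660 — 2 statements merged into one kernel-verified Lean document; each statement's English description precedes it below -/
import Mathlib

section
/- There exists a constant C>0 such that ‖(1−Δ_v+v²+|ξ|^{2/3}+|λ|^{1/2})(P̂₀(ξ)+n/2+1−iλ)^{−1}‖_{ℬ(L²(ℝⁿ_v))} ≤ C uniformly in ξ∈ℝⁿ and λ∈ℝ. -/
open MeasureTheory Real Complex Filter Topology

noncomputable section

/-- ℝⁿ (velocity variables) -/
abbrev Ev (n : ℕ) := EuclideanSpace ℝ (Fin n)
/-- L²(ℝⁿ_v) -/
abbrev HV (n : ℕ) := Lp ℂ 2 (volume : Measure (Ev n))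

/-- test functions on ℝⁿ_v -/
def IsTestV (n : ℕ) (φ : Ev n → ℂ) : Prop := ContDiff ℝ (⊤ : ℕ∞) φ ∧ HasCompactSupport φ

def djV (n : ℕ) (u : Ev n → ℂ) (j : Fin n) (v : Ev n) : ℂ :=
  fderiv ℝ u v (EuclideanSpace.single j 1)

def lapV (n : ℕ) (u : Ev n → ℂ) (v : Ev n) : ℂ :=
  ∑ j : Fin n, djV n (fun w => djV n u j w) j v

/-- the complex harmonic oscillator P̂₀(ξ) = −Δᵥ + v²/4 − n/2 + i v·ξ (it coincides with
its formal transpose w.r.t. the bilinear pairing ∫ u φ) -/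
def Phat0t (n : ℕ) (ξ : Ev n) (φ : Ev n → ℂ) (v : Ev n) : ℂ :=
  -lapV n φ v + ((‖v‖ ^ 2 / 4 - (n : ℝ) / 2 : ℝ) : ℂ) * φ v
    + Complex.I * (((∑ j : Fin n, v j * ξ j : ℝ)) : ℂ) * φ v

/-- R is the resolvent (P̂₀(ξ) − z)^{−1}, in the distributional sense -/
def IsResV (n : ℕ) (ξ : Ev n) (z : ℂ) (R : HV n →L[ℂ] HV n) : Prop :=
  ∀ f : HV n, ∀ φ : Ev n → ℂ, IsTestV n φ →
    ∫ v : Ev n, (R f) v * (Phat0t n ξ φ v - z * φ v) = ∫ v : Ev n, f v * φ v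

/-- normalized Hermite function φ_j = (j!√(2π))^{−1/2} e^{−s²/4} F_j(s), extended to
complex arguments (F_j = probabilists' Hermite polynomial). -/
def phiC (j : ℕ) (z : ℂ) : ℂ :=
  ((((Nat.factorial j : ℝ) * Real.sqrt (2 * π)) ^ (-(1:ℝ)/2) : ℝ) : ℂ)
    * Complex.exp (-z ^ 2 / 4) * Polynomial.aeval z (Polynomial.hermite j)

/-- ψ_α at complex arguments -/
def psiCN (n : ℕ) (α : Fin n → ℕ) (w : Fin n → ℂ) : ℂ := ∏ j : Fin n, phiC (α j) (w j)

/-- ψ_α^ξ(v) = ψ_α(v + 2iξ) -/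
def psiXi (n : ℕ) (α : Fin n → ℕ) (ξ : Ev n) (v : Ev n) : ℂ :=
  psiCN n α (fun j => ((v j : ℝ) : ℂ) + 2 * Complex.I * ((ξ j : ℝ) : ℂ))

/-- R is the resolvent (P̂₀(ξ) + n/2 + 1 − iλ)^{−1}, in the distributional sense -/
def IsRes5 (n : ℕ) (ξ : Ev n) (lam : ℝ) (R : HV n →L[ℂ] HV n) : Prop :=
  ∀ f : HV n, ∀ φ : Ev n → ℂ, IsTestV n φ →
    ∫ v : Ev n, (R f) v *
        (Phat0t n ξ φ v + (((n : ℝ) / 2 + 1 : ℝ) - Complex.I * (lam : ℝ)) * φ v)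
      = ∫ v : Ev n, f v * φ v

open scoped ComplexConjugate ContDiff InnerProductSpace

section Calculus

variable {n : ℕ}

lemma ContDiff.djV {u : Ev n → ℂ} (hu : ContDiff ℝ ∞ u) (j : Fin n) :
    ContDiff ℝ ∞ (djV n u j) :=
  (hu.fderiv_right (m := ∞) (by simp)).clm_apply contDiff_const

lemma HasCompactSupport.djV {u : Ev n → ℂ} (hu : HasCompactSupport u) (j : Fin n) :
    HasCompactSupport (djV n u j) :=
  hu.fderiv_apply (𝕜 := ℝ) _

lemma djV_mul {f g : Ev n → ℂ} (hf : ContDiff ℝ ∞ f) (hg : ContDiff ℝ ∞ g) (j : Fin n)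
    (v : Ev n) : djV n (fun w => f w * g w) j v = f v * djV n g j v + djV n f j v * g v := by
  unfold djV
  rw [fderiv_fun_mul (hf.differentiable (by simp) v) (hg.differentiable (by simp) v)]
  simp [mul_comm]

lemma djV_add {f g : Ev n → ℂ} (hf : ContDiff ℝ ∞ f) (hg : ContDiff ℝ ∞ g) (j : Fin n)
    (v : Ev n) : djV n (fun w => f w + g w) j v = djV n f j v + djV n g j v := by
  unfold djV
  rw [fderiv_fun_add (hf.differentiable (by simp) v) (hg.differentiable (by simp) v)]
  simp

lemma djV_const_mul {f : Ev n → ℂ} (hf : ContDiff ℝ ∞ f) (c : ℂ) (j : Fin n)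
    (v : Ev n) : djV n (fun w => c * f w) j v = c * djV n f j v := by
  unfold djV
  rw [fderiv_const_mul (hf.differentiable (by simp) v)]
  simp

lemma ContDiff.conj {f : Ev n → ℂ} (hf : ContDiff ℝ ∞ f) :
    ContDiff ℝ ∞ (fun v => conj (f v)) :=
  Complex.conjCLE.contDiff.comp hf

lemma djV_conj (f : Ev n → ℂ) (j : Fin n) (v : Ev n) :
    djV n (fun w => conj (f w)) j v = conj (djV n f j v) := by
  unfold djV
  have h : (fun w => conj (f w)) = Complex.conjCLE ∘ f := by ext; simp
  rw [h, ContinuousLinearEquiv.comp_fderiv]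
  simp

lemma djV_ofReal {p : Ev n → ℝ} (hp : Differentiable ℝ p) (j : Fin n) (v : Ev n) :
    djV n (fun w => (p w : ℂ)) j v = (fderiv ℝ p v (EuclideanSpace.single j 1) : ℝ) := by
  unfold djV
  have h : HasFDerivAt (fun w => (p w : ℂ)) (Complex.ofRealCLM.comp (fderiv ℝ p v)) v :=
    Complex.ofRealCLM.hasFDerivAt.comp v (hp v).hasFDerivAt
  rw [h.fderiv]
  simp

lemma lapV_add {f g : Ev n → ℂ} (hf : ContDiff ℝ ∞ f) (hg : ContDiff ℝ ∞ g)
    (v : Ev n) : lapV n (fun w => f w + g w) v = lapV n f v + lapV n g v := by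
  simp only [lapV, ← Finset.sum_add_distrib]
  refine Finset.sum_congr rfl fun j _ => ?_
  rw [← djV_add (hf.djV j) (hg.djV j)]
  congr 1
  ext w
  exact djV_add hf hg j w

lemma lapV_const_mul {f : Ev n → ℂ} (hf : ContDiff ℝ ∞ f) (c : ℂ)
    (v : Ev n) : lapV n (fun w => c * f w) v = c * lapV n f v := by
  simp only [lapV, Finset.mul_sum]
  refine Finset.sum_congr rfl fun j _ => ?_
  rw [← djV_const_mul (hf.djV j)]
  congr 1
  ext w
  exact djV_const_mul hf c j w

lemma lapV_conj (f : Ev n → ℂ) (v : Ev n) :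
    lapV n (fun w => conj (f w)) v = conj (lapV n f v) := by
  simp only [lapV, map_sum]
  refine Finset.sum_congr rfl fun j _ => ?_
  rw [← djV_conj]
  congr 1
  ext w
  exact djV_conj f j w

lemma ContDiff.lapV {u : Ev n → ℂ} (hu : ContDiff ℝ ∞ u) : ContDiff ℝ ∞ (lapV n u) :=
  ContDiff.sum fun j _ => (hu.djV j).djV j

lemma HasCompactSupport.finsetSum {ι X : Type*} [TopologicalSpace X] {s : Finset ι}
    {f : ι → X → ℂ} (h : ∀ i ∈ s, HasCompactSupport (f i)) :
    HasCompactSupport (fun x => ∑ i ∈ s, f i x) := by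
  classical
  induction s using Finset.induction_on with
  | empty => simpa using! HasCompactSupport.zero
  | insert i s hi ih =>
    simp only [Finset.sum_insert hi]
    exact (h i (by simp)).add (ih fun k hk => h k (by simp [hk]))

lemma HasCompactSupport.lapV {u : Ev n → ℂ} (hu : HasCompactSupport u) :
    HasCompactSupport (lapV n u) :=
  HasCompactSupport.finsetSum fun j _ => (hu.djV j).djV j

lemma HasCompactSupport.conj {u : Ev n → ℂ} (hu : HasCompactSupport u) :
    HasCompactSupport (fun v => conj (u v)) :=
  hu.comp_left (g := conj) (map_zero _)

/-- Integration by parts against a compactly supported factor. -/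
lemma integral_mul_djV {f g : Ev n → ℂ} (hf : ContDiff ℝ ∞ f) (hg : ContDiff ℝ ∞ g)
    (h : HasCompactSupport f ∨ HasCompactSupport g) (j : Fin n) :
    ∫ v, f v * djV n g j v = -∫ v, djV n f j v * g v := by
  refine integral_mul_fderiv_eq_neg_fderiv_mul_of_integrable ?_ ?_ ?_
    (fun v _ => hf.differentiable (by simp) v) (fun v _ => hg.differentiable (by simp) v)
  · refine ((hf.djV j).continuous.mul hg.continuous).integrable_of_hasCompactSupport ?_
    rcases h with h | h
    exacts [(h.djV j).mul_right, h.mul_left]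
  · refine (hf.continuous.mul (hg.djV j).continuous).integrable_of_hasCompactSupport ?_
    rcases h with h | h
    exacts [h.mul_right, (h.djV j).mul_left]
  · refine (hf.continuous.mul hg.continuous).integrable_of_hasCompactSupport ?_
    rcases h with h | h
    exacts [h.mul_right, h.mul_left]

/-- Green's identity with a weight. -/
lemma integral_weight_mul_conj_mul_lapV {p w : Ev n → ℂ} (hp : ContDiff ℝ ∞ p)
    (hw : ContDiff ℝ ∞ w) (h : HasCompactSupport p ∨ HasCompactSupport w) :
    ∫ v, p v * conj (w v) * lapV n w v =
      -∑ j, ∫ v, (p v * (conj (djV n w j v) * djV n w j v)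
        + djV n p j v * (conj (w v) * djV n w j v)) := by
  have hpw : ContDiff ℝ ∞ (fun v => p v * conj (w v)) := hp.mul hw.conj
  have hs : HasCompactSupport (fun v => p v * conj (w v)) := by
    rcases h with h | h
    exacts [h.mul_right, h.conj.mul_left]
  simp only [lapV, Finset.mul_sum]
  rw [integral_finsetSum, ← Finset.sum_neg_distrib]
  · refine Finset.sum_congr rfl fun j _ => ?_
    rw [integral_mul_djV hpw (hw.djV j) (Or.inl hs) j]
    congr 2
    ext v
    rw [djV_mul hp hw.conj, djV_conj]
    ring
  · intro j _
    exact (hpw.continuous.mul ((hw.djV j).djV j).continuous).integrable_of_hasCompactSupport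
      hs.mul_right

end Calculus

section Mollification

variable {n : ℕ}

/-- Convolution of complex functions on `ℝⁿ`. -/
def mollify (k u : Ev n → ℂ) : Ev n → ℂ :=
  convolution u k (ContinuousLinearMap.mul ℝ ℂ) volume

lemma mollify_apply (k u : Ev n → ℂ) (x : Ev n) :
    mollify k u x = ∫ y, u y * k (x - y) := by
  simp [mollify, convolution_def]

lemma integrable_mul_comp_sub {𝕜 : Type*} [RCLike 𝕜] {k u : Ev n → 𝕜} (hk : Continuous k)
    (hks : HasCompactSupport k) (hu : LocallyIntegrable u volume) (x : Ev n) :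
    Integrable (fun y => u y * k (x - y)) := by
  simpa [ConvolutionExistsAt] using
    hks.convolutionExists_right (ContinuousLinearMap.mul ℝ 𝕜) hu hk x

lemma contDiff_mollify {k u : Ev n → ℂ} (hk : ContDiff ℝ ∞ k) (hks : HasCompactSupport k)
    (hu : LocallyIntegrable u volume) : ContDiff ℝ ∞ (mollify k u) :=
  hks.contDiff_convolution_right (n := ⊤) _ hu hk

lemma djV_mollify {k u : Ev n → ℂ} (hk : ContDiff ℝ ∞ k) (hks : HasCompactSupport k)
    (hu : LocallyIntegrable u volume) (j : Fin n) (x : Ev n) :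
    djV n (mollify k u) j x = mollify (djV n k j) u x := by
  unfold djV mollify
  rw [(hks.hasFDerivAt_convolution_right (ContinuousLinearMap.mul ℝ ℂ) hu
    (hk.of_le (by simp)) x).fderiv,
    convolution_precompR_apply _ hu (hks.fderiv ℝ) (hk.continuous_fderiv (by simp))]

lemma lapV_mollify {k u : Ev n → ℂ} (hk : ContDiff ℝ ∞ k) (hks : HasCompactSupport k)
    (hu : LocallyIntegrable u volume) (x : Ev n) :
    lapV n (mollify k u) x = mollify (lapV n k) u x := by
  simp only [lapV, mollify_apply, Finset.mul_sum]
  rw [integral_finsetSum]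
  · refine Finset.sum_congr rfl fun j _ => ?_
    have : (fun w => djV n (mollify k u) j w) = mollify (djV n k j) u := by
      ext w
      exact djV_mollify hk hks hu j w
    rw [this, djV_mollify (hk.djV j) (hks.djV j) hu, mollify_apply]
  · intro j _
    exact integrable_mul_comp_sub ((hk.djV j).djV j).continuous ((hks.djV j).djV j) hu x

lemma djV_comp_sub {k : Ev n → ℂ} (hk : ContDiff ℝ ∞ k) (x : Ev n) (j : Fin n) (y : Ev n) :
    djV n (fun z => k (x - z)) j y = -djV n k j (x - y) := by
  unfold djV
  have h := (hk.differentiable (by simp) (x - y)).hasFDerivAt.comp y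
    ((hasFDerivAt_id y).const_sub x)
  rw [HasFDerivAt.fderiv (f := fun z => k (x - z)) h]
  simp

lemma lapV_comp_sub {k : Ev n → ℂ} (hk : ContDiff ℝ ∞ k) (x y : Ev n) :
    lapV n (fun z => k (x - z)) y = lapV n k (x - y) := by
  refine Finset.sum_congr rfl fun j _ => ?_
  have : (fun w => djV n (fun z => k (x - z)) j w)
      = fun w => (-1 : ℂ) * (fun z => djV n k j (x - z)) w := by
    ext w
    simp [djV_comp_sub hk]
  have hj : ContDiff ℝ ∞ (fun z => djV n k j (x - z)) :=
    (hk.djV j).comp (contDiff_const.sub contDiff_id)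
  rw [this, djV_const_mul hj, djV_comp_sub (hk.djV j)]
  simp

lemma isTestV_comp_sub {k : Ev n → ℂ} (hk : IsTestV n k) (x : Ev n) :
    IsTestV n (fun z => k (x - z)) :=
  ⟨hk.1.comp (contDiff_const.sub contDiff_id), hk.2.comp_homeomorph (Homeomorph.subLeft x)⟩

/-- Mollifying a distributional solution of `-Δu + qu = 0`. -/
lemma lapV_mollify_eq {k u q : Ev n → ℂ} (hk : IsTestV n k) (hq : Continuous q)
    (hu : LocallyIntegrable u volume)
    (h : ∀ φ, IsTestV n φ → ∫ v, u v * (-lapV n φ v + q v * φ v) = 0) (x : Ev n) :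
    lapV n (mollify k u) x = ∫ y, q y * (u y * k (x - y)) := by
  have hx := isTestV_comp_sub hk x
  have h0 := h _ hx
  simp only [lapV_comp_sub hk.1] at h0
  rw [lapV_mollify hk.1 hk.2 hu, mollify_apply]
  have h1 : Integrable (fun y => u y * lapV n k (x - y)) :=
    integrable_mul_comp_sub hk.1.lapV.continuous hk.2.lapV hu x
  have h2 : Integrable (fun y => q y * (u y * k (x - y))) := by
    have := hu.integrable_smul_right_of_hasCompactSupport (g := fun y => q y * k (x - y))
      (hq.mul hx.1.continuous) hx.2.mul_left
    refine this.congr (Eventually.of_forall fun y => ?_)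
    simp only [smul_eq_mul]
    ring
  have h3 : (fun v => u v * (-lapV n k (x - v) + q v * k (x - v)))
      = fun v => q v * (u v * k (x - v)) - u v * lapV n k (x - v) := by
    ext v
    ring
  rw [h3, integral_sub h2 h1] at h0
  exact (sub_eq_zero.mp h0).symm

end Mollification

section Uniqueness

variable {n : ℕ}

/-- The square of an average is at most the average of the squares. -/
lemma sq_integral_mul_le {X : Type*} [MeasurableSpace X] {μ : Measure X} {f ρ : X → ℝ}
    (hρ : ∀ x, 0 ≤ ρ x) (hρi : Integrable ρ μ) (hρ1 : ∫ x, ρ x ∂μ = 1)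
    (h1 : Integrable (fun x => f x * ρ x) μ) (h2 : Integrable (fun x => f x ^ 2 * ρ x) μ) :
    (∫ x, f x * ρ x ∂μ) ^ 2 ≤ ∫ x, f x ^ 2 * ρ x ∂μ := by
  set m := ∫ x, f x * ρ x ∂μ with hm
  have h0 : 0 ≤ ∫ x, (f x - m) ^ 2 * ρ x ∂μ :=
    integral_nonneg fun x => mul_nonneg (sq_nonneg _) (hρ x)
  have he : (fun x => (f x - m) ^ 2 * ρ x)
      = fun x => f x ^ 2 * ρ x - 2 * m * (f x * ρ x) + m ^ 2 * ρ x := by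
    ext x
    ring
  have hs : Integrable (fun x => f x ^ 2 * ρ x - 2 * m * (f x * ρ x)) μ := h2.sub (h1.const_mul _)
  rw [he, integral_add hs (hρi.const_mul _),
    integral_sub h2 (h1.const_mul _), integral_const_mul, integral_const_mul, hρ1, ← hm] at h0
  linarith

/-- Local energy estimate for a mollified solution of `-Δu + qu = 0`, `Re q ≥ 1`. -/
lemma integral_sq_mul_mollify_le {u q : Ev n → ℂ} (hu : MemLp u 2) (hq : Continuous q)
    (hq1 : ∀ v, 1 ≤ (q v).re)
    (h : ∀ φ, IsTestV n φ → ∫ v, u v * (-lapV n φ v + q v * φ v) = 0)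
    {χ : Ev n → ℝ} (hχ : ContDiff ℝ ∞ χ) (hχs : HasCompactSupport χ)
    (hχ1 : ∀ v, χ v ^ 2 ≤ 1) {D : ℝ}
    (hD : ∀ v j, ‖djV n (fun w => (χ w : ℂ)) j v‖ ≤ D) {L : ℝ}
    (hL : ∀ x y, χ x ≠ 0 → ‖x - y‖ ≤ 1 → ‖q y - q x‖ ≤ L * ‖x - y‖)
    (φ : ContDiffBump (0 : Ev n)) (hφ : φ.rOut ≤ 1) (hL0 : 0 ≤ L) :
    ∫ x, χ x ^ 2 * ‖mollify (fun y => (φ.normed volume y : ℂ)) u x‖ ^ 2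
      ≤ (L * φ.rOut + n * D ^ 2) * ∫ x, ‖u x‖ ^ 2 := by
  set ρ : Ev n → ℝ := φ.normed volume with hρdef
  set k : Ev n → ℂ := fun y => (ρ y : ℂ) with hkdef
  set w := mollify k u with hwdef
  have hρc : Continuous ρ := φ.continuous_normed
  have hρs : HasCompactSupport ρ := φ.hasCompactSupport_normed
  have hρ0 : ∀ x, 0 ≤ ρ x := φ.nonneg_normed
  have hk : IsTestV n k :=
    ⟨Complex.ofRealCLM.contDiff.comp (φ.contDiff_normed (n := ⊤)),
      hρs.comp_left (g := fun x : ℝ => (x : ℂ)) (by simp)⟩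
  have huL : LocallyIntegrable u volume := hu.locallyIntegrable (by norm_num)
  have hu2 : Integrable (fun x => ‖u x‖ ^ 2) := hu.integrable_norm_pow (by norm_num)
  have hw : ContDiff ℝ ∞ w := contDiff_mollify hk.1 hk.2 huL
  set A : Ev n → ℝ := fun x => ∫ y, ‖u y‖ * ρ (x - y) with hA
  set B : Ev n → ℝ := fun x => ∫ y, ‖u y‖ ^ 2 * ρ (x - y) with hB
  have hi1 : ∀ x, Integrable (fun y => ‖u y‖ * ρ (x - y)) :=
    integrable_mul_comp_sub hρc hρs (hu.norm.locallyIntegrable (by norm_num))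
  have hi2 : ∀ x, Integrable (fun y => ‖u y‖ ^ 2 * ρ (x - y)) :=
    integrable_mul_comp_sub hρc hρs hu2.locallyIntegrable
  have hBconv : B = convolution (fun y => ‖u y‖ ^ 2) ρ (ContinuousLinearMap.mul ℝ ℝ) volume := by
    ext x
    simp [hB, convolution_def]
  have hBi : Integrable B := by
    rw [hBconv]
    exact hu2.integrable_convolution _ φ.integrable_normed
  have hBint : ∫ x, B x = ∫ x, ‖u x‖ ^ 2 := by
    rw [hBconv, integral_convolution _ hu2 φ.integrable_normed, φ.integral_normed]
    simp
  have hAB : ∀ x, A x ^ 2 ≤ B x := fun x => by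
    refine sq_integral_mul_le (fun y => hρ0 _) (φ.integrable_normed.comp_sub_left x) ?_
      (hi1 x) (hi2 x)
    rw [integral_sub_left_eq_self (fun y => ρ y)]
    exact φ.integral_normed
  have hA0 : ∀ x, 0 ≤ A x := fun x =>
    integral_nonneg fun y => mul_nonneg (norm_nonneg _) (hρ0 _)
  have hwA : ∀ x, ‖w x‖ ≤ A x := fun x => by
    rw [hwdef, mollify_apply]
    refine norm_integral_le_of_norm_le (hi1 x) (Eventually.of_forall fun y => ?_)
    simp [hkdef, abs_of_nonneg (hρ0 _)]
  have hcomm : ∀ x, χ x ≠ 0 → ‖lapV n w x - q x * w x‖ ≤ L * φ.rOut * A x := by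
    intro x hx
    have hI1 : Integrable (fun y => u y * k (x - y)) :=
      integrable_mul_comp_sub hk.1.continuous hk.2 huL x
    have hI2 : Integrable (fun y => q y * (u y * k (x - y))) := by
      have hkx := isTestV_comp_sub hk x
      refine (huL.integrable_smul_right_of_hasCompactSupport (g := fun y => q y * k (x - y))
        (hq.mul hkx.1.continuous) hkx.2.mul_left).congr (Eventually.of_forall fun y => ?_)
      simp only [smul_eq_mul]
      ring
    rw [hwdef, lapV_mollify_eq hk hq huL h, mollify_apply, ← integral_const_mul,
      ← integral_sub hI2 (hI1.const_mul _), ← integral_const_mul]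
    refine norm_integral_le_of_norm_le ((hi1 x).const_mul _) (Eventually.of_forall fun y => ?_)
    rw [← sub_mul, norm_mul, norm_mul]
    have hkn : ‖k (x - y)‖ = ρ (x - y) := by simp [hkdef, abs_of_nonneg (hρ0 _)]
    rw [hkn]
    by_cases hxy : ρ (x - y) = 0
    · simp [hxy]
    · have hmem : x - y ∈ Function.support ρ := hxy
      rw [hρdef, φ.support_normed_eq, mem_ball_zero_iff] at hmem
      refine mul_le_mul_of_nonneg_right ?_ (mul_nonneg (norm_nonneg _) (hρ0 _))
      exact (hL x y hx (hmem.le.trans hφ)).trans (mul_le_mul_of_nonneg_left hmem.le hL0)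
  have hχc : ContDiff ℝ ∞ (fun v => (χ v : ℂ)) := Complex.ofRealCLM.contDiff.comp hχ
  have hχcs : HasCompactSupport (fun v => (χ v : ℂ)) :=
    hχs.comp_left (g := fun x : ℝ => (x : ℂ)) (by simp)
  have hgreen := integral_weight_mul_conj_mul_lapV (hχc.mul hχc) hw
    (Or.inl (hχcs.mul_left (f := fun v => (χ v : ℂ))))
  have hE : ∀ j, -(D ^ 2 * ∫ x, ‖u x‖ ^ 2) ≤
      (∫ v, ((χ v : ℂ) * χ v * (conj (djV n w j v) * djV n w j v)
        + djV n (fun v => (χ v : ℂ) * χ v) j v * (conj (w v) * djV n w j v))).re := by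
    intro j
    have hint : Integrable (fun v => (χ v : ℂ) * χ v * (conj (djV n w j v) * djV n w j v)
        + djV n (fun v => (χ v : ℂ) * χ v) j v * (conj (w v) * djV n w j v)) := by
      refine Continuous.integrable_of_hasCompactSupport ?_ ?_
      · exact (((hχc.mul hχc).mul ((hw.djV j).conj.mul (hw.djV j))).add
          (((hχc.mul hχc).djV j).mul (hw.conj.mul (hw.djV j)))).continuous
      · exact (hχcs.mul_left (f := fun v => (χ v : ℂ))).mul_right.add
          ((hχcs.mul_left (f := fun v => (χ v : ℂ))).djV j).mul_right
    rw [← hBint, ← integral_const_mul, ← integral_neg]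
    have hre := integral_re hint
    simp only [RCLike.re_to_complex] at hre
    rw [← hre]
    refine integral_mono (hBi.const_mul _).neg hint.re fun v => ?_
    beta_reduce
    rw [djV_mul hχc hχc]
    set z := djV n w j v
    set d := djV n (fun w => (χ w : ℂ)) j v with hd
    have h1 : (χ v : ℂ) * χ v * (conj z * z) = ((χ v ^ 2 * ‖z‖ ^ 2 : ℝ) : ℂ) := by
      rw [← Complex.normSq_eq_conj_mul_self, Complex.normSq_eq_norm_sq]
      push_cast
      ring
    have h2 : ‖(χ v * d + d * χ v) * (conj (w v) * z)‖ ≤ 2 * (|χ v| * D * (‖w v‖ * ‖z‖)) := by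
      rw [mul_comm d, ← two_mul, norm_mul, norm_mul, norm_mul, norm_mul]
      simp only [Complex.norm_real, Real.norm_eq_abs, RCLike.norm_conj, Complex.norm_ofNat]
      have := hD v j
      rw [← hd] at this
      have h3 : |χ v| * ‖d‖ * (‖w v‖ * ‖z‖) ≤ |χ v| * D * (‖w v‖ * ‖z‖) := by gcongr
      linarith
    have h3 := (abs_le.mp ((Complex.abs_re_le_norm _).trans h2)).1
    have h4 : ‖w v‖ ^ 2 ≤ B v := (pow_le_pow_left₀ (norm_nonneg _) (hwA v) 2).trans (hAB v)
    rw [h1, Complex.add_re, Complex.ofReal_re]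
    nlinarith [sq_nonneg (|χ v| * ‖z‖ - D * ‖w v‖), sq_abs (χ v),
      mul_le_mul_of_nonneg_left h4 (sq_nonneg D)]
  have hχ2 : Continuous fun v => χ v ^ 2 * ‖w v‖ ^ 2 := by
    have := hχ.continuous
    have := hw.continuous
    fun_prop
  have hχ2s : HasCompactSupport fun v => χ v ^ 2 * ‖w v‖ ^ 2 := by
    have : HasCompactSupport fun v => χ v ^ 2 := hχs.comp_left (g := fun t : ℝ => t ^ 2) (by simp)
    exact this.mul_right
  have hχ2i := hχ2.integrable_of_hasCompactSupport hχ2s (μ := volume)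
  have hlow : (∫ v, χ v ^ 2 * ‖w v‖ ^ 2) - L * φ.rOut * ∫ x, ‖u x‖ ^ 2 ≤
      (∫ v, (χ v : ℂ) * χ v * conj (w v) * lapV n w v).re := by
    have hint : Integrable (fun v => (χ v : ℂ) * χ v * conj (w v) * lapV n w v) :=
      (((hχc.mul hχc).mul hw.conj).mul hw.lapV).continuous.integrable_of_hasCompactSupport
        ((hχcs.mul_left (f := fun v => (χ v : ℂ))).mul_right.mul_right)
    rw [← hBint, ← integral_const_mul, ← integral_sub hχ2i (hBi.const_mul _)]
    have hre := integral_re hint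
    simp only [RCLike.re_to_complex] at hre
    rw [← hre]
    refine integral_mono (hχ2i.sub (hBi.const_mul _)) hint.re fun v => ?_
    beta_reduce
    by_cases hv : χ v = 0
    · have : 0 ≤ B v := (sq_nonneg _).trans (hAB v)
      have : 0 ≤ L * φ.rOut * B v := mul_nonneg (mul_nonneg hL0 φ.rOut_pos.le) this
      simp [hv, this]
    set c := lapV n w v - q v * w v with hc
    have h1 : (χ v : ℂ) * χ v * conj (w v) * lapV n w v
        = ((χ v ^ 2 : ℝ) : ℂ) * (((‖w v‖ ^ 2 : ℝ) : ℂ) * q v + conj (w v) * c) := by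
      rw [hc, ← Complex.normSq_eq_norm_sq, Complex.normSq_eq_conj_mul_self]
      push_cast
      ring
    have h2 : ‖conj (w v) * c‖ ≤ A v * (L * φ.rOut * A v) := by
      rw [norm_mul, RCLike.norm_conj]
      exact mul_le_mul (hwA v) (hcomm v hv) (norm_nonneg _) (hA0 v)
    have h3 := (abs_le.mp ((Complex.abs_re_le_norm _).trans h2)).1
    have h4 : A v * (L * φ.rOut * A v) ≤ L * φ.rOut * B v := by
      have := mul_le_mul_of_nonneg_left (hAB v) (mul_nonneg hL0 φ.rOut_pos.le)
      linarith
    rw [h1, Complex.re_ofReal_mul, Complex.add_re, Complex.re_ofReal_mul]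
    have h5 := mul_le_mul_of_nonneg_left (hq1 v) (sq_nonneg ‖w v‖)
    have h6 : 0 ≤ L * φ.rOut * B v :=
      mul_nonneg (mul_nonneg hL0 φ.rOut_pos.le) ((sq_nonneg _).trans (hAB v))
    have h7 : ‖w v‖ ^ 2 - L * φ.rOut * B v ≤ ‖w v‖ ^ 2 * (q v).re + (conj (w v) * c).re := by
      linarith
    have h8 := mul_le_mul_of_nonneg_left h7 (sq_nonneg (χ v))
    have h9 := mul_le_mul_of_nonneg_right (hχ1 v) h6
    linarith
  rw [hgreen, Complex.neg_re, Complex.re_sum] at hlow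
  have hsum := Finset.sum_le_sum fun j (_ : j ∈ Finset.univ) => hE j
  simp only [Finset.sum_const, Finset.card_univ, Fintype.card_fin, nsmul_eq_mul] at hsum
  linarith


/-- Fatou's lemma for Bochner integrals of nonnegative functions. -/
lemma integral_le_of_tendsto_ae {X : Type*} [MeasurableSpace X] {μ : Measure X}
    {f : ℕ → X → ℝ} {g : X → ℝ} {c : ℕ → ℝ} {c₀ : ℝ} (hf : ∀ k, Integrable (f k) μ)
    (hf0 : ∀ k x, 0 ≤ f k x) (hg : Integrable g μ) (hg0 : ∀ x, 0 ≤ g x)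
    (h : ∀ᵐ x ∂μ, Tendsto (fun k => f k x) atTop (𝓝 (g x)))
    (hc : Tendsto c atTop (𝓝 c₀)) (hfc : ∀ k, ∫ x, f k x ∂μ ≤ c k) : ∫ x, g x ∂μ ≤ c₀ := by
  have hc0 : 0 ≤ c₀ := ge_of_tendsto' hc fun k => (integral_nonneg (hf0 k)).trans (hfc k)
  rw [← ENNReal.ofReal_le_ofReal_iff hc0,
    ofReal_integral_eq_lintegral_ofReal hg (Eventually.of_forall hg0)]
  have h1 : ∫⁻ x, ENNReal.ofReal (g x) ∂μ
      = ∫⁻ x, liminf (fun k => ENNReal.ofReal (f k x)) atTop ∂μ := by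
    refine lintegral_congr_ae (h.mono fun x hx => ?_)
    exact ((ENNReal.continuous_ofReal.tendsto _).comp hx).liminf_eq.symm
  rw [h1]
  refine (lintegral_liminf_le' fun k => (hf k).aemeasurable.ennreal_ofReal).trans ?_
  have h2 : Tendsto (fun k => ENNReal.ofReal (c k)) atTop (𝓝 (ENNReal.ofReal c₀)) :=
    (ENNReal.continuous_ofReal.tendsto _).comp hc
  rw [← h2.liminf_eq]
  refine liminf_le_liminf (Eventually.of_forall fun k => ?_)
  rw [← ofReal_integral_eq_lintegral_ofReal (hf k) (Eventually.of_forall (hf0 k))]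
  exact ENNReal.ofReal_le_ofReal (hfc k)

lemma exists_lipschitz_near_support {q : Ev n → ℂ} (hq : ContDiff ℝ ∞ q) {χ : Ev n → ℝ}
    (hχs : HasCompactSupport χ) :
    ∃ L, 0 ≤ L ∧ ∀ x y, χ x ≠ 0 → ‖x - y‖ ≤ 1 → ‖q y - q x‖ ≤ L * ‖x - y‖ := by
  obtain ⟨R, hR⟩ := hχs.isCompact.isBounded.subset_closedBall (0 : Ev n)
  obtain ⟨L, hL⟩ := (isCompact_closedBall (0 : Ev n) (R + 1)).exists_bound_of_continuousOn
    (hq.continuous_fderiv (by simp)).continuousOn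
  refine ⟨max L 0, le_max_right _ _, fun x y hx hxy => ?_⟩
  have hxR : ‖x‖ ≤ R := by simpa using hR (subset_tsupport χ hx)
  have hy : ‖y‖ ≤ R + 1 := by
    have := norm_sub_norm_le y x
    rw [norm_sub_rev] at this
    linarith
  rw [norm_sub_rev x y]
  refine (convex_closedBall (0 : Ev n) (R + 1)).norm_image_sub_le_of_norm_fderiv_le (𝕜 := ℝ)
    (fun z _ => hq.differentiable (by simp) z) (fun z hz => (hL z hz).trans (le_max_left _ _))
    ?_ ?_
  · simpa using by linarith
  · simpa using hy

lemma integral_sq_mul_le {u q : Ev n → ℂ} (hu : MemLp u 2) (hq : ContDiff ℝ ∞ q)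
    (hq1 : ∀ v, 1 ≤ (q v).re)
    (h : ∀ φ, IsTestV n φ → ∫ v, u v * (-lapV n φ v + q v * φ v) = 0)
    {χ : Ev n → ℝ} (hχ : ContDiff ℝ ∞ χ) (hχs : HasCompactSupport χ)
    (hχ1 : ∀ v, χ v ^ 2 ≤ 1) {D : ℝ}
    (hD : ∀ v j, ‖djV n (fun w => (χ w : ℂ)) j v‖ ≤ D) :
    ∫ x, χ x ^ 2 * ‖u x‖ ^ 2 ≤ n * D ^ 2 * ∫ x, ‖u x‖ ^ 2 := by
  obtain ⟨L, hL0, hL⟩ := exists_lipschitz_near_support hq hχs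
  have huL : LocallyIntegrable u volume := hu.locallyIntegrable (by norm_num)
  have hu2 : Integrable (fun x => ‖u x‖ ^ 2) := hu.integrable_norm_pow (by norm_num)
  let φ : ℕ → ContDiffBump (0 : Ev n) := fun k =>
    ⟨1 / (k + 2), 2 / (k + 2), by positivity, by gcongr; norm_num⟩
  have hφ1 : ∀ k, (φ k).rOut ≤ 1 := fun k => by
    change (2 : ℝ) / (k + 2) ≤ 1
    rw [div_le_one (by positivity)]
    linarith [(Nat.cast_nonneg k : (0 : ℝ) ≤ k)]
  have hφ0 : Tendsto (fun k => (φ k).rOut) atTop (𝓝 0) := by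
    change Tendsto (fun k : ℕ => (2 : ℝ) / (k + 2)) atTop (𝓝 0)
    exact tendsto_const_nhds.div_atTop
      (tendsto_atTop_add_const_right _ _ tendsto_natCast_atTop_atTop)
  have hconv := ContDiffBump.ae_convolution_tendsto_right_of_locallyIntegrable (K := 2) hφ0
    (Eventually.of_forall fun k => by
      change (2 : ℝ) / (k + 2) ≤ 2 * (1 / (k + 2))
      rw [mul_one_div]) huL
  have hm : ∀ k x, convolution ((φ k).normed volume) u (ContinuousLinearMap.lsmul ℝ ℝ) volume x
      = mollify (fun y => ((φ k).normed volume y : ℂ)) u x := fun k x => by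
    rw [convolution_lsmul_swap, mollify_apply]
    refine integral_congr_ae (Eventually.of_forall fun y => ?_)
    simp [mul_comm]
  simp only [hm] at hconv
  have hχc := hχ.continuous
  have hsq : HasCompactSupport fun v => χ v ^ 2 :=
    hχs.comp_left (g := fun t : ℝ => t ^ 2) (by simp)
  refine integral_le_of_tendsto_ae
    (f := fun k x => χ x ^ 2 * ‖mollify (fun y => ((φ k).normed volume y : ℂ)) u x‖ ^ 2)
    (c := fun k => (L * (φ k).rOut + n * D ^ 2) * ∫ x, ‖u x‖ ^ 2)
    (fun k => ?_) (fun k x => by positivity) ?_ (fun x => by positivity) ?_ ?_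
    (fun k => integral_sq_mul_mollify_le hu hq.continuous hq1 h hχ hχs hχ1 hD hL (φ k) (hφ1 k) hL0)
  · have hw : Continuous (mollify (fun y => ((φ k).normed volume y : ℂ)) u) :=
      (contDiff_mollify (Complex.ofRealCLM.contDiff.comp ((φ k).contDiff_normed (n := ⊤)))
        ((φ k).hasCompactSupport_normed.comp_left (g := fun x : ℝ => (x : ℂ)) (by simp))
        huL).continuous
    exact Continuous.integrable_of_hasCompactSupport (by fun_prop) hsq.mul_right
  · refine hu2.mono' ((by fun_prop : Continuous fun x => χ x ^ 2).aestronglyMeasurable.mul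
      hu2.aestronglyMeasurable) (Eventually.of_forall fun x => ?_)
    rw [Real.norm_of_nonneg (by positivity)]
    exact mul_le_of_le_one_left (by positivity) (hχ1 x)
  · filter_upwards [hconv] with x hx
    exact (hx.norm.pow 2).const_mul _
  · have := ((hφ0.const_mul L).add_const (n * D ^ 2)).mul_const (∫ x, ‖u x‖ ^ 2)
    simpa using this

/-- An `L²` distributional solution of `-Δu + qu = 0` with `Re q ≥ 1` vanishes. -/
theorem ae_eq_zero_of_distributional {u q : Ev n → ℂ} (hu : MemLp u 2) (hq : ContDiff ℝ ∞ q)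
    (hq1 : ∀ v, 1 ≤ (q v).re)
    (h : ∀ φ, IsTestV n φ → ∫ v, u v * (-lapV n φ v + q v * φ v) = 0) :
    u =ᵐ[volume] 0 := by
  have hu2 : Integrable (fun x => ‖u x‖ ^ 2) := hu.integrable_norm_pow (by norm_num)
  let b : ContDiffBump (0 : Ev n) := ⟨1, 2, by norm_num, by norm_num⟩
  have hb : ContDiff ℝ ∞ b := b.contDiff
  obtain ⟨M, hM⟩ := (b.hasCompactSupport.fderiv (𝕜 := ℝ)).exists_bound_of_continuous
    (hb.continuous_fderiv (by simp))
  let χ : ℕ → Ev n → ℝ := fun k v => b ((1 / ((k : ℝ) + 1)) • v)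
  have hχ : ∀ k, ContDiff ℝ ∞ (χ k) := fun k => hb.comp (contDiff_const_smul _)
  have hχs : ∀ k, HasCompactSupport (χ k) := fun k =>
    b.hasCompactSupport.comp_smul (by positivity)
  have hχ1 : ∀ k v, χ k v ^ 2 ≤ 1 := fun k v => pow_le_one₀ b.nonneg b.le_one
  have hD : ∀ k v j, ‖djV n (fun w => (χ k w : ℂ)) j v‖ ≤ 1 / ((k : ℝ) + 1) * M := by
    intro k v j
    rw [djV_ofReal ((hχ k).differentiable (by simp)), Complex.norm_real]
    have hf : fderiv ℝ (χ k) v = (1 / ((k : ℝ) + 1)) • fderiv ℝ b ((1 / ((k : ℝ) + 1)) • v) :=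
      fderiv_comp_smul _
    rw [hf]
    refine (ContinuousLinearMap.le_opNorm _ _).trans ?_
    rw [norm_smul, Real.norm_of_nonneg (by positivity), PiLp.norm_single, norm_one,
      mul_one]
    exact mul_le_mul_of_nonneg_left (hM _) (by positivity)
  have hzero : ∫ x, ‖u x‖ ^ 2 ≤ 0 := by
    refine integral_le_of_tendsto_ae (f := fun k x => χ k x ^ 2 * ‖u x‖ ^ 2)
      (c := fun k => n * (1 / ((k : ℝ) + 1) * M) ^ 2 * ∫ x, ‖u x‖ ^ 2)
      (fun k => ?_) (fun k x => by positivity) hu2 (fun x => by positivity) ?_ ?_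
      (fun k => integral_sq_mul_le hu hq hq1 h (hχ k) (hχs k) (hχ1 k) (hD k))
    · have := (hχ k).continuous
      refine hu2.mono' ((by fun_prop : Continuous fun x => χ k x ^ 2).aestronglyMeasurable.mul
        hu2.aestronglyMeasurable) (Eventually.of_forall fun x => ?_)
      rw [Real.norm_of_nonneg (by positivity)]
      exact mul_le_of_le_one_left (by positivity) (hχ1 k x)
    · refine Eventually.of_forall fun x => ?_
      have h1 : Tendsto (fun k : ℕ => (1 / ((k : ℝ) + 1)) • x) atTop (𝓝 0) := by
        simpa using (tendsto_one_div_add_atTop_nhds_zero_nat (𝕜 := ℝ)).smul_const x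
      have h2 : Tendsto (fun k => χ k x) atTop (𝓝 1) := by
        have := (b.continuous.tendsto 0).comp h1
        rwa [b.one_of_mem_closedBall (by simp [b.rIn_pos.le])] at this
      simpa using (h2.pow 2).mul_const (‖u x‖ ^ 2)
    · have h0 : (0 : ℝ) = n * (0 * M) ^ 2 * ∫ x, ‖u x‖ ^ 2 := by ring
      rw [h0]
      exact ((((tendsto_one_div_add_atTop_nhds_zero_nat (𝕜 := ℝ)).mul_const M).pow 2).const_mul
        (n : ℝ)).mul_const (∫ x, ‖u x‖ ^ 2)
  have h0 := (integral_eq_zero_iff_of_nonneg (fun x => by positivity) hu2).mp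
    (hzero.antisymm (integral_nonneg fun x => by positivity))
  filter_upwards [h0] with x hx
  exact norm_eq_zero.mp (pow_eq_zero_iff two_ne_zero |>.mp hx)

end Uniqueness

section HilbertEstimate

/-- The scalar interpolation argument behind the subelliptic gain `r² = |ξ|^{2/3}`. -/
lemma subelliptic_interpolation {F N G Z h r : ℝ} (hF : 0 ≤ F) (hN : 0 ≤ N) (hG : 0 ≤ G)
    (hr : 0 ≤ r) (h1 : G ^ 2 + N ^ 2 ≤ N * F)
    (h2 : h ^ 2 + Z ^ 2 ≤ F ^ 2 + 2 * (r ^ 3 * G * N))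
    (h3 : (r ^ 3) ^ 2 * N ^ 2 ≤ 2 * (Z * (r ^ 3 * G))) :
    N ≤ F ∧ r ^ 2 * N ≤ 100 * F ∧ h ^ 2 + Z ^ 2 ≤ 2001 * F ^ 2 := by
  have hNF : N ≤ F := by
    rcases hN.eq_or_lt with h0 | h0
    · rwa [← h0]
    · exact le_of_mul_le_mul_left (by nlinarith [sq_nonneg G]) h0
  have hGNF : G ^ 2 ≤ N * F := by nlinarith [sq_nonneg N]
  have hrN : r ^ 2 * N ≤ 100 * F := by
    by_contra! hcon
    have hN0 : 0 < N := by
      rcases hN.eq_or_lt with h0 | h0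
      · rw [← h0] at hcon
        linarith
      · exact h0
    have hr0 : 0 < r := by
      rcases hr.eq_or_lt with h0 | h0
      · rw [← h0] at hcon
        linarith
      · exact h0
    have hGr : G ≤ r * N / 10 := by
      refine abs_le_of_sq_le_sq' ?_ (by positivity) |>.2
      nlinarith
    have hFr : F ^ 2 ≤ (r ^ 2 * N / 100) ^ 2 := pow_le_pow_left₀ hF (by linarith) 2
    have hmul : r ^ 3 * G * N ≤ r ^ 3 * (r * N / 10) * N := by gcongr
    have hZ : Z ≤ r ^ 2 * N / 2 := by
      refine abs_le_of_sq_le_sq' ?_ (by positivity) |>.2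
      have : 0 ≤ (r ^ 2 * N) ^ 2 := sq_nonneg _
      nlinarith [sq_nonneg h]
    have hZG : Z * (r ^ 3 * G) ≤ (r ^ 2 * N / 2) * (r ^ 3 * (r * N / 10)) := by gcongr
    have hpos : 0 < (r ^ 3) ^ 2 * N ^ 2 := by positivity
    nlinarith
  have haGN : r ^ 3 * G * N ≤ 1000 * F ^ 2 := by
    refine abs_le_of_sq_le_sq' ?_ (by positivity) |>.2
    calc (r ^ 3 * G * N) ^ 2 = (r ^ 3) ^ 2 * N ^ 2 * G ^ 2 := by ring
      _ ≤ (r ^ 3) ^ 2 * N ^ 2 * (N * F) := by gcongr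
      _ = (r ^ 2 * N) ^ 3 * F := by ring
      _ ≤ (100 * F) ^ 3 * F := by gcongr
      _ = (1000 * F ^ 2) ^ 2 := by ring
  exact ⟨hNF, hrN, by linarith⟩

variable {H : Type*} [NormedAddCommGroup H] [InnerProductSpace ℂ H]

lemma abs_sum_mul_re_inner_le {n : ℕ} (ξ : Ev n) (z : H) (d : Fin n → H) (s : Fin n → ℝ)
    (hs : ∀ j, |s j| ≤ ‖⟪z, d j⟫_ℂ‖) :
    |∑ j, ξ j * s j| ≤ ‖z‖ * (‖ξ‖ * √(∑ j, ‖d j‖ ^ 2)) := by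
  calc |∑ j, ξ j * s j| ≤ ∑ j, |ξ j| * (‖z‖ * ‖d j‖) := by
        refine (Finset.abs_sum_le_sum_abs _ _).trans (Finset.sum_le_sum fun j _ => ?_)
        rw [abs_mul]
        exact mul_le_mul_of_nonneg_left ((hs j).trans (norm_inner_le_norm _ _)) (abs_nonneg _)
    _ = ‖z‖ * ∑ j, |ξ j| * ‖d j‖ := by
        rw [Finset.mul_sum]
        exact Finset.sum_congr rfl fun j _ => by ring
    _ ≤ ‖z‖ * (√(∑ j, |ξ j| ^ 2) * √(∑ j, ‖d j‖ ^ 2)) := by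
        gcongr
        exact Real.sum_mul_le_sqrt_mul_sqrt _ _ _
    _ = ‖z‖ * (‖ξ‖ * √(∑ j, ‖d j‖ ^ 2)) := by
        rw [EuclideanSpace.norm_eq]
        simp only [Real.norm_eq_abs]

lemma re_im_quarter_mul (w : ℂ) :
    ((1 / 4 : ℂ) * w).re = w.re / 4 ∧ ((1 / 4 : ℂ) * w).im = w.im / 4 := by
  have : (1 / 4 : ℂ) = ((1 / 4 : ℝ) : ℂ) := by push_cast; rfl
  rw [this, Complex.re_ofReal_mul, Complex.im_ofReal_mul]
  constructor <;> ring

lemma energy_le {x z b c : H} {g : ℝ} (hxb : (⟪x, b⟫_ℂ).re = g) (hxc : 0 ≤ (⟪x, c⟫_ℂ).re)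
    (hzx : (⟪z, x⟫_ℂ).im = 0) :
    g + ‖x‖ ^ 2 ≤ ‖x‖ * ‖b + (1 / 4 : ℂ) • c + x + Complex.I • z‖ := by
  have hxz : (⟪x, z⟫_ℂ).im = 0 := by
    rw [← inner_conj_symm, Complex.conj_im, hzx, neg_zero]
  have hxx : (⟪x, x⟫_ℂ).re = ‖x‖ ^ 2 := by
    rw [inner_self_eq_norm_sq_to_K]
    norm_cast
  have h0 := re_inner_le_norm (𝕜 := ℂ) x (b + (1 / 4 : ℂ) • c + x + Complex.I • z)
  simp only [inner_add_right, inner_smul_right, RCLike.re_to_complex, Complex.add_re,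
    (re_im_quarter_mul _).1, Complex.I_mul_re, hxz, hxb, hxx] at h0
  linarith

lemma norm_sq_add_I_smul {x z b c : H} {s : ℝ} (hzx : (⟪z, x⟫_ℂ).im = 0)
    (hzc : (⟪z, c⟫_ℂ).im = 0) (hzb : (⟪z, b⟫_ℂ).im = s) :
    ‖b + (1 / 4 : ℂ) • c + x + Complex.I • z‖ ^ 2
      = ‖b + (1 / 4 : ℂ) • c + x‖ ^ 2 + 2 * s + ‖z‖ ^ 2 := by
  have e := norm_add_sq (𝕜 := ℂ) (b + (1 / 4 : ℂ) • c + x) (Complex.I • z)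
  have e2 : (⟪b + (1 / 4 : ℂ) • c + x, Complex.I • z⟫_ℂ).re = s := by
    rw [inner_smul_right, Complex.I_mul_re, ← inner_conj_symm, Complex.conj_im, neg_neg,
      inner_add_right, inner_add_right, inner_smul_right, Complex.add_im, Complex.add_im,
      (re_im_quarter_mul _).2, hzx, hzc, hzb]
    ring
  rw [RCLike.re_to_complex, e2, norm_smul, Complex.norm_I, one_mul] at e
  exact e

lemma norm_sq_add_norm_sq_le {b c : H} {m : ℝ} (hcb : -m ≤ (⟪c, b⟫_ℂ).re) :
    ‖b‖ ^ 2 + ‖c‖ ^ 2 / 16 ≤ ‖b + (1 / 4 : ℂ) • c‖ ^ 2 + m / 2 := by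
  have e := norm_add_sq (𝕜 := ℂ) b ((1 / 4 : ℂ) • c)
  have e1 : (⟪b, c⟫_ℂ).re = (⟪c, b⟫_ℂ).re := by
    rw [← inner_conj_symm, Complex.conj_re]
  have e3 : ‖(1 / 4 : ℂ)‖ = 1 / 4 := by norm_num
  rw [inner_smul_right, norm_smul, RCLike.re_to_complex, (re_im_quarter_mul _).1, e1, e3] at e
  have e4 : (1 / 4 * ‖c‖) ^ 2 = ‖c‖ ^ 2 / 16 := by ring
  linarith

/-- The scalar bookkeeping at the end of `hilbert_maximal_estimate`. -/
lemma le_of_sq_add_sq_le {n F N h e β γ : ℝ} (hn : 0 ≤ n) (hF : 0 ≤ F) (hN : 0 ≤ N)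
    (he : 0 ≤ e) (hNF : N ≤ F) (hhF : h ≤ 45 * F) (heh : e ≤ h + N)
    (hβγ : β ^ 2 + γ ^ 2 / 16 ≤ e ^ 2 + n * N ^ 2 / 2) :
    β ≤ (50 + n) * F ∧ γ ≤ 4 * (50 + n) * F := by
  have h1 : e ^ 2 ≤ (46 * F) ^ 2 := pow_le_pow_left₀ he (by linarith) 2
  have h2 : n * N ^ 2 ≤ n * F ^ 2 := mul_le_mul_of_nonneg_left (pow_le_pow_left₀ hN hNF 2) hn
  have h3 := mul_nonneg hn (sq_nonneg F)
  have h4 := mul_nonneg (mul_nonneg hn hn) (sq_nonneg F)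
  have h5 := sq_nonneg F
  have hsq : β ^ 2 + γ ^ 2 / 16 ≤ ((50 + n) * F) ^ 2 := by
    have : ((50 + n) * F) ^ 2 = 2500 * F ^ 2 + 100 * (n * F ^ 2) + n * n * F ^ 2 := by ring
    linarith
  refine ⟨(abs_le_of_sq_le_sq' (by linarith [sq_nonneg γ]) (by positivity)).2,
    (abs_le_of_sq_le_sq' ?_ (by positivity)).2⟩
  have : (4 * (50 + n) * F) ^ 2 = 16 * ((50 + n) * F) ^ 2 := by ring
  linarith [sq_nonneg β]

/-- Abstract form of the maximal estimate: `x = φ`, `d j = ∂ⱼφ`, `z = Vφ`, `b = -Δφ`,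
`c = |v|²φ` with `V = v·ξ - λ`. -/
lemma hilbert_maximal_estimate {n : ℕ} (ξ : Ev n) {x z b c : H} {d : Fin n → H} {r : ℝ}
    (hr : 0 ≤ r) (hrξ : r ^ 3 = ‖ξ‖)
    (hxb : (⟪x, b⟫_ℂ).re = ∑ j, ‖d j‖ ^ 2) (hxc : 0 ≤ (⟪x, c⟫_ℂ).re)
    (hzx : (⟪z, x⟫_ℂ).im = 0) (hzc : (⟪z, c⟫_ℂ).im = 0)
    (hzb : (⟪z, b⟫_ℂ).im = ∑ j, ξ j * (⟪x, d j⟫_ℂ).im)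
    (hzd : ∑ j, ξ j * (⟪z, d j⟫_ℂ).re = -(‖ξ‖ ^ 2 * ‖x‖ ^ 2 / 2))
    (hcb : -(n * ‖x‖ ^ 2) ≤ (⟪c, b⟫_ℂ).re) {F : ℝ}
    (hF : ‖b + (1 / 4 : ℂ) • c + x + Complex.I • z‖ = F) :
    ‖x‖ ≤ F ∧ r ^ 2 * ‖x‖ ≤ 100 * F ∧ ‖z‖ ≤ 45 * F ∧ ‖b‖ ≤ (50 + n) * F
      ∧ ‖c‖ ≤ 4 * (50 + n) * F := by
  have hF0 : 0 ≤ F := hF ▸ norm_nonneg _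
  have hG2 : √(∑ j, ‖d j‖ ^ 2) ^ 2 = ∑ j, ‖d j‖ ^ 2 :=
    Real.sq_sqrt (Finset.sum_nonneg fun j _ => sq_nonneg _)
  have h1 := energy_le hxb hxc hzx
  have h2 := norm_sq_add_I_smul hzx hzc hzb
  have h3 := norm_sq_add_norm_sq_le hcb
  have h4 := (abs_le.mp (abs_sum_mul_re_inner_le ξ x d (fun j => (⟪x, d j⟫_ℂ).im)
    fun j => Complex.abs_im_le_norm _)).1
  have h5 := (abs_le.mp (abs_sum_mul_re_inner_le ξ z d (fun j => (⟪z, d j⟫_ℂ).re)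
    fun j => Complex.abs_re_le_norm _)).1
  have h6 : ‖b + (1 / 4 : ℂ) • c‖ ≤ ‖b + (1 / 4 : ℂ) • c + x‖ + ‖x‖ := by
    simpa using norm_sub_le (b + (1 / 4 : ℂ) • c + x) x
  rw [← hG2, hF] at h1
  rw [hF] at h2
  rw [hzd, ← hrξ] at h5
  rw [← hrξ] at h4
  obtain ⟨hNF, hrN, hhZ⟩ := subelliptic_interpolation hF0 (norm_nonneg x)
    (Real.sqrt_nonneg (∑ j, ‖d j‖ ^ 2)) hr h1 (h := ‖b + (1 / 4 : ℂ) • c + x‖) (Z := ‖z‖)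
    (by linarith) (by linarith)
  have h7 : (45 * F) ^ 2 = 2025 * F ^ 2 := by ring
  have h8 := sq_nonneg F
  have hZ : ‖z‖ ≤ 45 * F := (abs_le_of_sq_le_sq'
    (by linarith [sq_nonneg ‖b + (1 / 4 : ℂ) • c + x‖]) (by positivity)).2
  have hhF : ‖b + (1 / 4 : ℂ) • c + x‖ ≤ 45 * F := (abs_le_of_sq_le_sq'
    (by linarith [sq_nonneg ‖z‖]) (by positivity)).2
  exact ⟨hNF, hrN, hZ, le_of_sq_add_sq_le (Nat.cast_nonneg n) hF0 (norm_nonneg x)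
    (norm_nonneg _) hNF hhF h6 h3⟩

end HilbertEstimate

section TestFunctions

variable {n : ℕ}

/-- Test functions as a complex vector space. -/
def testV (n : ℕ) : Submodule ℂ (Ev n → ℂ) where
  carrier := {f | IsTestV n f}
  add_mem' hf hg := ⟨hf.1.add hg.1, hf.2.add hg.2⟩
  zero_mem' := ⟨contDiff_const, HasCompactSupport.zero⟩
  smul_mem' c _ hf := ⟨contDiff_const.mul hf.1, hf.2.mul_left (f := fun _ => c)⟩

lemma IsTestV.memLp {f : Ev n → ℂ} (hf : IsTestV n f) : MemLp f 2 volume :=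
  hf.1.continuous.memLp_of_hasCompactSupport hf.2

/-- The inclusion of test functions in `L²`. -/
def toHV (n : ℕ) : testV n →ₗ[ℂ] HV n where
  toFun φ := φ.2.memLp.toLp φ
  map_add' φ ψ := MemLp.toLp_add φ.2.memLp ψ.2.memLp
  map_smul' c φ := MemLp.toLp_const_smul c φ.2.memLp

/-- Multiplication by a smooth function on test functions. -/
def mulT {p : Ev n → ℂ} (hp : ContDiff ℝ ∞ p) : testV n →ₗ[ℂ] testV n where
  toFun φ := ⟨fun v => p v * φ.1 v, hp.mul φ.2.1, φ.2.2.mul_left⟩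
  map_add' φ ψ := by
    ext v
    exact mul_add _ _ _
  map_smul' c φ := by
    ext v
    exact mul_left_comm _ _ _

/-- The `j`-th partial derivative on test functions. -/
def djT (n : ℕ) (j : Fin n) (φ : testV n) : testV n :=
  ⟨djV n φ.1 j, φ.2.1.djV j, φ.2.2.djV j⟩

/-- The Laplacian on test functions. -/
def lapT (n : ℕ) : testV n →ₗ[ℂ] testV n where
  toFun φ := ⟨lapV n φ.1, φ.2.1.lapV, φ.2.2.lapV⟩
  map_add' φ ψ := by
    ext v
    exact lapV_add φ.2.1 ψ.2.1 v
  map_smul' c φ := by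
    ext v
    exact lapV_const_mul φ.2.1 c v

/-- Complex conjugation on test functions. -/
def conjT (φ : testV n) : testV n := ⟨fun v => conj (φ.1 v), φ.2.1.conj, φ.2.2.conj⟩

lemma coeFn_toHV (φ : testV n) : toHV n φ =ᵐ[volume] φ.1 :=
  φ.2.memLp.coeFn_toLp

lemma inner_toHV_left (φ : testV n) (f : HV n) :
    ⟪toHV n φ, f⟫_ℂ = ∫ v, f v * conj (φ.1 v) := by
  rw [L2.inner_def]
  refine integral_congr_ae ?_
  filter_upwards [coeFn_toHV φ] with v hv
  rw [hv]
  rfl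

lemma inner_toHV (φ ψ : testV n) :
    ⟪toHV n φ, toHV n ψ⟫_ℂ = ∫ v, conj (φ.1 v) * ψ.1 v := by
  rw [inner_toHV_left]
  refine integral_congr_ae ?_
  filter_upwards [coeFn_toHV ψ] with v hv
  rw [hv, mul_comm]

lemma inner_toHV_conjT (φ : testV n) (f : HV n) :
    ⟪toHV n (conjT φ), f⟫_ℂ = ∫ v, f v * φ.1 v := by
  rw [inner_toHV_left]
  simp [conjT]

lemma norm_toHV_conjT (φ : testV n) : ‖toHV n (conjT φ)‖ = ‖toHV n φ‖ := by
  refine le_antisymm (Lp.norm_le_norm_of_ae_le ?_) (Lp.norm_le_norm_of_ae_le ?_) <;>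
  · filter_upwards [coeFn_toHV φ, coeFn_toHV (conjT φ)] with v h1 h2
    rw [h1, h2]
    simp [conjT]

lemma integral_conj_mul_self (φ : testV n) :
    ∫ v, conj (φ.1 v) * φ.1 v = ((‖toHV n φ‖ ^ 2 : ℝ) : ℂ) := by
  rw [← inner_toHV, inner_self_eq_norm_sq_to_K]
  norm_cast

lemma conj_mul_self_eq (z : ℂ) : conj z * z = ((‖z‖ ^ 2 : ℝ) : ℂ) := by
  rw [← Complex.normSq_eq_conj_mul_self, Complex.normSq_eq_norm_sq]

lemma im_integral_weight_mul (p : Ev n → ℝ) (φ : Ev n → ℂ) :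
    (∫ v, (p v : ℂ) * (conj (φ v) * φ v)).im = 0 := by
  simp only [conj_mul_self_eq, ← Complex.ofReal_mul]
  rw [integral_complex_ofReal]
  exact Complex.ofReal_im _

lemma re_integral_weight_mul_nonneg {p : Ev n → ℝ} (hp : ∀ v, 0 ≤ p v) (φ : Ev n → ℂ) :
    0 ≤ (∫ v, (p v : ℂ) * (conj (φ v) * φ v)).re := by
  simp only [conj_mul_self_eq, ← Complex.ofReal_mul]
  rw [integral_complex_ofReal]
  exact integral_nonneg fun v => mul_nonneg (hp v) (sq_nonneg _)

/-- Commuting `∂ⱼ` with a weight whose `j`-th derivative is constant. -/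
lemma re_integral_weight_mul_djV {p : Ev n → ℝ} (hp : ContDiff ℝ ∞ p) {j : Fin n} {c : ℝ}
    (hc : ∀ v, djV n (fun w => (p w : ℂ)) j v = c) (φ : testV n) :
    (∫ v, (p v : ℂ) * (conj (φ.1 v) * djV n φ.1 j v)).re = -(c * ‖toHV n φ‖ ^ 2 / 2) := by
  have hpc : ContDiff ℝ ∞ fun v => (p v : ℂ) := Complex.ofRealCLM.contDiff.comp hp
  have hφ := φ.2
  have h1 := integral_mul_djV (hpc.mul hφ.1.conj) hφ.1 (Or.inr hφ.2) j
  have h2 : ∀ v, djV n (fun w => (p w : ℂ) * conj (φ.1 w)) j v * φ.1 v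
      = conj ((p v : ℂ) * (conj (φ.1 v) * djV n φ.1 j v)) + c * (conj (φ.1 v) * φ.1 v) := by
    intro v
    rw [djV_mul hpc hφ.1.conj, djV_conj, hc]
    simp only [map_mul, Complex.conj_conj, Complex.conj_ofReal]
    ring
  have h3 : Integrable fun v => (p v : ℂ) * (conj (φ.1 v) * djV n φ.1 j v) :=
    (hpc.mul (hφ.1.conj.mul (hφ.1.djV j))).continuous.integrable_of_hasCompactSupport
      hφ.2.conj.mul_right.mul_left
  have h4 : Integrable fun v => conj (φ.1 v) * φ.1 v :=
    (hφ.1.conj.mul hφ.1).continuous.integrable_of_hasCompactSupport hφ.2.mul_left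
  have h5 : Integrable fun v => conj ((p v : ℂ) * (conj (φ.1 v) * djV n φ.1 j v)) :=
    (hpc.mul (hφ.1.conj.mul (hφ.1.djV j))).conj.continuous.integrable_of_hasCompactSupport
      hφ.2.conj.mul_right.mul_left.conj
  simp only [h2, mul_assoc] at h1
  rw [integral_add h5 (h4.const_mul _), integral_conj, integral_const_mul,
    integral_conj_mul_self] at h1
  have h6 := congrArg Complex.re h1
  simp only [Complex.neg_re, Complex.add_re, Complex.conj_re, Complex.re_ofReal_mul,
    Complex.ofReal_re] at h6
  linarith

/-- Green's identity on test functions with a real weight. -/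
lemma inner_mulT_neg_lapT {p : Ev n → ℝ} (hp : ContDiff ℝ ∞ fun v => (p v : ℂ)) (φ : testV n) :
    ⟪toHV n (mulT hp φ), -toHV n (lapT n φ)⟫_ℂ =
      ∑ j, ((∫ v, (p v : ℂ) * (conj (djV n φ.1 j v) * djV n φ.1 j v))
        + ∫ v, djV n (fun w => (p w : ℂ)) j v * (conj (φ.1 v) * djV n φ.1 j v)) := by
  have hφ := φ.2
  rw [inner_neg_right, inner_toHV]
  have h := integral_weight_mul_conj_mul_lapV hp hφ.1 (Or.inr hφ.2)
  have h1 : ∀ v, conj ((mulT hp φ).1 v) * (lapT n φ).1 v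
      = (p v : ℂ) * conj (φ.1 v) * lapV n φ.1 v := fun v => by
    simp [mulT, lapT]
  simp only [h1]
  rw [h, neg_neg]
  refine Finset.sum_congr rfl fun j _ => integral_add ?_ ?_
  · exact (hp.mul ((hφ.1.djV j).conj.mul (hφ.1.djV j))).continuous.integrable_of_hasCompactSupport
      (hφ.2.djV j).mul_left.mul_left
  · exact ((hp.djV j).mul (hφ.1.conj.mul (hφ.1.djV j))).continuous.integrable_of_hasCompactSupport
      (hφ.2.djV j).mul_left.mul_left

lemma inner_toHV_mulT_self {p : Ev n → ℝ} (hp : ContDiff ℝ ∞ fun v => (p v : ℂ)) (φ : testV n) :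
    ⟪toHV n (mulT hp φ), toHV n φ⟫_ℂ = ∫ v, (p v : ℂ) * (conj (φ.1 v) * φ.1 v) := by
  rw [inner_toHV]
  simp [mulT, mul_assoc]

lemma inner_toHV_mulT_mulT {p q : Ev n → ℝ} (hp : ContDiff ℝ ∞ fun v => (p v : ℂ))
    (hq : ContDiff ℝ ∞ fun v => (q v : ℂ)) (φ : testV n) :
    ⟪toHV n (mulT hp φ), toHV n (mulT hq φ)⟫_ℂ
      = ∫ v, ((p v * q v : ℝ) : ℂ) * (conj (φ.1 v) * φ.1 v) := by
  rw [inner_toHV]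
  refine integral_congr_ae (Eventually.of_forall fun v => ?_)
  simp only [mulT, LinearMap.coe_mk, AddHom.coe_mk, map_mul, Complex.conj_ofReal,
    Complex.ofReal_mul]
  ring

end TestFunctions

section Operator

variable {n : ℕ}

/-- The real function `V = v·ξ - λ`. -/
def drift (ξ : Ev n) (lam : ℝ) (v : Ev n) : ℝ := ∑ j, v j * ξ j - lam

lemma contDiff_drift (ξ : Ev n) (lam : ℝ) : ContDiff ℝ ∞ (drift ξ lam) := by
  unfold drift
  fun_prop

lemma contDiff_ofReal_drift (ξ : Ev n) (lam : ℝ) :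
    ContDiff ℝ ∞ fun v => (drift ξ lam v : ℂ) :=
  Complex.ofRealCLM.contDiff.comp (contDiff_drift ξ lam)

lemma contDiff_ofReal_norm_sq : ContDiff ℝ ∞ fun v : Ev n => ((‖v‖ ^ 2 : ℝ) : ℂ) :=
  Complex.ofRealCLM.contDiff.comp (contDiff_norm_sq ℝ)

lemma djV_drift (ξ : Ev n) (lam : ℝ) (j : Fin n) (v : Ev n) :
    djV n (fun w => (drift ξ lam w : ℂ)) j v = (ξ j : ℝ) := by
  rw [djV_ofReal ((contDiff_drift ξ lam).differentiable (by simp))]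
  have h : drift ξ lam = fun w => innerSL ℝ ξ w - lam := by
    ext w
    simp [drift, PiLp.inner_apply]
  rw [h, fderiv_sub_const, ContinuousLinearMap.fderiv]
  simp [EuclideanSpace.inner_single_right]

lemma djV_norm_sq (j : Fin n) (v : Ev n) :
    djV n (fun w => ((‖w‖ ^ 2 : ℝ) : ℂ)) j v = (2 * v j : ℝ) := by
  rw [djV_ofReal ((contDiff_norm_sq ℝ (n := ∞)).differentiable (by simp)), fderiv_norm_sq_apply]
  simp [EuclideanSpace.inner_single_right]

lemma djV_two_mul_coord (j : Fin n) (v : Ev n) :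
    djV n (fun w => ((2 * w j : ℝ) : ℂ)) j v = (2 : ℝ) := by
  rw [djV_ofReal (by fun_prop)]
  have h : (fun w : Ev n => 2 * w j) = ⇑((2 : ℝ) • (EuclideanSpace.proj j : Ev n →L[ℝ] ℝ)) := by
    ext w
    simp
  rw [h, ContinuousLinearMap.fderiv]
  simp

lemma re_inner_toHV_neg_lapT (φ : testV n) :
    (⟪toHV n φ, -toHV n (lapT n φ)⟫_ℂ).re = ∑ j, ‖toHV n (djT n j φ)‖ ^ 2 := by
  have h := inner_mulT_neg_lapT (n := n) (p := fun _ => 1) contDiff_const φ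
  have h1 : mulT (n := n) (p := fun _ => ((1 : ℝ) : ℂ)) contDiff_const φ = φ := by
    ext v
    simp [mulT]
  rw [h1] at h
  have h2 : ∀ j v, djV n (fun _ => ((1 : ℝ) : ℂ)) j v = 0 := fun j v => by
    simp [djV]
  rw [h, Complex.re_sum]
  refine Finset.sum_congr rfl fun j _ => ?_
  have h3 := integral_conj_mul_self (djT n j φ)
  simp only [djT] at h3
  simp only [h2, zero_mul, integral_zero, add_zero]
  simp only [Complex.ofReal_one, one_mul, h3]
  exact Complex.ofReal_re _

lemma im_inner_drift_neg_lapT (ξ : Ev n) (lam : ℝ) (φ : testV n) :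
    (⟪toHV n (mulT (contDiff_ofReal_drift ξ lam) φ), -toHV n (lapT n φ)⟫_ℂ).im
      = ∑ j, ξ j * (⟪toHV n φ, toHV n (djT n j φ)⟫_ℂ).im := by
  rw [inner_mulT_neg_lapT, Complex.im_sum]
  refine Finset.sum_congr rfl fun j _ => ?_
  simp only [djV_drift]
  rw [Complex.add_im, im_integral_weight_mul, zero_add, integral_const_mul,
    Complex.im_ofReal_mul, inner_toHV]
  rfl

lemma sum_mul_re_inner_drift_djT (ξ : Ev n) (lam : ℝ) (φ : testV n) :
    ∑ j, ξ j * (⟪toHV n (mulT (contDiff_ofReal_drift ξ lam) φ), toHV n (djT n j φ)⟫_ℂ).re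
      = -(‖ξ‖ ^ 2 * ‖toHV n φ‖ ^ 2 / 2) := by
  have h : ∀ j, (⟪toHV n (mulT (contDiff_ofReal_drift ξ lam) φ), toHV n (djT n j φ)⟫_ℂ).re
      = -(ξ j * ‖toHV n φ‖ ^ 2 / 2) := fun j => by
    rw [← re_integral_weight_mul_djV (contDiff_drift ξ lam) (djV_drift ξ lam j) φ, inner_toHV]
    simp [mulT, djT, mul_assoc]
  simp only [h]
  rw [EuclideanSpace.real_norm_sq_eq, Finset.sum_mul, Finset.sum_div, ← Finset.sum_neg_distrib]
  exact Finset.sum_congr rfl fun j _ => by ring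

lemma neg_le_re_inner_norm_sq_neg_lapT (φ : testV n) :
    -(n * ‖toHV n φ‖ ^ 2)
      ≤ (⟪toHV n (mulT contDiff_ofReal_norm_sq φ), -toHV n (lapT n φ)⟫_ℂ).re := by
  rw [inner_mulT_neg_lapT, Complex.re_sum]
  have h : ∀ j ∈ Finset.univ, -‖toHV n φ‖ ^ 2 ≤
      ((∫ v, ((‖v‖ ^ 2 : ℝ) : ℂ) * (conj (djV n φ.1 j v) * djV n φ.1 j v))
        + ∫ v, djV n (fun w => ((‖w‖ ^ 2 : ℝ) : ℂ)) j v * (conj (φ.1 v) * djV n φ.1 j v)).re := by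
    intro j _
    simp only [djV_norm_sq]
    rw [Complex.add_re, re_integral_weight_mul_djV (by fun_prop) (djV_two_mul_coord j) φ]
    have := re_integral_weight_mul_nonneg (fun v : Ev n => sq_nonneg ‖v‖) (djV n φ.1 j)
    linarith
  simpa using Finset.sum_le_sum h

/-- The potential of `P̂₀(ξ) + n/2 + 1 - iλ`. -/
def pot (ξ : Ev n) (lam : ℝ) (v : Ev n) : ℂ :=
  ((‖v‖ ^ 2 / 4 + 1 : ℝ) : ℂ) + Complex.I * (drift ξ lam v : ℝ)

lemma contDiff_pot (ξ : Ev n) (lam : ℝ) : ContDiff ℝ ∞ (pot ξ lam) :=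
  (Complex.ofRealCLM.contDiff.comp (((contDiff_norm_sq ℝ).div_const 4).add contDiff_const)).add
    (contDiff_const.mul (contDiff_ofReal_drift ξ lam))

/-- The operator `P̂₀(ξ) + n/2 + 1 - iλ` on test functions. -/
def opT (ξ : Ev n) (lam : ℝ) : testV n →ₗ[ℂ] testV n := mulT (contDiff_pot ξ lam) - lapT n

/-- The operator `1 - Δ + |v|² + |ξ|^{2/3} + |λ|^{1/2}` on test functions. -/
def weightT (ξ : Ev n) (lam : ℝ) : testV n →ₗ[ℂ] testV n :=
  mulT contDiff_ofReal_norm_sq - lapT n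
    + ((1 + ‖ξ‖ ^ ((2 : ℝ) / 3) + √|lam| : ℝ) : ℂ) • LinearMap.id

lemma opT_apply (ξ : Ev n) (lam : ℝ) (φ : testV n) (v : Ev n) :
    (opT ξ lam φ).1 v
      = Phat0t n ξ φ.1 v + (((n : ℝ) / 2 + 1 : ℝ) - Complex.I * (lam : ℝ)) * φ.1 v := by
  change pot ξ lam v * φ.1 v - lapV n φ.1 v = _
  simp only [pot, drift, Phat0t]
  push_cast
  ring

lemma weightT_apply (ξ : Ev n) (lam : ℝ) (φ : testV n) (v : Ev n) :
    (weightT ξ lam φ).1 v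
      = ((1 + ‖v‖ ^ 2 + ‖ξ‖ ^ ((2 : ℝ) / 3) + √|lam| : ℝ) : ℂ) * φ.1 v - lapV n φ.1 v := by
  change ((‖v‖ ^ 2 : ℝ) : ℂ) * φ.1 v - lapV n φ.1 v
    + ((1 + ‖ξ‖ ^ ((2 : ℝ) / 3) + √|lam| : ℝ) : ℂ) * φ.1 v = _
  push_cast
  ring

lemma toHV_opT (ξ : Ev n) (lam : ℝ) (φ : testV n) :
    -toHV n (lapT n φ) + (1 / 4 : ℂ) • toHV n (mulT contDiff_ofReal_norm_sq φ) + toHV n φ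
      + Complex.I • toHV n (mulT (contDiff_ofReal_drift ξ lam) φ) = toHV n (opT ξ lam φ) := by
  rw [← map_neg, ← map_smul (toHV n) (1 / 4 : ℂ), ← map_smul (toHV n) Complex.I, ← map_add,
    ← map_add, ← map_add]
  congr 1
  ext v
  change -lapV n φ.1 v + (1 / 4 : ℂ) * (((‖v‖ ^ 2 : ℝ) : ℂ) * φ.1 v) + φ.1 v
    + Complex.I * ((drift ξ lam v : ℂ) * φ.1 v) = pot ξ lam v * φ.1 v - lapV n φ.1 v
  simp only [pot]
  push_cast
  ring

lemma sqrt_abs_le (ξ : Ev n) (lam : ℝ) {r : ℝ} (hr : 0 ≤ r) (hrξ : r ^ 3 = ‖ξ‖) (v : Ev n) :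
    √|lam| ≤ 1 + |drift ξ lam v| + ‖v‖ ^ 2 + r ^ 2 := by
  refine Real.sqrt_le_iff.mpr ⟨by positivity, ?_⟩
  have h1 : |∑ j, v j * ξ j| ≤ ‖v‖ * ‖ξ‖ := by
    have h := abs_real_inner_le_norm ξ v
    rw [PiLp.inner_apply, mul_comm] at h
    simpa using h
  have h2 : |lam| ≤ |drift ξ lam v| + ‖v‖ * r ^ 3 := by
    have h3 : lam = ∑ j, v j * ξ j - drift ξ lam v := by simp [drift]
    have h4 := abs_sub (∑ j, v j * ξ j) (drift ξ lam v)
    rw [← h3] at h4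
    rw [hrξ]
    linarith
  have h5 : ‖v‖ * r ^ 3 ≤ (‖v‖ ^ 2 + r ^ 2) ^ 2 := by
    have h6 := mul_le_mul_of_nonneg_right (two_mul_le_add_sq ‖v‖ r) (sq_nonneg r)
    have h7 : 0 ≤ ‖v‖ * r ^ 3 := by positivity
    have h8 : 0 ≤ ‖v‖ ^ 2 * (‖v‖ ^ 2 + r ^ 2) := by positivity
    linarith
  have h9 := abs_nonneg (drift ξ lam v)
  have h10 : 0 ≤ ‖v‖ ^ 2 + r ^ 2 := by positivity
  have h11 := mul_nonneg h9 h10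
  have h12 := sq_nonneg (drift ξ lam v)
  rw [← sq_abs] at h12
  linarith

lemma norm_toLp_norm {f : Ev n → ℂ} (hf : MemLp f 2 volume) :
    ‖hf.norm.toLp fun v => ‖f v‖‖ = ‖hf.toLp f‖ := by
  rw [Lp.norm_toLp, Lp.norm_toLp, eLpNorm_norm]

lemma sqrt_abs_mul_norm_le (ξ : Ev n) (lam : ℝ) {r : ℝ} (hr : 0 ≤ r) (hrξ : r ^ 3 = ‖ξ‖)
    (φ : testV n) :
    √|lam| * ‖toHV n φ‖ ≤ ‖toHV n φ‖ + ‖toHV n (mulT (contDiff_ofReal_drift ξ lam) φ)‖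
      + ‖toHV n (mulT contDiff_ofReal_norm_sq φ)‖ + r ^ 2 * ‖toHV n φ‖ := by
  have hx := φ.2.memLp
  have hz := (mulT (contDiff_ofReal_drift ξ lam) φ).2.memLp
  have hc := (mulT contDiff_ofReal_norm_sq φ).2.memLp
  have hle : ‖√|lam| • hx.norm.toLp fun v => ‖φ.1 v‖‖
      ≤ ‖hx.norm.toLp (fun v => ‖φ.1 v‖) + hz.norm.toLp (fun v => ‖_‖)
        + hc.norm.toLp (fun v => ‖_‖) + r ^ 2 • hx.norm.toLp (fun v => ‖φ.1 v‖)‖ := by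
    rw [← MemLp.toLp_const_smul, ← MemLp.toLp_const_smul, ← MemLp.toLp_add, ← MemLp.toLp_add,
      ← MemLp.toLp_add]
    refine Lp.norm_le_norm_of_ae_le ?_
    filter_upwards [MemLp.coeFn_toLp (hx.norm.const_smul (√|lam|)), MemLp.coeFn_toLp
      (((hx.norm.add hz.norm).add hc.norm).add (hx.norm.const_smul (r ^ 2)))] with v h1 h2
    rw [h1, h2]
    simp only [Pi.smul_apply, Pi.add_apply, smul_eq_mul]
    rw [Real.norm_of_nonneg (by positivity), Real.norm_of_nonneg (by positivity)]
    have h3 := mul_le_mul_of_nonneg_right (sqrt_abs_le ξ lam hr hrξ v) (norm_nonneg (φ.1 v))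
    simp only [mulT, LinearMap.coe_mk, AddHom.coe_mk, norm_mul, Complex.norm_real, norm_pow,
      abs_norm, Real.norm_eq_abs]
    linarith
  have e : ‖√|lam| • hx.norm.toLp fun v => ‖φ.1 v‖‖ = √|lam| * ‖toHV n φ‖ := by
    rw [norm_smul, Real.norm_of_nonneg (Real.sqrt_nonneg _), norm_toLp_norm hx]
    rfl
  rw [e] at hle
  refine hle.trans ((norm_add_le _ _).trans (add_le_add ((norm_add_le _ _).trans
    (add_le_add ((norm_add_le _ _).trans (add_le_add ?_ ?_)) ?_)) ?_))
  · exact (norm_toLp_norm hx).le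
  · exact (norm_toLp_norm hz).le
  · exact (norm_toLp_norm hc).le
  · rw [norm_smul, Real.norm_of_nonneg (sq_nonneg r), norm_toLp_norm hx]
    rfl

/-- The maximal estimate on test functions, uniform in `ξ` and `λ`. -/
theorem norm_toHV_weightT_le (ξ : Ev n) (lam : ℝ) (φ : testV n) :
    ‖toHV n φ‖ ≤ ‖toHV n (opT ξ lam φ)‖ ∧
      ‖toHV n (weightT ξ lam φ)‖ ≤ (1000 + 9 * n) * ‖toHV n (opT ξ lam φ)‖ := by
  set r : ℝ := ‖ξ‖ ^ ((1 : ℝ) / 3) with hrdef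
  have hr : 0 ≤ r := by positivity
  have hr3 : r ^ 3 = ‖ξ‖ := by
    rw [hrdef, ← Real.rpow_natCast, ← Real.rpow_mul (norm_nonneg _)]
    norm_num
  have hr2 : r ^ 2 = ‖ξ‖ ^ ((2 : ℝ) / 3) := by
    rw [hrdef, ← Real.rpow_natCast, ← Real.rpow_mul (norm_nonneg _)]
    norm_num
  obtain ⟨hx, hrx, hz, hb, hc⟩ := hilbert_maximal_estimate ξ hr hr3
    (re_inner_toHV_neg_lapT φ)
    (c := toHV n (mulT contDiff_ofReal_norm_sq φ))
    (z := toHV n (mulT (contDiff_ofReal_drift ξ lam) φ))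
    (by
      rw [← inner_conj_symm, Complex.conj_re, inner_toHV_mulT_self]
      exact re_integral_weight_mul_nonneg (fun v => sq_nonneg ‖v‖) _)
    (by rw [inner_toHV_mulT_self, im_integral_weight_mul])
    (by rw [inner_toHV_mulT_mulT, im_integral_weight_mul])
    (im_inner_drift_neg_lapT ξ lam φ) (sum_mul_re_inner_drift_djT ξ lam φ)
    (neg_le_re_inner_norm_sq_neg_lapT φ) (congrArg norm (toHV_opT ξ lam φ))
  refine ⟨hx, ?_⟩
  have hs := sqrt_abs_mul_norm_le ξ lam hr hr3 φ
  have hw : toHV n (weightT ξ lam φ) = toHV n (mulT contDiff_ofReal_norm_sq φ)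
      + -toHV n (lapT n φ) + ((1 + r ^ 2 + √|lam| : ℝ) : ℂ) • toHV n φ := by
    rw [hr2, ← sub_eq_add_neg, ← map_sub, ← map_smul, ← map_add]
    rfl
  have h1 : ‖((1 + r ^ 2 + √|lam| : ℝ) : ℂ) • toHV n φ‖ = (1 + r ^ 2 + √|lam|) * ‖toHV n φ‖ := by
    rw [norm_smul, Complex.norm_real, Real.norm_of_nonneg (by positivity)]
  have h2 := norm_add_le (toHV n (mulT contDiff_ofReal_norm_sq φ) + -toHV n (lapT n φ))
    (((1 + r ^ 2 + √|lam| : ℝ) : ℂ) • toHV n φ)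
  have h3 := norm_add_le (toHV n (mulT contDiff_ofReal_norm_sq φ)) (-toHV n (lapT n φ))
  rw [hw]
  have hF := norm_nonneg (toHV n (opT ξ lam φ))
  linarith

end Operator

section Resolvent

variable {n : ℕ}

lemma integral_toHV_mul (φ ψ : testV n) :
    ∫ v, toHV n φ v * ψ.1 v = ∫ v, φ.1 v * ψ.1 v := by
  refine integral_congr_ae ?_
  filter_upwards [coeFn_toHV φ] with v hv
  rw [hv]

lemma one_le_re_pot (ξ : Ev n) (lam : ℝ) (v : Ev n) : 1 ≤ (pot ξ lam v).re := by
  rw [pot, Complex.add_re, Complex.ofReal_re, Complex.re_mul_ofReal, Complex.I_re, zero_mul,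
    add_zero]
  linarith [sq_nonneg ‖v‖]

lemma eq_zero_of_integral_mul_opT {ξ : Ev n} {lam : ℝ} {f : HV n}
    (h : ∀ φ : testV n, ∫ v, f v * (opT ξ lam φ).1 v = 0) : f = 0 := by
  rw [Lp.eq_zero_iff_ae_eq_zero]
  refine ae_eq_zero_of_distributional (Lp.memLp f) (contDiff_pot ξ lam) (one_le_re_pot ξ lam)
    fun φ hφ => ?_
  rw [← h ⟨φ, hφ⟩]
  refine integral_congr_ae (Eventually.of_forall fun v => ?_)
  change f v * (-lapV n φ v + pot ξ lam v * φ v) = f v * (pot ξ lam v * φ v - lapV n φ v)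
  ring

lemma conjT_conjT (φ : testV n) : conjT (conjT φ) = φ := by
  ext v
  exact Complex.conj_conj _

lemma conjT_opT (ξ : Ev n) (lam : ℝ) (φ : testV n) :
    conjT (opT ξ lam φ) = opT (-ξ) (-lam) (conjT φ) := by
  ext v
  change conj (pot ξ lam v * φ.1 v - lapV n φ.1 v)
    = pot (-ξ) (-lam) v * conj (φ.1 v) - lapV n (fun w => conj (φ.1 w)) v
  rw [lapV_conj]
  have h : drift (-ξ) (-lam) v = -drift ξ lam v := by
    simp only [drift, PiLp.neg_apply, mul_neg, Finset.sum_neg_distrib]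
    ring
  simp only [pot, h, map_sub, map_mul, map_add, Complex.conj_ofReal, Complex.conj_I]
  push_cast
  ring

lemma denseRange_toHV_opT (ξ : Ev n) (lam : ℝ) :
    DenseRange (toHV n ∘ₗ opT ξ lam) := by
  have h : (LinearMap.range (toHV n ∘ₗ opT ξ lam)).topologicalClosure = ⊤ := by
    rw [Submodule.topologicalClosure_eq_top_iff, Submodule.eq_bot_iff]
    intro f hf
    refine eq_zero_of_integral_mul_opT (ξ := -ξ) (lam := -lam) fun φ => ?_
    rw [← inner_toHV_conjT, conjT_opT, neg_neg, neg_neg]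
    exact (Submodule.mem_orthogonal _ _).mp hf _ ⟨conjT φ, rfl⟩
  rw [DenseRange, ← LinearMap.coe_range]
  exact Submodule.dense_iff_topologicalClosure_eq_top.mpr h

lemma denseRange_toHV : DenseRange (toHV n) := by
  refine (Lp.dense_hasCompactSupport_contDiff (F := ℂ) (p := 2) (by norm_num)).mono ?_
  rintro f ⟨g, hfg, hs, hg⟩
  refine ⟨⟨g, hg, hs⟩, Lp.ext ?_⟩
  exact (coeFn_toHV _).trans hfg.symm

lemma isRes5_iff {ξ : Ev n} {lam : ℝ} {R : HV n →L[ℂ] HV n} :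
    IsRes5 n ξ lam R ↔ ∀ (f : HV n) (φ : testV n),
      ∫ v, R f v * (opT ξ lam φ).1 v = ∫ v, f v * φ.1 v := by
  simp only [opT_apply]
  exact ⟨fun h f φ => h f φ.1 φ.2, fun h f φ hφ => h f ⟨φ, hφ⟩⟩

theorem exists_isRes5 (ξ : Ev n) (lam : ℝ) : ∃ R : HV n →L[ℂ] HV n, IsRes5 n ξ lam R := by
  have hS := LinearMap.extendOfNorm_eq (f := toHV n) (e := toHV n ∘ₗ opT (-ξ) (-lam))
    (denseRange_toHV_opT (-ξ) (-lam))
    ⟨1, fun φ => by simpa using (norm_toHV_weightT_le (-ξ) (-lam) φ).1⟩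
  refine ⟨ContinuousLinearMap.adjoint
    ((toHV n).extendOfNorm (toHV n ∘ₗ opT (-ξ) (-lam))), isRes5_iff.mpr fun f φ => ?_⟩
  rw [← inner_toHV_conjT, conjT_opT, ContinuousLinearMap.adjoint_inner_right,
    ← inner_toHV_conjT φ]
  exact congrArg (inner ℂ · f) (hS (conjT φ))

/-- `m - Δ` is symmetric for the bilinear pairing. -/
lemma integral_mul_sub_lapV {m : Ev n → ℂ} (hm : Continuous m) (φ ψ : testV n) :
    ∫ v, ψ.1 v * (m v * φ.1 v - lapV n φ.1 v) = ∫ v, (m v * ψ.1 v - lapV n ψ.1 v) * φ.1 v := by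
  have hφ := φ.2
  have hψ := ψ.2
  have hlap : ∫ v, ψ.1 v * lapV n φ.1 v = ∫ v, lapV n ψ.1 v * φ.1 v := by
    simp only [lapV, Finset.mul_sum, Finset.sum_mul]
    rw [integral_finsetSum, integral_finsetSum]
    · refine Finset.sum_congr rfl fun j _ => ?_
      rw [integral_mul_djV hψ.1 (hφ.1.djV j) (Or.inl hψ.2),
        integral_mul_djV (hψ.1.djV j) hφ.1 (Or.inr hφ.2), neg_neg]
    · exact fun j _ => (((hψ.1.djV j).djV j).mul hφ.1).continuous.integrable_of_hasCompactSupport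
        hφ.2.mul_left
    · exact fun j _ => (hψ.1.mul ((hφ.1.djV j).djV j)).continuous.integrable_of_hasCompactSupport
        hψ.2.mul_right
  have h1 : Integrable fun v => m v * ψ.1 v * φ.1 v :=
    ((hm.mul hψ.1.continuous).mul hφ.1.continuous).integrable_of_hasCompactSupport hφ.2.mul_left
  have h2 : Integrable fun v => ψ.1 v * lapV n φ.1 v :=
    (hψ.1.mul hφ.1.lapV).continuous.integrable_of_hasCompactSupport hψ.2.mul_right
  have h3 : Integrable fun v => lapV n ψ.1 v * φ.1 v :=
    (hψ.1.lapV.mul hφ.1).continuous.integrable_of_hasCompactSupport hφ.2.mul_left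
  have h4 : ∀ v, ψ.1 v * (m v * φ.1 v - lapV n φ.1 v)
      = m v * ψ.1 v * φ.1 v - ψ.1 v * lapV n φ.1 v := fun v => by ring
  simp only [h4, sub_mul]
  rw [integral_sub h1 h2, integral_sub h1 h3, hlap]

lemma integral_mul_opT (ξ : Ev n) (lam : ℝ) (φ ψ : testV n) :
    ∫ v, ψ.1 v * (opT ξ lam φ).1 v = ∫ v, (opT ξ lam ψ).1 v * φ.1 v :=
  integral_mul_sub_lapV (contDiff_pot ξ lam).continuous φ ψ

lemma integral_mul_weightT (ξ : Ev n) (lam : ℝ) (φ ψ : testV n) :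
    ∫ v, ψ.1 v * (weightT ξ lam φ).1 v = ∫ v, (weightT ξ lam ψ).1 v * φ.1 v := by
  simp only [weightT_apply]
  exact integral_mul_sub_lapV (by fun_prop) φ ψ

lemma IsRes5.apply_toHV_opT {ξ : Ev n} {lam : ℝ} {R : HV n →L[ℂ] HV n}
    (hR : IsRes5 n ξ lam R) (ψ : testV n) : R (toHV n (opT ξ lam ψ)) = toHV n ψ := by
  rw [← sub_eq_zero]
  refine eq_zero_of_integral_mul_opT (ξ := ξ) (lam := lam) fun φ => ?_
  rw [← inner_toHV_conjT, inner_sub_right, inner_toHV_conjT, inner_toHV_conjT,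
    isRes5_iff.mp hR, integral_toHV_mul, integral_toHV_mul, integral_mul_opT, sub_self]

lemma IsRes5.norm_inner_weightT_le {ξ : Ev n} {lam : ℝ} {R : HV n →L[ℂ] HV n}
    (hR : IsRes5 n ξ lam R) (f : HV n) (φ : testV n) :
    ‖⟪toHV n (conjT (weightT ξ lam φ)), R f⟫_ℂ‖ ≤ (1000 + 9 * n) * ‖f‖ * ‖toHV n φ‖ := by
  induction f using (denseRange_toHV_opT ξ lam).induction_on with
  | hp => exact isClosed_le (by fun_prop) (by fun_prop)
  | ih ψ =>
    rw [LinearMap.comp_apply, hR.apply_toHV_opT, inner_toHV_conjT, integral_toHV_mul,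
      integral_mul_weightT, ← integral_toHV_mul, ← inner_toHV_conjT]
    refine (norm_inner_le_norm _ _).trans ?_
    rw [norm_toHV_conjT, mul_comm]
    exact mul_le_mul_of_nonneg_right (norm_toHV_weightT_le ξ lam ψ).2 (norm_nonneg _)

end Resolvent

/-- **Theorem 2.3** (from the appendix of [N2]).  There exists C > 0 such that
  ‖(1 − Δᵥ + v² + |ξ|^{2/3} + |λ|^{1/2})(P̂₀(ξ) + n/2 + 1 − iλ)^{−1}‖_{ℬ(L²(ℝⁿ_v))} ≤ C
uniformly in ξ ∈ ℝⁿ and λ ∈ ℝ.  The function gg below is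
(1 − Δᵥ + v² + |ξ|^{2/3} + |λ|^{1/2}) R f, characterized distributionally. -/
theorem statement5 (n : ℕ) (hn : 1 ≤ n) :
    ∃ C > (0:ℝ), ∀ ξ : Ev n, ∀ lam : ℝ,
      -- the resolvent exists …
      (∃ R : HV n →L[ℂ] HV n, IsRes5 n ξ lam R) ∧
      -- … and the weighted bound holds :
      (∀ R : HV n →L[ℂ] HV n, IsRes5 n ξ lam R →
        ∀ f gg : HV n,
          (∀ φ : Ev n → ℂ, IsTestV n φ →
            ∫ v : Ev n, gg v * φ v
              = ∫ v : Ev n, (R f) v *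
                  (((1 + ‖v‖ ^ 2 + ‖ξ‖ ^ ((2:ℝ)/3) + Real.sqrt |lam| : ℝ) : ℂ) * φ v
                    - lapV n φ v)) →
          ‖gg‖ ≤ C * ‖f‖) := by
  refine ⟨1000 + 9 * n, by positivity, fun ξ lam => ⟨exists_isRes5 ξ lam, ?_⟩⟩
  intro R hR f gg hgg
  have h : ∀ u : HV n, ‖⟪u, gg⟫_ℂ‖ ≤ (1000 + 9 * n) * ‖f‖ * ‖u‖ := by
    intro u
    induction u using denseRange_toHV.induction_on with
    | hp => exact isClosed_le (by fun_prop) (by fun_prop)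
    | ih φ =>
      have h1 := hgg (conjT φ).1 (conjT φ).2
      rw [← inner_toHV_conjT, conjT_conjT] at h1
      simp only [← weightT_apply] at h1
      rw [h1, ← inner_toHV_conjT, ← norm_toHV_conjT φ]
      exact hR.norm_inner_weightT_le f (conjT φ)
  have h1 := h gg
  rw [inner_self_eq_norm_sq_to_K, norm_pow, RCLike.norm_ofReal, abs_norm, sq] at h1
  rcases (norm_nonneg gg).eq_or_lt with h0 | h0
  · rw [← h0]
    positivity
  · exact le_of_mul_le_mul_right h1 h0

end
end

section
/- There exists C>0 such that for all u∈𝒮(ℝ^{2n}_{x,v}) and all λ∈ℝ, |λ|·‖u‖² + ‖Δ_v u‖² + ‖|v|²u‖² + ‖|D_x|^{2/3}u‖² ≤ C‖(P₀ + (n+2)/2 − iλ)u‖², where ‖·‖ is the L²(ℝ^{2n}) norm. Moreover, P₀ defined on 𝒮(ℝ^{2n}_{x,v}) is essentially maximally accretive in L²(ℝ^{2n}). -/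
open MeasureTheory Real Complex Filter Topology

noncomputable section

/-- ℝⁿ -/
abbrev En (n : ℕ) := EuclideanSpace ℝ (Fin n)
/-- phase space ℝ^{2n}: `p.1` = position x, `p.2` = velocity v -/
abbrev PhaseN (n : ℕ) := En n × En n
/-- L²(ℝ^{2n}) -/
abbrev HspN (n : ℕ) := Lp ℂ 2 (volume : Measure (PhaseN n))

/-- ⟨x⟩^s = (1+|x|²)^{s/2} -/
def jbrN (n : ℕ) (s : ℝ) (x : En n) : ℝ := (1 + ‖x‖ ^ 2) ^ (s / 2)

/-- test functions on phase space -/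
def IsTestN (n : ℕ) (φ : PhaseN n → ℂ) : Prop := ContDiff ℝ (⊤ : ℕ∞) φ ∧ HasCompactSupport φ

def dxjN (n : ℕ) (u : PhaseN n → ℂ) (j : Fin n) (p : PhaseN n) : ℂ :=
  fderiv ℝ u p (EuclideanSpace.single j 1, 0)
def dvjN (n : ℕ) (u : PhaseN n → ℂ) (j : Fin n) (p : PhaseN n) : ℂ :=
  fderiv ℝ u p (0, EuclideanSpace.single j 1)

def lapvN (n : ℕ) (u : PhaseN n → ℂ) (p : PhaseN n) : ℂ :=
  ∑ j : Fin n, dvjN n (fun q => dvjN n u j q) j p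
def lapxN (n : ℕ) (u : PhaseN n → ℂ) (p : PhaseN n) : ℂ :=
  ∑ j : Fin n, dxjN n (fun q => dxjN n u j q) j p

/-- formal transpose of the free KFP operator P₀ = v·∇ₓ − Δᵥ + |v|²/4 − n/2
w.r.t. the bilinear pairing ∫ u φ -/
def KFP0tN (n : ℕ) (φ : PhaseN n → ℂ) (p : PhaseN n) : ℂ :=
  -(∑ j : Fin n, (p.2 j : ℂ) * dxjN n φ j p) - lapvN n φ p
    + ((‖p.2‖ ^ 2 / 4 - (n : ℝ) / 2 : ℝ) : ℂ) * φ p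

/-- formal transpose of P = P₀ + W, W = −∇V(x)·∇ᵥ -/
def KFPtN (n : ℕ) (V : En n → ℝ) (φ : PhaseN n → ℂ) (p : PhaseN n) : ℂ :=
  KFP0tN n φ p
    + ∑ j : Fin n, ((fderiv ℝ V p.1 (EuclideanSpace.single j 1) : ℝ) : ℂ) * dvjN n φ j p

/-- decay assumption (1.4) on the potential -/
def VDecayN (n : ℕ) (V : En n → ℝ) (ρ : ℝ) : Prop :=
  ContDiff ℝ 1 V ∧
    ∃ C : ℝ, ∀ x : En n, |V x| + jbrN n 1 x * ‖fderiv ℝ V x‖ ≤ C * jbrN n (-ρ) x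

def offRplus : Set ℂ := {z : ℂ | ¬(0 ≤ z.re ∧ z.im = 0)}

/-- R is (a) resolvent family for P = P₀ + W on the set S :
(P−z)(R z f) = f in the sense of distributions, for every f ∈ L². -/
def IsResolventN (n : ℕ) (V : En n → ℝ) (R : ℂ → HspN n →L[ℂ] HspN n) (S : Set ℂ) : Prop :=
  ∀ z ∈ S, ∀ f : HspN n, ∀ φ : PhaseN n → ℂ, IsTestN n φ →
    ∫ p : PhaseN n, (R z f) p * (KFPtN n V φ p - z * φ p) = ∫ p : PhaseN n, f p * φ p

/-- partial Fourier transform in the x-variables -/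
def pftxN (n : ℕ) (w : PhaseN n → ℂ) (q : PhaseN n) : ℂ :=
  ∫ x : En n,
    Complex.exp (-(((2 * π * ∑ j : Fin n, x j * q.1 j : ℝ)) : ℂ) * Complex.I) * w (x, q.2)

/-- squared ℋ^{1,s}-norm (of a nice function): quadratic form of
(1−Δᵥ+|v|²+⟨D_x⟩^{2/3}) applied to ⟨x⟩^s h -/
def H1normSqN (n : ℕ) (s : ℝ) (h : PhaseN n → ℂ) : ℝ :=
  (∫ p : PhaseN n, (‖(jbrN n s p.1 : ℂ) * h p‖ ^ 2
      + (∑ j : Fin n, ‖dvjN n (fun q : PhaseN n => (jbrN n s q.1 : ℂ) * h q) j p‖ ^ 2)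
      + ‖p.2‖ ^ 2 * ‖(jbrN n s p.1 : ℂ) * h p‖ ^ 2))
  + ∫ q : PhaseN n, (1 + (2 * π) ^ 2 * ‖q.1‖ ^ 2) ^ ((1:ℝ)/3)
      * ‖pftxN n (fun p : PhaseN n => (jbrN n s p.1 : ℂ) * h p) q‖ ^ 2

def H1normN (n : ℕ) (s : ℝ) (h : PhaseN n → ℂ) : ℝ := (H1normSqN n s h).sqrt

/-- "‖f‖_{ℋ^{-1,-s}} ≤ B" : f is B-bounded as a functional on ℋ^{1,s} -/
def DualBoundN (n : ℕ) (s : ℝ) (f : PhaseN n → ℂ) (B : ℝ) : Prop :=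
  ∀ h : PhaseN n → ℂ, IsTestN n h → ‖∫ p : PhaseN n, f p * h p‖ ≤ B * H1normN n s h

/-- weighted L²-norm: norm of 𝓛^{2,s} -/
def wNormN (n : ℕ) (s : ℝ) (f : PhaseN n → ℂ) : ℝ :=
  (∫ p : PhaseN n, ‖f p‖ ^ 2 * jbrN n (2 * s) p.1).sqrt

/-- the free KFP operator P₀ = v·∇ₓ − Δᵥ + |v|²/4 − n/2 (acting directly) -/
def KFP0N (n : ℕ) (u : PhaseN n → ℂ) (p : PhaseN n) : ℂ :=
  (∑ j : Fin n, (p.2 j : ℂ) * dxjN n u j p) - lapvN n u p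
    + ((‖p.2‖ ^ 2 / 4 - (n : ℝ) / 2 : ℝ) : ℂ) * u p

section Abstract

open scoped InnerProductSpace

variable {S H : Type*} [AddCommGroup S] [Module ℂ S] [NormedAddCommGroup H]
  [InnerProductSpace ℂ H] {n : ℕ}

/-- Position operators `V j` and derivations `D j` acting on a space `S` of nice functions, which
obey the canonical commutation relations; `V j` is symmetric and `D j` is skew-symmetric for the
semi-inner product induced by `T : S → H`. -/
structure IsCCR (T : S →ₗ[ℂ] H) (V D : Fin n → S →ₗ[ℂ] S) : Prop where
  symm : ∀ j a b, ⟪T (V j a), T b⟫_ℂ = ⟪T a, T (V j b)⟫_ℂ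
  skew : ∀ j a b, ⟪T (D j a), T b⟫_ℂ = -⟪T a, T (D j b)⟫_ℂ
  comm : ∀ j k a, V j (V k a) = V k (V j a)
  ccr : ∀ j k a, D j (V k a) = V k (D j a) + if j = k then a else 0

/-- The operator `ξ · v - λ`. -/
def transportMul (V : Fin n → S →ₗ[ℂ] S) (ξ : Fin n → ℝ) (lam : ℝ) : S →ₗ[ℂ] S :=
  ∑ j, (ξ j : ℂ) • V j - (lam : ℂ) • LinearMap.id

/-- The harmonic oscillator `-Δᵥ + |v|²/4`. -/
def oscillator (V D : Fin n → S →ₗ[ℂ] S) : S →ₗ[ℂ] S :=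
  -(∑ j, D j ∘ₗ D j) + (1 / 4 : ℂ) • ∑ j, V j ∘ₗ V j

/-- The operator `ξ · ∂ᵥ`. -/
def dirDeriv (D : Fin n → S →ₗ[ℂ] S) (ξ : Fin n → ℝ) : S →ₗ[ℂ] S :=
  ∑ j, (ξ j : ℂ) • D j

lemma transportMul_apply (V : Fin n → S →ₗ[ℂ] S) (ξ : Fin n → ℝ) (lam : ℝ) (a : S) :
    transportMul V ξ lam a = ∑ j, (ξ j : ℂ) • V j a - (lam : ℂ) • a := by
  simp [transportMul]

lemma dirDeriv_apply (D : Fin n → S →ₗ[ℂ] S) (ξ : Fin n → ℝ) (a : S) :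
    dirDeriv D ξ a = ∑ j, (ξ j : ℂ) • D j a := by
  simp [dirDeriv]

lemma oscillator_apply (V D : Fin n → S →ₗ[ℂ] S) (a : S) :
    oscillator V D a = -(∑ j, D j (D j a)) + (1 / 4 : ℂ) • ∑ j, V j (V j a) := by
  simp [oscillator]

lemma norm_sum_smul_le (ξ : Fin n → ℝ) (x : Fin n → H) :
    ‖∑ j, (ξ j : ℂ) • x j‖ ≤ √(∑ j, ξ j ^ 2) * √(∑ j, ‖x j‖ ^ 2) := by
  calc ‖∑ j, (ξ j : ℂ) • x j‖ ≤ ∑ j, |ξ j| * ‖x j‖ :=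
        (norm_sum_le _ _).trans_eq (by simp [norm_smul])
    _ ≤ √(∑ j, |ξ j| ^ 2) * √(∑ j, ‖x j‖ ^ 2) := Real.sum_mul_le_sqrt_mul_sqrt _ _ _
    _ = _ := by simp

namespace IsCCR

variable {T : S →ₗ[ℂ] H} {V D : Fin n → S →ₗ[ℂ] S}

lemma transportMul_symm (h : IsCCR T V D) (ξ : Fin n → ℝ) (lam : ℝ) (a b : S) :
    ⟪T (transportMul V ξ lam a), T b⟫_ℂ = ⟪T a, T (transportMul V ξ lam b)⟫_ℂ := by
  simp [transportMul_apply, h.symm]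

lemma im_transportMul (h : IsCCR T V D) (ξ : Fin n → ℝ) (lam : ℝ) (a : S) :
    (⟪T (transportMul V ξ lam a), T a⟫_ℂ).im = 0 := by
  have h1 := h.transportMul_symm ξ lam a a
  rw [← inner_conj_symm (T a)] at h1
  have := congrArg Complex.im h1
  simp only [Complex.conj_im] at this
  linarith

lemma transportMul_V (h : IsCCR T V D) (ξ : Fin n → ℝ) (lam : ℝ) (j : Fin n) (a : S) :
    V j (transportMul V ξ lam a) = transportMul V ξ lam (V j a) := by
  simp [transportMul_apply, h.comm j]

lemma D_transportMul (h : IsCCR T V D) (ξ : Fin n → ℝ) (lam : ℝ) (j : Fin n) (a : S) :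
    D j (transportMul V ξ lam a) = transportMul V ξ lam (D j a) + (ξ j : ℂ) • a := by
  simp [transportMul_apply, h.ccr j, Finset.sum_add_distrib, smul_add]
  abel

lemma dirDeriv_transportMul (h : IsCCR T V D) (ξ : Fin n → ℝ) (lam : ℝ) (a : S) :
    dirDeriv D ξ (transportMul V ξ lam a) =
      transportMul V ξ lam (dirDeriv D ξ a) + ((∑ j, ξ j ^ 2 : ℝ) : ℂ) • a := by
  simp only [dirDeriv_apply, h.D_transportMul, map_sum, map_smul, smul_add,
    Finset.sum_add_distrib, smul_smul, Complex.ofReal_sum, Finset.sum_smul, sq, Complex.ofReal_mul]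

lemma dirDeriv_skew (h : IsCCR T V D) (ξ : Fin n → ℝ) (a b : S) :
    ⟪T (dirDeriv D ξ a), T b⟫_ℂ = -⟪T a, T (dirDeriv D ξ b)⟫_ℂ := by
  simp [dirDeriv_apply, h.skew]

lemma norm_dirDeriv_le (ξ : Fin n → ℝ) (a : S) :
    ‖T (dirDeriv D ξ a)‖ ≤ √(∑ j, ξ j ^ 2) * √(∑ j, ‖T (D j a)‖ ^ 2) := by
  simpa [dirDeriv_apply] using norm_sum_smul_le ξ fun j ↦ T (D j a)

lemma transportMul_zero_add (ξ : Fin n → ℝ) (lam : ℝ) (a : S) :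
    T (transportMul V ξ lam a) = ∑ j, (ξ j : ℂ) • T (V j a) - (lam : ℂ) • T a := by
  simp [transportMul_apply]

lemma inner_oscillator (h : IsCCR T V D) (a : S) :
    ⟪T (oscillator V D a), T a⟫_ℂ =
      ((∑ j, ‖T (D j a)‖ ^ 2 + (∑ j, ‖T (V j a)‖ ^ 2) / 4 : ℝ) : ℂ) := by
  simp only [oscillator_apply, map_add, map_neg, map_sum, map_smul, inner_add_left,
    inner_neg_left, sum_inner, inner_smul_left, h.skew _ (D _ a), h.symm _ (V _ a),
    inner_self_eq_norm_sq_to_K]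
  have h4 : (starRingEnd ℂ) (1 / 4 : ℂ) = 1 / 4 := by simp [map_ofNat]
  rw [h4]
  simp
  ring

/-- The commutator `[ξ · ∂ᵥ, ξ · v - λ] = |ξ|²`, tested against `u`. -/
lemma commutator_bound (h : IsCCR T V D) (ξ : Fin n → ℝ) (lam : ℝ) (u : S) :
    √(∑ j, ξ j ^ 2) * ‖T u‖ ^ 2 ≤
      2 * ‖T (transportMul V ξ lam u)‖ * √(∑ j, ‖T (D j u)‖ ^ 2) := by
  set r := √(∑ j, ξ j ^ 2) with hr
  set d := √(∑ j, ‖T (D j u)‖ ^ 2)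
  set m := ‖T (transportMul V ξ lam u)‖ with hm
  have hr2 : r ^ 2 = ∑ j, ξ j ^ 2 := Real.sq_sqrt (by positivity)
  have hr0 : 0 ≤ r := Real.sqrt_nonneg _
  have key : ((r ^ 2 : ℝ) : ℂ) * ⟪T u, T u⟫_ℂ =
      -⟪T (transportMul V ξ lam u), T (dirDeriv D ξ u)⟫_ℂ
        - ⟪T (dirDeriv D ξ u), T (transportMul V ξ lam u)⟫_ℂ := by
    rw [← h.dirDeriv_skew ξ (transportMul V ξ lam u) u, ← h.transportMul_symm,
      h.dirDeriv_transportMul, map_add, inner_add_left, map_smul, inner_smul_left, hr2]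
    simp
  have h1 : r ^ 2 * ‖T u‖ ^ 2 ≤ 2 * m * (r * d) := by
    have h2 := congrArg norm key
    rw [norm_mul, inner_self_eq_norm_sq_to_K] at h2
    have h3 : ‖((r ^ 2 : ℝ) : ℂ)‖ = r ^ 2 := by
      rw [Complex.norm_real, Real.norm_of_nonneg (by positivity)]
    rw [h3] at h2
    have h4 := norm_dirDeriv_le (T := T) (D := D) ξ u
    have h5 := norm_inner_le_norm (𝕜 := ℂ) (T (transportMul V ξ lam u)) (T (dirDeriv D ξ u))
    have h6 := norm_inner_le_norm (𝕜 := ℂ) (T (dirDeriv D ξ u)) (T (transportMul V ξ lam u))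
    have h7 := norm_sub_le (-⟪T (transportMul V ξ lam u), T (dirDeriv D ξ u)⟫_ℂ)
      ⟪T (dirDeriv D ξ u), T (transportMul V ξ lam u)⟫_ℂ
    rw [norm_neg, ← h2] at h7
    simp only [norm_pow, Complex.norm_real, norm_norm, Complex.coe_algebraMap] at h7
    have h8 : m * ‖T (dirDeriv D ξ u)‖ ≤ m * (r * d) := by gcongr
    nlinarith
  rcases hr0.eq_or_lt with h0 | h0
  · rw [← h0]; simp only [zero_mul]; positivity
  · refine le_of_mul_le_mul_left (a := r) ?_ h0
    linarith

lemma re_inner_oscillator_transportMul (h : IsCCR T V D) (ξ : Fin n → ℝ) (lam : ℝ) (u : S) :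
    |(⟪T (oscillator V D u), T (transportMul V ξ lam u)⟫_ℂ).im| ≤
      ‖T u‖ * (√(∑ j, ξ j ^ 2) * √(∑ j, ‖T (D j u)‖ ^ 2)) := by
  have key : (⟪T (oscillator V D u), T (transportMul V ξ lam u)⟫_ℂ).im =
      (⟪T (dirDeriv D ξ u), T u⟫_ℂ).im := by
    have hD : ∀ j, (⟪T (D j u), T (transportMul V ξ lam (D j u))⟫_ℂ).im = 0 := fun j ↦ by
      rw [← h.transportMul_symm]; exact h.im_transportMul ξ lam _
    have hV : ∀ j, (⟪T (V j u), T (transportMul V ξ lam (V j u))⟫_ℂ).im = 0 := fun j ↦ by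
      rw [← h.transportMul_symm]; exact h.im_transportMul ξ lam _
    simp only [oscillator_apply, map_add, map_neg, map_sum, map_smul, inner_add_left,
      inner_neg_left, sum_inner, inner_smul_left, h.skew _ (D _ u), h.symm _ (V _ u),
      h.D_transportMul, h.transportMul_V, inner_add_right, inner_smul_right, dirDeriv_apply]
    have h4 : (starRingEnd ℂ) (1 / 4 : ℂ) = ((1 / 4 : ℝ) : ℂ) := by
      rw [show (1 / 4 : ℂ) = ((1 / 4 : ℝ) : ℂ) by norm_num, Complex.conj_ofReal]
    rw [h4, Complex.add_im, Complex.im_ofReal_mul, Complex.im_sum,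
      Finset.sum_congr rfl fun j _ ↦ hV j]
    simp [Finset.sum_add_distrib, hD]
  rw [key]
  calc _ ≤ ‖⟪T (dirDeriv D ξ u), T u⟫_ℂ‖ := Complex.abs_im_le_norm _
    _ ≤ ‖T (dirDeriv D ξ u)‖ * ‖T u‖ := norm_inner_le_norm _ _
    _ ≤ _ := by
      rw [mul_comm]
      gcongr
      exact norm_dirDeriv_le ξ u

lemma energy_le (h : IsCCR T V D) (ξ : Fin n → ℝ) (lam : ℝ) (u : S) (g : H)
    (hg : g = Complex.I • T (transportMul V ξ lam u) + T (oscillator V D u) + T u) :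
    ∑ j, ‖T (D j u)‖ ^ 2 + (∑ j, ‖T (V j u)‖ ^ 2) / 4 + ‖T u‖ ^ 2 ≤ ‖g‖ * ‖T u‖ := by
  have h1 : (⟪g, T u⟫_ℂ).re =
      ∑ j, ‖T (D j u)‖ ^ 2 + (∑ j, ‖T (V j u)‖ ^ 2) / 4 + ‖T u‖ ^ 2 := by
    rw [hg, inner_add_left, inner_add_left, inner_smul_left, h.inner_oscillator,
      inner_self_eq_norm_sq_to_K, Complex.add_re, Complex.add_re, Complex.ofReal_re,
      Complex.conj_I, neg_mul, Complex.neg_re, Complex.I_mul_re, h.im_transportMul]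
    simp [← Complex.ofReal_pow]
  rw [← h1]
  exact (Complex.re_le_norm _).trans (norm_inner_le_norm _ _)

lemma norm_sq_expand_ge (h : IsCCR T V D) (ξ : Fin n → ℝ) (lam : ℝ) (u : S) (g : H)
    (hg : g = Complex.I • T (transportMul V ξ lam u) + T (oscillator V D u) + T u) :
    ‖T (transportMul V ξ lam u)‖ ^ 2 + ‖T (oscillator V D u) + T u‖ ^ 2 ≤
      ‖g‖ ^ 2 + 2 * (‖T u‖ * (√(∑ j, ξ j ^ 2) * √(∑ j, ‖T (D j u)‖ ^ 2))) := by
  have h1 := norm_add_sq (𝕜 := ℂ) (T (oscillator V D u) + T u)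
    (Complex.I • T (transportMul V ξ lam u))
  have h2 : T (oscillator V D u) + T u + Complex.I • T (transportMul V ξ lam u) = g := by
    rw [hg]; abel
  have h3 : RCLike.re ⟪T (oscillator V D u) + T u, Complex.I • T (transportMul V ξ lam u)⟫_ℂ =
      -(⟪T (oscillator V D u), T (transportMul V ξ lam u)⟫_ℂ).im := by
    have h4 := h.im_transportMul ξ lam u
    rw [h.transportMul_symm] at h4
    rw [inner_smul_right, inner_add_left]
    simp [h4]
  rw [h2, h3, norm_smul, Complex.norm_I, one_mul] at h1
  have h5 := (abs_le.mp (h.re_inner_oscillator_transportMul ξ lam u)).2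
  linarith

/-- Elliptic regularity for the harmonic oscillator. -/
lemma oscillator_elliptic (h : IsCCR T V D) (u : S) :
    ‖T (∑ j, D j (D j u))‖ ^ 2 + ‖T (∑ j, V j (V j u))‖ ^ 2 ≤
      16 * (‖T (oscillator V D u)‖ ^ 2 + n / 2 * ‖T u‖ ^ 2) := by
  have hsum : ∀ j, 2 * (⟪T (D j u), T (V j u)⟫_ℂ).re = -‖T u‖ ^ 2 := fun j ↦ by
    have h1 : ⟪T (D j u), T (V j u)⟫_ℂ = -⟪T (V j u), T (D j u)⟫_ℂ - ((‖T u‖ ^ 2 : ℝ) : ℂ) := by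
      rw [h.skew, h.ccr, if_pos rfl, map_add, inner_add_right, ← h.symm, inner_self_eq_norm_sq_to_K]
      simp
      ring
    have h2 := congrArg Complex.re h1
    rw [← inner_conj_symm (T (V j u))] at h2
    simp only [Complex.sub_re, Complex.neg_re, Complex.conj_re, Complex.ofReal_re] at h2
    linarith
  have hjk : ∀ j k, (⟪T (D j (D j u)), T (V k (V k u))⟫_ℂ).re =
      -‖T (V k (D j u))‖ ^ 2 + if j = k then ‖T u‖ ^ 2 else 0 := fun j k ↦ by
    have h1 : D j (V k (V k u)) =
        V k (V k (D j u)) + if j = k then (2 : ℂ) • V k u else 0 := by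
      rw [h.ccr, h.ccr]
      split_ifs
      · rw [map_add, two_smul]; abel
      · simp
    rw [h.skew, h1, map_add, inner_add_right, ← h.symm, inner_self_eq_norm_sq_to_K]
    split_ifs with hc
    · subst hc
      have := hsum j
      simp [inner_smul_right, ← Complex.ofReal_pow]
      linarith
    · simp [← Complex.ofReal_pow]
  have hcross : (⟪T (∑ j, D j (D j u)), T (∑ j, V j (V j u))⟫_ℂ).re ≤ n * ‖T u‖ ^ 2 := by
    simp only [map_sum, sum_inner, inner_sum, Complex.re_sum, hjk]
    calc _ ≤ ∑ k : Fin n, ∑ j : Fin n, (if j = k then ‖T u‖ ^ 2 else 0) :=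
          Finset.sum_le_sum fun k _ ↦ Finset.sum_le_sum fun j _ ↦
            add_le_of_nonpos_left (by simp)
      _ = _ := by simp
  have h1 := norm_sub_sq (𝕜 := ℂ) ((1 / 4 : ℂ) • T (∑ j, V j (V j u))) (T (∑ j, D j (D j u)))
  have h2 : (1 / 4 : ℂ) • T (∑ j, V j (V j u)) - T (∑ j, D j (D j u)) =
      T (oscillator V D u) := by
    rw [oscillator_apply, map_add, map_neg, map_smul]; abel
  have h3 : RCLike.re ⟪(1 / 4 : ℂ) • T (∑ j, V j (V j u)), T (∑ j, D j (D j u))⟫_ℂ =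
      (⟪T (∑ j, D j (D j u)), T (∑ j, V j (V j u))⟫_ℂ).re / 4 := by
    rw [← inner_re_symm, inner_smul_right, show (1 / 4 : ℂ) = ((1 / 4 : ℝ) : ℂ) by norm_num]
    simp only [RCLike.re_to_complex, Complex.re_ofReal_mul]
    ring
  rw [h2, h3, norm_smul] at h1
  rw [show ‖(1 / 4 : ℂ)‖ = 1 / 4 by norm_num] at h1
  generalize ‖T (∑ j, D j (D j u))‖ = x at *
  generalize ‖T (∑ j, V j (V j u))‖ = y at *
  nlinarith [sq_nonneg x, sq_nonneg y]

lemma transport_term_le {a F m d r : ℝ} (ha : 0 ≤ a) (hm : 0 ≤ m) (hF : 0 ≤ F)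
    (hd2 : d ^ 2 ≤ F * a) (hr : r * a ^ 2 ≤ 2 * m * d) (hd : 0 ≤ d) :
    a * (r * d) ≤ 2 * m * F := by
  rcases ha.eq_or_lt with rfl | ha'
  · simp; positivity
  · refine le_of_mul_le_mul_left (a := a) ?_ ha'
    nlinarith [mul_le_mul_of_nonneg_right hr hd, mul_le_mul_of_nonneg_left hd2 hm]

set_option maxHeartbeats 1000000 in
/-- The subelliptic estimate on each Fourier mode. -/
theorem subelliptic (h : IsCCR T V D) (ξ : Fin n → ℝ) (lam : ℝ) (u : S) (g : H)
    (hg : g = Complex.I • T (transportMul V ξ lam u) + T (oscillator V D u) + T u) :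
    |lam| * ‖T u‖ ^ 2 + ‖T (∑ j, D j (D j u))‖ ^ 2 + ‖T (∑ j, V j (V j u))‖ ^ 2
      + (∑ j, ξ j ^ 2) ^ ((2 : ℝ) / 3) * ‖T u‖ ^ 2 ≤ (16 * (36 + n / 2) + 50) * ‖g‖ ^ 2 := by
  have hE := h.energy_le ξ lam u g hg
  have hC := h.commutator_bound ξ lam u
  have hN := h.norm_sq_expand_ge ξ lam u g hg
  have hO := h.oscillator_elliptic u
  have hM := transportMul_zero_add (T := T) (V := V) ξ lam u
  have hVn := norm_sum_smul_le ξ fun j ↦ T (V j u)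
  have hL := norm_sub_le (T (oscillator V D u) + T u) (T u)
  rw [add_sub_cancel_right] at hL
  set D2 := ∑ j, ‖T (D j u)‖ ^ 2 with hD2
  set W2 := ∑ j, ‖T (V j u)‖ ^ 2 with hW2
  have hD0 : 0 ≤ D2 := by positivity
  have hW0 : 0 ≤ W2 := by positivity
  have hdD := Real.sq_sqrt hD0
  have hwW := Real.sq_sqrt hW0
  have hr2 : √(∑ j, ξ j ^ 2) ^ 2 = ∑ j, ξ j ^ 2 := Real.sq_sqrt (by positivity)
  rw [← hr2]
  have hd0 := Real.sqrt_nonneg D2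
  have hw0 := Real.sqrt_nonneg W2
  have hr0 := Real.sqrt_nonneg (∑ j, ξ j ^ 2)
  have ha0 := norm_nonneg (T u)
  have hm0 := norm_nonneg (T (transportMul V ξ lam u))
  have hF0 := norm_nonneg g
  have hl0 := norm_nonneg (T (oscillator V D u) + T u)
  have hLo0 := norm_nonneg (T (oscillator V D u))
  generalize √D2 = d at *
  generalize √W2 = w at *
  generalize √(∑ j, ξ j ^ 2) = r at *
  have hlam : |lam| * ‖T u‖ ≤ r * w + ‖T (transportMul V ξ lam u)‖ := by
    have h1 : (lam : ℂ) • T u = ∑ j, (ξ j : ℂ) • T (V j u) - T (transportMul V ξ lam u) := by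
      rw [hM]; abel
    have h2 := congrArg norm h1
    rw [norm_smul, Complex.norm_real, Real.norm_eq_abs] at h2
    rw [h2]
    exact (norm_sub_le _ _).trans (by gcongr)
  generalize ‖T (transportMul V ξ lam u)‖ = m at *
  generalize ‖T (oscillator V D u) + T u‖ = l at *
  generalize ‖T (oscillator V D u)‖ = lo at *
  generalize ‖g‖ = F at *
  generalize ‖T u‖ = a at *
  have haF : a ≤ F := by
    rcases ha0.eq_or_lt with rfl | ha'
    · exact hF0
    · refine le_of_mul_le_mul_right (a := a) ?_ ha'
      nlinarith
  have hd2 : d ^ 2 ≤ F * a := by nlinarith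
  have hw2 : w ^ 2 ≤ 4 * (F * a) := by nlinarith
  have ht := transport_term_le ha0 hm0 hF0 hd2 hC hd0
  have hm5 : m ≤ 5 * F := by
    by_contra! hcon
    nlinarith
  have hl : l ≤ 5 * F := by
    by_contra! hcon
    nlinarith
  have hlo : lo ^ 2 ≤ 36 * F ^ 2 := by nlinarith
  have ha2 : a ^ 2 ≤ F ^ 2 := by gcongr
  have hra : r ^ 2 * a ^ 3 ≤ 100 * F ^ 3 := by
    rcases ha0.eq_or_lt with rfl | ha'
    · simp; positivity
    · refine le_of_mul_le_mul_left (a := a) ?_ ha'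
      have h1 : (r * a ^ 2) ^ 2 ≤ (2 * m * d) ^ 2 := by gcongr
      have h2 : (2 * m * d) ^ 2 ≤ (2 * (5 * F)) ^ 2 * (F * a) := by
        rw [mul_pow]; gcongr
      linarith
  have hrw : (r * w) * a ≤ 20 * F ^ 2 := by
    refine (pow_le_pow_iff_left₀ (by positivity) (by positivity) two_ne_zero).1 ?_
    calc ((r * w) * a) ^ 2 = r ^ 2 * a ^ 2 * w ^ 2 := by ring
      _ ≤ r ^ 2 * a ^ 2 * (4 * (F * a)) := by gcongr
      _ = 4 * F * (r ^ 2 * a ^ 3) := by ring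
      _ ≤ 4 * F * (100 * F ^ 3) := by gcongr
      _ = (20 * F ^ 2) ^ 2 := by ring
  have hfrac : (r ^ 2) ^ ((2 : ℝ) / 3) * a ^ 2 ≤ 25 * F ^ 2 := by
    refine (pow_le_pow_iff_left₀ (by positivity) (by positivity) (n := 3) (by norm_num)).1 ?_
    have h1 : ((r ^ 2) ^ ((2 : ℝ) / 3)) ^ 3 = (r ^ 2) ^ 2 := by
      rw [← Real.rpow_natCast, ← Real.rpow_mul (by positivity)]
      norm_num
    calc ((r ^ 2) ^ ((2 : ℝ) / 3) * a ^ 2) ^ 3 = (r ^ 2 * a ^ 3) ^ 2 := by rw [mul_pow, h1]; ring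
      _ ≤ (100 * F ^ 3) ^ 2 := by gcongr
      _ ≤ (25 * F ^ 2) ^ 3 := by
        rw [mul_pow, mul_pow, ← pow_mul, ← pow_mul]
        gcongr
        norm_num
  have h25 : |lam| * a ^ 2 ≤ 25 * F ^ 2 := by
    have h1 : |lam| * a * a ≤ (r * w + m) * a := by gcongr
    have h2 : m * a ≤ 5 * F * F := by gcongr
    nlinarith
  have hn : (n : ℝ) / 2 * a ^ 2 ≤ n / 2 * F ^ 2 := by gcongr
  linarith

lemma accretive (h : IsCCR T V D) (u : S) :
    n / 2 * ‖T u‖ ^ 2 ≤ (⟪T (oscillator V D u), T u⟫_ℂ).re := by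
  rw [h.inner_oscillator, Complex.ofReal_re]
  have key : ∀ j, ‖T u‖ ^ 2 / 2 ≤ ‖T (D j u)‖ ^ 2 + ‖T (V j u)‖ ^ 2 / 4 := fun j ↦ by
    have h1 : ‖T u‖ ^ 2 = -2 * (⟪T (D j u), T (V j u)⟫_ℂ).re := by
      have h1 : ⟪T (D j u), T (V j u)⟫_ℂ = -⟪T (V j u), T (D j u)⟫_ℂ - ((‖T u‖ ^ 2 : ℝ) : ℂ) := by
        rw [h.skew, h.ccr, if_pos rfl, map_add, inner_add_right, ← h.symm,
          inner_self_eq_norm_sq_to_K]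
        simp
        ring
      have h2 := congrArg Complex.re h1
      rw [← inner_conj_symm (T (V j u))] at h2
      simp only [Complex.sub_re, Complex.neg_re, Complex.conj_re, Complex.ofReal_re] at h2
      linarith
    have h2 := (abs_le.1 ((Complex.abs_re_le_norm _).trans
      (norm_inner_le_norm (𝕜 := ℂ) (T (D j u)) (T (V j u))))).1
    nlinarith [sq_nonneg (‖T (D j u)‖ - ‖T (V j u)‖ / 2)]
  calc n / 2 * ‖T u‖ ^ 2 = ∑ _j : Fin n, ‖T u‖ ^ 2 / 2 := by simp; ring
    _ ≤ ∑ j, (‖T (D j u)‖ ^ 2 + ‖T (V j u)‖ ^ 2 / 4) := Finset.sum_le_sum fun j _ ↦ key j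
    _ = _ := by rw [Finset.sum_add_distrib, Finset.sum_div]

end IsCCR

end Abstract

section PhaseSpaceOperators

open scoped SchwartzMap LineDeriv

variable {n : ℕ}

/-- The coordinate vectors in the position directions. -/
abbrev posDir (j : Fin n) : PhaseN n := (EuclideanSpace.single j 1, 0)

/-- The coordinate vectors in the velocity directions. -/
abbrev velDir (j : Fin n) : PhaseN n := (0, EuclideanSpace.single j 1)

lemma hasTemperateGrowth_vel (j : Fin n) :
    Function.HasTemperateGrowth fun p : PhaseN n ↦ (p.2 j : ℂ) := by
  have : (fun p : PhaseN n ↦ (p.2 j : ℂ)) =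
      (Complex.ofRealCLM ∘L EuclideanSpace.proj j ∘L ContinuousLinearMap.snd ℝ (En n) (En n)) := by
    ext; simp
  rw [this]
  exact ContinuousLinearMap.hasTemperateGrowth _

/-- Multiplication by the velocity coordinate `v j`. -/
def velMul (j : Fin n) : 𝓢(PhaseN n, ℂ) →ₗ[ℂ] 𝓢(PhaseN n, ℂ) :=
  (SchwartzMap.smulLeftCLM ℂ fun p : PhaseN n ↦ (p.2 j : ℂ)).toLinearMap

/-- The derivative in the velocity coordinate `v j`. -/
def velDeriv (j : Fin n) : 𝓢(PhaseN n, ℂ) →ₗ[ℂ] 𝓢(PhaseN n, ℂ) :=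
  (LineDeriv.lineDerivOpCLM ℂ 𝓢(PhaseN n, ℂ) (velDir j)).toLinearMap

/-- The derivative in the position coordinate `x j`. -/
def posDeriv (j : Fin n) : 𝓢(PhaseN n, ℂ) →ₗ[ℂ] 𝓢(PhaseN n, ℂ) :=
  (LineDeriv.lineDerivOpCLM ℂ 𝓢(PhaseN n, ℂ) (posDir j)).toLinearMap

lemma velMul_apply (j : Fin n) (u : 𝓢(PhaseN n, ℂ)) (p : PhaseN n) :
    velMul j u p = (p.2 j : ℂ) * u p := by
  simp [velMul, SchwartzMap.smulLeftCLM_apply_apply (hasTemperateGrowth_vel j)]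

lemma posDeriv_eq (j : Fin n) (u : 𝓢(PhaseN n, ℂ)) : posDeriv j u = ∂_{posDir j} u := rfl

lemma coe_velDeriv (j : Fin n) (u : 𝓢(PhaseN n, ℂ)) : ⇑(velDeriv j u) = dvjN n u j := rfl

lemma coe_posDeriv (j : Fin n) (u : 𝓢(PhaseN n, ℂ)) : ⇑(posDeriv j u) = dxjN n u j := rfl

lemma velMul_comm (j k : Fin n) (u : 𝓢(PhaseN n, ℂ)) :
    velMul j (velMul k u) = velMul k (velMul j u) := by
  ext p; simp only [velMul_apply]; ring

lemma hasFDerivAt_vel (j : Fin n) (p : PhaseN n) :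
    HasFDerivAt (fun p : PhaseN n ↦ (p.2 j : ℂ))
      (Complex.ofRealCLM ∘L EuclideanSpace.proj j ∘L ContinuousLinearMap.snd ℝ (En n) (En n)) p :=
  (Complex.ofRealCLM ∘L EuclideanSpace.proj j ∘L
    ContinuousLinearMap.snd ℝ (En n) (En n)).hasFDerivAt

lemma velDeriv_velMul (j k : Fin n) (u : 𝓢(PhaseN n, ℂ)) :
    velDeriv j (velMul k u) = velMul k (velDeriv j u) + if j = k then u else 0 := by
  ext p
  have h1 : (⇑(velMul k u) : PhaseN n → ℂ) = fun p ↦ (p.2 k : ℂ) * u p :=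
    funext fun p ↦ velMul_apply k u p
  rw [add_apply, velMul_apply, coe_velDeriv, coe_velDeriv, dvjN, h1,
    ((hasFDerivAt_vel k p).fun_mul (u.hasFDerivAt p)).fderiv]
  by_cases h : j = k
  · subst h; simp [dvjN]
  · simp [dvjN, h, Ne.symm h]

/-- The transport operator `v · ∂ₓ`. -/
def transport : 𝓢(PhaseN n, ℂ) →ₗ[ℂ] 𝓢(PhaseN n, ℂ) :=
  ∑ j, velMul j ∘ₗ posDeriv j

lemma transport_apply (u : 𝓢(PhaseN n, ℂ)) : transport u = ∑ j, velMul j (posDeriv j u) := by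
  simp [transport]

/-- The free Kramers-Fokker-Planck operator on the Schwartz space. -/
def kfp : 𝓢(PhaseN n, ℂ) →ₗ[ℂ] 𝓢(PhaseN n, ℂ) :=
  transport + oscillator velMul velDeriv - (n / 2 : ℂ) • LinearMap.id

lemma kfp_eq (u : 𝓢(PhaseN n, ℂ)) :
    kfp u = transport u + oscillator velMul velDeriv u - (n / 2 : ℂ) • u := rfl

lemma sum_velMul_velMul_apply (u : 𝓢(PhaseN n, ℂ)) (p : PhaseN n) :
    (∑ j, velMul j (velMul j u)) p = ((‖p.2‖ ^ 2 : ℝ) : ℂ) * u p := by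
  rw [sum_apply]
  simp only [velMul_apply, ← mul_assoc, ← Finset.sum_mul, EuclideanSpace.real_norm_sq_eq]
  push_cast
  simp [sq]

lemma sum_velDeriv_velDeriv_apply (u : 𝓢(PhaseN n, ℂ)) (p : PhaseN n) :
    (∑ j, velDeriv j (velDeriv j u)) p = lapvN n u p := by
  rw [sum_apply]
  rfl

lemma kfp_apply (u : 𝓢(PhaseN n, ℂ)) (p : PhaseN n) : kfp u p = KFP0N n u p := by
  rw [kfp_eq, oscillator_apply, transport_apply, KFP0N]
  simp only [add_apply, sub_apply, smul_apply,
    neg_apply, sum_velMul_velMul_apply, sum_velDeriv_velDeriv_apply]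
  rw [sum_apply]
  simp only [velMul_apply, coe_posDeriv, smul_eq_mul]
  push_cast
  ring

end PhaseSpaceOperators

section PartialFourier

open scoped SchwartzMap LineDeriv FourierTransform ComplexConjugate

variable {n : ℕ}

/-- An integrable majorant on `ℝⁿ`. -/
def decay (x : En n) : ℝ := (1 + ‖x‖) ^ (-(n + 1 : ℝ))

lemma decay_pos (x : En n) : 0 < decay x := by unfold decay; positivity

lemma decay_le_one (x : En n) : decay x ≤ 1 :=
  Real.rpow_le_one_of_one_le_of_nonpos (by simp) (by linarith [n.cast_nonneg (α := ℝ)])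

lemma integrable_decay : Integrable (decay (n := n)) :=
  integrable_one_add_norm (by simp)

lemma exists_le_decay (w : 𝓢(PhaseN n, ℂ)) :
    ∃ C, 0 ≤ C ∧ ∀ p : PhaseN n, ‖w p‖ ≤ C * (decay p.1 * decay p.2) := by
  refine ⟨2 ^ (2 * (n + 1)) * ((Finset.Iic (2 * (n + 1), 0)).sup fun m ↦
    SchwartzMap.seminorm ℂ m.1 m.2) w, by positivity, fun p ↦ ?_⟩
  · have h := SchwartzMap.one_add_le_sup_seminorm_apply (𝕜 := ℂ) (m := (2 * (n + 1), 0))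
      (k := 2 * (n + 1)) (n := 0) le_rfl le_rfl w p
    rw [norm_iteratedFDeriv_zero] at h
    have h1 : decay p.1 * decay p.2 = ((1 + ‖p.1‖) ^ (n + 1) * (1 + ‖p.2‖) ^ (n + 1))⁻¹ := by
      simp only [decay]
      rw [Real.rpow_neg (by positivity), Real.rpow_neg (by positivity), mul_inv]
      norm_cast
    rw [h1, ← div_eq_mul_inv, le_div_iff₀ (by positivity), mul_comm]
    refine le_trans ?_ h
    have h2 := norm_fst_le p
    have h3 := norm_snd_le p
    calc _ ≤ (1 + ‖p‖) ^ (n + 1) * (1 + ‖p‖) ^ (n + 1) * ‖w p‖ := by gcongr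
      _ = _ := by rw [← pow_add, two_mul]

/-- The restriction of a Schwartz function on phase space to a fixed velocity. -/
def posSlice (v : En n) : 𝓢(PhaseN n, ℂ) →L[ℂ] 𝓢(En n, ℂ) :=
  SchwartzMap.compCLM ℂ (g := fun x : En n ↦ (x, v))
    (by
      have h : (fun x : En n ↦ (x, v)) =
          fun x ↦ ContinuousLinearMap.inl ℝ (En n) (En n) x + (0, v) := by ext <;> simp
      rw [h]
      exact (ContinuousLinearMap.hasTemperateGrowth _).add (.const _))
    ⟨1, 1, fun x ↦ by
      have := norm_fst_le (x, v)
      simp only at this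
      linarith⟩

@[simp]
lemma posSlice_apply (v : En n) (w : 𝓢(PhaseN n, ℂ)) (x : En n) : posSlice v w x = w (x, v) := rfl

lemma posSlice_posDeriv (v : En n) (w : 𝓢(PhaseN n, ℂ)) (j : Fin n) :
    posSlice v (posDeriv j w) = ∂_{EuclideanSpace.single j (1 : ℝ)} (posSlice v w) := by
  ext x
  rw [posSlice_apply, coe_posDeriv, dxjN, SchwartzMap.lineDerivOp_apply_eq_fderiv]
  have h : HasFDerivAt (fun x : En n ↦ (x, v)) (ContinuousLinearMap.inl ℝ (En n) (En n)) x :=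
    (hasFDerivAt_id x).prodMk (hasFDerivAt_const v x)
  have h2 : HasFDerivAt (posSlice v w) _ x :=
    HasFDerivAt.comp (g := w) x (w.hasFDerivAt (x, v)) h
  rw [h2.fderiv]
  rfl

lemma pftxN_eq_fourier (w : 𝓢(PhaseN n, ℂ)) (q : PhaseN n) :
    pftxN n w q = 𝓕 (posSlice q.2 w) q.1 := by
  rw [SchwartzMap.fourier_coe, Real.fourier_eq']
  refine integral_congr_ae (.of_forall fun x ↦ ?_)
  simp only [posSlice_apply, smul_eq_mul, PiLp.inner_apply]
  congr 3
  push_cast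
  simp [mul_comm]

lemma norm_pftxN_kernel (x ξ : En n) :
    ‖Complex.exp (-(((2 * π * ∑ j : Fin n, x j * ξ j : ℝ)) : ℂ) * Complex.I)‖ = 1 := by
  rw [← Complex.ofReal_neg, Complex.norm_exp_ofReal_mul_I]

lemma pftxN_posDeriv (w : 𝓢(PhaseN n, ℂ)) (j : Fin n) (q : PhaseN n) :
    pftxN n (posDeriv j w) q = (2 * π * I * q.1 j) * pftxN n w q := by
  rw [pftxN_eq_fourier, pftxN_eq_fourier, posSlice_posDeriv, SchwartzMap.fourier_lineDerivOp_eq,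
    smul_apply, SchwartzMap.smulLeftCLM_apply_apply (by fun_prop)]
  simp [EuclideanSpace.inner_single_right, mul_assoc]

lemma pftxN_velMul (w : 𝓢(PhaseN n, ℂ)) (j : Fin n) (q : PhaseN n) :
    pftxN n (velMul j w) q = q.2 j * pftxN n w q := by
  rw [pftxN_eq_fourier, pftxN_eq_fourier]
  have : posSlice q.2 (velMul j w) = (q.2 j : ℂ) • posSlice q.2 w := by
    ext x; simp [velMul_apply]
  rw [this, FourierTransform.fourier_smul]
  simp

lemma pftxN_add (w w' : 𝓢(PhaseN n, ℂ)) (q : PhaseN n) :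
    pftxN n (w + w' : 𝓢(PhaseN n, ℂ)) q = pftxN n w q + pftxN n w' q := by
  rw [pftxN_eq_fourier, pftxN_eq_fourier, pftxN_eq_fourier]
  simp [FourierTransform.fourier_add]

lemma pftxN_smul (c : ℂ) (w : 𝓢(PhaseN n, ℂ)) (q : PhaseN n) :
    pftxN n (c • w : 𝓢(PhaseN n, ℂ)) q = c * pftxN n w q := by
  rw [pftxN_eq_fourier, pftxN_eq_fourier]
  simp [FourierTransform.fourier_smul]

lemma stronglyMeasurable_pftxN (w : 𝓢(PhaseN n, ℂ)) : StronglyMeasurable (pftxN n w) := by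
  unfold pftxN
  refine StronglyMeasurable.integral_prod_right (f := fun (q : PhaseN n) (x : En n) ↦
    Complex.exp (-(((2 * π * ∑ j : Fin n, x j * q.1 j : ℝ)) : ℂ) * Complex.I) * w (x, q.2)) ?_
  have := w.continuous
  exact Continuous.stronglyMeasurable (by unfold Function.uncurry; fun_prop)

lemma exists_norm_pftxN_le (w : 𝓢(PhaseN n, ℂ)) :
    ∃ C, ∀ q : PhaseN n, ‖pftxN n w q‖ ≤ C * decay q.2 := by
  obtain ⟨C, hC, h⟩ := exists_le_decay w
  refine ⟨C * ∫ x : En n, decay x, fun q ↦ ?_⟩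
  calc ‖pftxN n w q‖ ≤ ∫ x : En n, C * decay q.2 * decay x := by
        refine norm_integral_le_of_norm_le (integrable_decay.const_mul _) (.of_forall fun x ↦ ?_)
        rw [norm_mul, norm_pftxN_kernel, one_mul]
        exact (h (x, q.2)).trans_eq (by ring)
    _ = _ := by rw [integral_const_mul]; ring

lemma memLp_pftxN (w : 𝓢(PhaseN n, ℂ)) (ξ : En n) :
    MemLp (fun v : En n ↦ pftxN n w (ξ, v)) 2 := by
  obtain ⟨C, h⟩ := exists_norm_pftxN_le w
  have hm : AEStronglyMeasurable (fun v : En n ↦ pftxN n w (ξ, v)) :=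
    ((stronglyMeasurable_pftxN w).comp_measurable measurable_prodMk_left).aestronglyMeasurable
  refine (memLp_two_iff_integrable_sq_norm hm).2 ?_
  refine Integrable.mono' (integrable_decay.const_mul (C ^ 2)) (hm.norm.pow 2)
    (.of_forall fun v ↦ ?_)
  rw [Real.norm_of_nonneg (by positivity)]
  calc ‖pftxN n w (ξ, v)‖ ^ 2 ≤ (C * decay v) ^ 2 := by gcongr; exact h (ξ, v)
    _ = C ^ 2 * (decay v * decay v) := by ring
    _ ≤ C ^ 2 * (decay v * 1) := by
      gcongr
      exacts [(decay_pos v).le, decay_le_one v]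
    _ = _ := by ring

lemma hasLineDerivAt_pftxN (w : 𝓢(PhaseN n, ℂ)) (j : Fin n) (ξ v : En n) :
    HasLineDerivAt ℝ (fun v : En n ↦ pftxN n w (ξ, v)) (pftxN n (velDeriv j w) (ξ, v)) v
      (EuclideanSpace.single j 1) := by
  obtain ⟨C, hC, h⟩ := exists_le_decay (velDeriv j w)
  obtain ⟨C', hC', h'⟩ := exists_le_decay w
  have hcw := w.continuous
  have hcd := (velDeriv j w).continuous
  set e : En n := EuclideanSpace.single j 1
  let K : En n → ℂ := fun x ↦
    Complex.exp (-(((2 * π * ∑ j : Fin n, x j * ξ j : ℝ)) : ℂ) * Complex.I)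
  have hK : Continuous K := by fun_prop
  have key := (hasDerivAt_integral_of_dominated_loc_of_deriv_le (μ := (volume : Measure (En n)))
    (F := fun (t : ℝ) x ↦ K x * w (x, v + t • e))
    (F' := fun (t : ℝ) x ↦ K x * velDeriv j w (x, v + t • e)) (x₀ := 0) (s := Set.univ)
    (bound := fun x ↦ C * decay x) Filter.univ_mem
    (.of_forall fun t ↦ Continuous.aestronglyMeasurable (by fun_prop)) ?_
    (Continuous.aestronglyMeasurable (by fun_prop)) (.of_forall fun x t _ ↦ ?_)
    (integrable_decay.const_mul _) (.of_forall fun x t _ ↦ ?_)).2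
  · have h0 : v + (0 : ℝ) • e = v := by simp
    rw [h0] at key
    exact key
  · refine Integrable.mono' (integrable_decay.const_mul C')
      (Continuous.aestronglyMeasurable (by fun_prop)) (.of_forall fun x ↦ ?_)
    rw [norm_mul, norm_pftxN_kernel, one_mul]
    refine (h' _).trans ?_
    gcongr
    exact mul_le_of_le_one_right (decay_pos _).le (decay_le_one _)
  · rw [norm_mul, norm_pftxN_kernel, one_mul]
    refine (h _).trans ?_
    gcongr
    exact mul_le_of_le_one_right (decay_pos _).le (decay_le_one _)
  · have h1 : HasDerivAt (fun t : ℝ ↦ (x, v + t • e)) (velDir j) t :=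
      (hasDerivAt_const t x).prodMk (by simpa using ((hasDerivAt_id t).smul_const e).const_add v)
    exact ((w.hasFDerivAt _).comp_hasDerivAt t h1).const_mul _

/-- The slice at frequency `ξ` of the partial Fourier transform in the position variable. -/
def freqSlice (ξ : En n) : 𝓢(PhaseN n, ℂ) →ₗ[ℂ] Lp ℂ 2 (volume : Measure (En n)) where
  toFun w := (memLp_pftxN w ξ).toLp
  map_add' w w' := by
    rw [← MemLp.toLp_add]
    exact MemLp.toLp_congr _ _ (.of_forall fun v ↦ pftxN_add w w' _)
  map_smul' c w := by
    rw [RingHom.id_apply, ← MemLp.toLp_const_smul]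
    exact MemLp.toLp_congr _ _ (.of_forall fun v ↦ pftxN_smul c w _)

lemma inner_freqSlice (ξ : En n) (a b : 𝓢(PhaseN n, ℂ)) :
    inner ℂ (freqSlice ξ a) (freqSlice ξ b) =
      ∫ v : En n, conj (pftxN n a (ξ, v)) * pftxN n b (ξ, v) := by
  rw [L2.inner_def]
  refine integral_congr_ae ?_
  filter_upwards [(memLp_pftxN a ξ).coeFn_toLp, (memLp_pftxN b ξ).coeFn_toLp] with v h1 h2
  change inner ℂ ((memLp_pftxN a ξ).toLp _ v) ((memLp_pftxN b ξ).toLp _ v) = _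
  rw [h1, h2, RCLike.inner_apply, mul_comm]

lemma norm_sq_freqSlice (ξ : En n) (a : 𝓢(PhaseN n, ℂ)) :
    ‖freqSlice ξ a‖ ^ 2 = ∫ v : En n, ‖pftxN n a (ξ, v)‖ ^ 2 := by
  have h := inner_freqSlice ξ a a
  rw [inner_self_eq_norm_sq_to_K] at h
  simp only [RCLike.conj_mul] at h
  simp only [Complex.coe_algebraMap, ← Complex.ofReal_pow] at h
  rw [integral_complex_ofReal] at h
  exact_mod_cast h

lemma integrable_pftxN_mul (a b : 𝓢(PhaseN n, ℂ)) (ξ : En n) :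
    Integrable fun v ↦ conj (pftxN n a (ξ, v)) * pftxN n b (ξ, v) :=
  (memLp_pftxN a ξ).star.integrable_mul (memLp_pftxN b ξ)

lemma isCCR_freqSlice (ξ : En n) : IsCCR (freqSlice ξ) (velMul (n := n)) velDeriv where
  symm j a b := by
    simp only [inner_freqSlice, pftxN_velMul, map_mul, Complex.conj_ofReal]
    congr with v
    ring
  skew j a b := by
    simp only [inner_freqSlice]
    have := integral_bilinear_hasLineDerivAt_right_eq_neg_left_of_integrable
      (μ := (volume : Measure (En n)))
      (f := fun v ↦ conj (pftxN n a (ξ, v))) (f' := fun v ↦ conj (pftxN n (velDeriv j a) (ξ, v)))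
      (g := fun v ↦ pftxN n b (ξ, v)) (g' := fun v ↦ pftxN n (velDeriv j b) (ξ, v))
      (v := EuclideanSpace.single j 1) (B := ContinuousLinearMap.mul ℝ ℂ)
      (integrable_pftxN_mul _ _ ξ) (integrable_pftxN_mul _ _ ξ) (integrable_pftxN_mul _ _ ξ)
      (fun v _ ↦ by
        have h := hasLineDerivAt_pftxN a j ξ v
        exact (Complex.conjCLE.toContinuousLinearMap.hasFDerivAt).comp_hasDerivAt 0 h)
      (fun v _ ↦ hasLineDerivAt_pftxN b j ξ v)
    simp only [ContinuousLinearMap.mul_apply'] at this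
    rw [this, neg_neg]
  comm j k a := velMul_comm j k a
  ccr j k a := velDeriv_velMul j k a

end PartialFourier

section SubellipticEstimate

open scoped SchwartzMap FourierTransform

variable {n : ℕ}

instance isAddHaarMeasure_volume_phaseN : (volume : Measure (PhaseN n)).IsAddHaarMeasure :=
  inferInstanceAs ((volume : Measure (En n)).prod volume).IsAddHaarMeasure

lemma integrable_norm_sq (w : 𝓢(PhaseN n, ℂ)) : Integrable fun p : PhaseN n ↦ ‖w p‖ ^ 2 :=
  (memLp_two_iff_integrable_sq_norm w.continuous.aestronglyMeasurable).1 (w.memLp 2)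

lemma integral_norm_sq_pftxN_slice (w : 𝓢(PhaseN n, ℂ)) (v : En n) :
    ∫ ξ : En n, ‖pftxN n w (ξ, v)‖ ^ 2 = ∫ x : En n, ‖w (x, v)‖ ^ 2 := by
  simp only [pftxN_eq_fourier]
  exact SchwartzMap.integral_norm_sq_fourier (posSlice v w)

lemma integrable_norm_sq_pftxN (w : 𝓢(PhaseN n, ℂ)) :
    Integrable fun q : PhaseN n ↦ ‖pftxN n w q‖ ^ 2 := by
  refine (integrable_prod_iff' ?_).2 ⟨.of_forall fun v ↦ ?_, ?_⟩
  · exact ((stronglyMeasurable_pftxN w).norm.pow 2).aestronglyMeasurable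
  · simp only [pftxN_eq_fourier]
    set g := 𝓕 (posSlice v w)
    exact (memLp_two_iff_integrable_sq_norm g.continuous.aestronglyMeasurable).1 (g.memLp 2)
  · simp only [norm_pow, norm_norm, integral_norm_sq_pftxN_slice]
    exact (integrable_norm_sq w).integral_prod_right

/-- Plancherel's theorem for the partial Fourier transform. -/
lemma integral_norm_sq_pftxN (w : 𝓢(PhaseN n, ℂ)) :
    ∫ q : PhaseN n, ‖pftxN n w q‖ ^ 2 = ∫ p : PhaseN n, ‖w p‖ ^ 2 := by
  rw [Measure.volume_eq_prod, integral_prod_symm _ (integrable_norm_sq_pftxN w),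
    integral_prod_symm _ (integrable_norm_sq w)]
  simp only [integral_norm_sq_pftxN_slice]

lemma integrable_norm_sq_freqSlice (w : 𝓢(PhaseN n, ℂ)) :
    Integrable fun ξ : En n ↦ ‖freqSlice ξ w‖ ^ 2 := by
  simp only [norm_sq_freqSlice]
  exact (integrable_norm_sq_pftxN w).integral_prod_left

lemma integral_norm_sq_freqSlice (w : 𝓢(PhaseN n, ℂ)) :
    ∫ ξ : En n, ‖freqSlice ξ w‖ ^ 2 = ∫ p : PhaseN n, ‖w p‖ ^ 2 := by
  simp only [norm_sq_freqSlice]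
  rw [← integral_norm_sq_pftxN, Measure.volume_eq_prod,
    integral_prod _ (integrable_norm_sq_pftxN w)]

lemma freqSlice_velMul_posDeriv (ξ : En n) (j : Fin n) (u : 𝓢(PhaseN n, ℂ)) :
    freqSlice ξ (velMul j (posDeriv j u)) = (2 * π * I * ξ j : ℂ) • freqSlice ξ (velMul j u) := by
  rw [← map_smul]
  refine MemLp.toLp_congr (memLp_pftxN _ ξ) (memLp_pftxN _ ξ) (.of_forall fun v ↦ ?_)
  simp only [pftxN_smul, pftxN_velMul, pftxN_velMul, pftxN_posDeriv]
  ring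

/-- The shifted operator `P₀ + (n + 2) / 2 - i λ` on the Schwartz space. -/
def shiftedKfp (lam : ℝ) (u : 𝓢(PhaseN n, ℂ)) : 𝓢(PhaseN n, ℂ) :=
  kfp u + (((n : ℝ) + 2) / 2 : ℂ) • u - (I * lam) • u

lemma freqSlice_shiftedKfp (ξ : En n) (lam : ℝ) (u : 𝓢(PhaseN n, ℂ)) :
    freqSlice ξ (shiftedKfp lam u) =
      I • freqSlice ξ (transportMul velMul (fun j ↦ 2 * π * ξ j) lam u)
        + freqSlice ξ (oscillator velMul velDeriv u) + freqSlice ξ u := by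
  simp only [shiftedKfp, kfp_eq, transport_apply, transportMul_apply, map_add, map_sub, map_sum,
    map_smul, freqSlice_velMul_posDeriv, smul_sub, Finset.smul_sum, smul_smul]
  have h : ∀ j, (2 * π * I * ξ j : ℂ) = I * ((2 * π * ξ j : ℝ) : ℂ) := fun j ↦ by
    push_cast; ring
  simp only [h]
  module

lemma freqSlice_estimate (lam : ℝ) (u : 𝓢(PhaseN n, ℂ)) (ξ : En n) :
    |lam| * ‖freqSlice ξ u‖ ^ 2 + ‖freqSlice ξ (∑ j, velDeriv j (velDeriv j u))‖ ^ 2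
      + ‖freqSlice ξ (∑ j, velMul j (velMul j u))‖ ^ 2
      + ((2 * π) ^ 2 * ‖ξ‖ ^ 2) ^ ((2 : ℝ) / 3) * ‖freqSlice ξ u‖ ^ 2 ≤
      (16 * (36 + n / 2) + 50) * ‖freqSlice ξ (shiftedKfp lam u)‖ ^ 2 := by
  have h := (isCCR_freqSlice ξ).subelliptic (fun j ↦ 2 * π * ξ j) lam u _
    (freqSlice_shiftedKfp ξ lam u)
  simp only [mul_pow (2 * π), ← Finset.mul_sum, ← EuclideanSpace.real_norm_sq_eq] at h
  exact h

lemma integrable_norm_sq_fracDeriv (u : 𝓢(PhaseN n, ℂ)) :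
    Integrable fun q : PhaseN n ↦
      ((2 * π) ^ 2 * ‖q.1‖ ^ 2) ^ ((2 : ℝ) / 3) * ‖pftxN n u q‖ ^ 2 := by
  have hm : Continuous fun ξ : En n ↦ ((2 * π) ^ 2 * ‖ξ‖ ^ 2) ^ ((2 : ℝ) / 3) :=
    Continuous.rpow_const (by fun_prop) fun _ ↦ Or.inr (by norm_num)
  refine (integrable_prod_iff ?_).2 ⟨.of_forall fun ξ ↦ ?_, ?_⟩
  · exact ((hm.comp continuous_fst).stronglyMeasurable.mul
      ((stronglyMeasurable_pftxN u).norm.pow 2)).aestronglyMeasurable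
  · exact ((memLp_two_iff_integrable_sq_norm (memLp_pftxN u ξ).1).1 (memLp_pftxN u ξ)).const_mul
      (((2 * π) ^ 2 * ‖ξ‖ ^ 2) ^ ((2 : ℝ) / 3))
  · refine Integrable.mono' (g := fun ξ ↦
      (16 * (36 + n / 2) + 50) * ‖freqSlice ξ (shiftedKfp 0 u)‖ ^ 2)
      ((integrable_norm_sq_freqSlice _).const_mul _) ?_ (.of_forall fun ξ ↦ ?_)
    · simp only [norm_mul, norm_pow, norm_norm, integral_const_mul, ← norm_sq_freqSlice]
      exact hm.norm.aestronglyMeasurable.mul (integrable_norm_sq_freqSlice u).1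
    · simp only [norm_mul, norm_pow, norm_norm, integral_const_mul, ← norm_sq_freqSlice]
      rw [Real.norm_of_nonneg (by positivity)]
      have := freqSlice_estimate 0 u ξ
      simp only [abs_zero, zero_mul] at this
      nlinarith [sq_nonneg ‖freqSlice ξ (∑ j, velDeriv j (velDeriv j u))‖,
        sq_nonneg ‖freqSlice ξ (∑ j, velMul j (velMul j u))‖]

lemma integral_norm_sq_fracDeriv (u : 𝓢(PhaseN n, ℂ)) :
    ∫ q : PhaseN n, ((2 * π) ^ 2 * ‖q.1‖ ^ 2) ^ ((2 : ℝ) / 3) * ‖pftxN n u q‖ ^ 2 =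
      ∫ ξ : En n, ((2 * π) ^ 2 * ‖ξ‖ ^ 2) ^ ((2 : ℝ) / 3) * ‖freqSlice ξ u‖ ^ 2 := by
  rw [Measure.volume_eq_prod, integral_prod _ (integrable_norm_sq_fracDeriv u)]
  simp only [integral_const_mul, norm_sq_freqSlice]

/-- The uniform subelliptic estimate. -/
theorem subelliptic_estimate (u : 𝓢(PhaseN n, ℂ)) (lam : ℝ) :
    |lam| * (∫ p : PhaseN n, ‖u p‖ ^ 2)
        + (∫ p : PhaseN n, ‖lapvN n (⇑u) p‖ ^ 2)
        + (∫ p : PhaseN n, ‖p.2‖ ^ 4 * ‖u p‖ ^ 2)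
        + (∫ q : PhaseN n, ((2 * π) ^ 2 * ‖q.1‖ ^ 2) ^ ((2:ℝ)/3) * ‖pftxN n (⇑u) q‖ ^ 2)
      ≤ (16 * (36 + n / 2) + 50) * ∫ p : PhaseN n,
          ‖KFP0N n (⇑u) p + ((((n : ℝ) + 2) / 2 : ℝ) : ℂ) * u p
            - Complex.I * (lam : ℝ) * u p‖ ^ 2 := by
  have h1 : ∫ p : PhaseN n, ‖lapvN n (⇑u) p‖ ^ 2 =
      ∫ ξ, ‖freqSlice ξ (∑ j, velDeriv j (velDeriv j u))‖ ^ 2 := by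
    simp only [integral_norm_sq_freqSlice, sum_velDeriv_velDeriv_apply]
  have h2 : ∫ p : PhaseN n, ‖p.2‖ ^ 4 * ‖u p‖ ^ 2 =
      ∫ ξ, ‖freqSlice ξ (∑ j, velMul j (velMul j u))‖ ^ 2 := by
    simp only [integral_norm_sq_freqSlice, sum_velMul_velMul_apply, norm_mul, Complex.norm_real,
      norm_pow, norm_norm, mul_pow, ← pow_mul]
  have h3 : ∫ p : PhaseN n, ‖KFP0N n (⇑u) p + ((((n : ℝ) + 2) / 2 : ℝ) : ℂ) * u p
      - Complex.I * (lam : ℝ) * u p‖ ^ 2 = ∫ ξ, ‖freqSlice ξ (shiftedKfp lam u)‖ ^ 2 := by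
    rw [integral_norm_sq_freqSlice]
    congr with p
    simp [shiftedKfp, kfp_apply]
  have i1 := integrable_norm_sq_freqSlice u
  have i2 := integrable_norm_sq_freqSlice (∑ j, velDeriv j (velDeriv j u))
  have i3 := integrable_norm_sq_freqSlice (∑ j, velMul j (velMul j u))
  have i4 : Integrable fun ξ : En n ↦
      ((2 * π) ^ 2 * ‖ξ‖ ^ 2) ^ ((2 : ℝ) / 3) * ‖freqSlice ξ u‖ ^ 2 := by
    have := (integrable_norm_sq_fracDeriv u).integral_prod_left
    simpa only [integral_const_mul, ← norm_sq_freqSlice] using this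
  have j2 := (i1.const_mul |lam|).add i2
  have j3 := j2.add i3
  have key := integral_mono (j3.add i4) ((integrable_norm_sq_freqSlice _).const_mul _)
    (freqSlice_estimate lam u)
  rwa [integral_add' j3 i4, integral_add' j2 i3, integral_add' (i1.const_mul _) i2,
    integral_const_mul, integral_const_mul, ← h1, ← h2, ← h3, ← integral_norm_sq_fracDeriv,
    integral_norm_sq_freqSlice u] at key

end SubellipticEstimate

section Accretivity

open scoped SchwartzMap LineDeriv ComplexConjugate

variable {n : ℕ}

/-- The embedding of the Schwartz space on phase space into `L²`. -/
def toL2 : 𝓢(PhaseN n, ℂ) →ₗ[ℂ] HspN n :=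
  (SchwartzMap.toLpCLM ℂ ℂ 2 (volume : Measure (PhaseN n))).toLinearMap

lemma toL2_eq (u : 𝓢(PhaseN n, ℂ)) : toL2 u = u.toLp 2 := rfl

lemma inner_toL2 (a b : 𝓢(PhaseN n, ℂ)) :
    inner ℂ (toL2 a) (toL2 b) = ∫ p : PhaseN n, conj (a p) * b p := by
  rw [L2.inner_def]
  refine integral_congr_ae ?_
  filter_upwards [a.coeFn_toLp 2, b.coeFn_toLp 2] with p h1 h2
  rw [toL2_eq, toL2_eq, h1, h2, RCLike.inner_apply, mul_comm]

lemma lineDeriv_skew (m : PhaseN n) (a b : 𝓢(PhaseN n, ℂ)) :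
    inner ℂ (toL2 (∂_{m} a)) (toL2 b) = -inner ℂ (toL2 a) (toL2 (∂_{m} b)) := by
  simp only [inner_toL2]
  have := SchwartzMap.integral_bilinear_lineDerivOp_right_eq_neg_left (μ := volume) a b
    ((ContinuousLinearMap.mul ℝ ℂ).comp Complex.conjCLE.toContinuousLinearMap) m
  simp only [ContinuousLinearMap.comp_apply, ContinuousLinearMap.mul_apply'] at this
  exact (neg_eq_iff_eq_neg.2 this).symm

lemma isCCR_toL2 : IsCCR toL2 (velMul (n := n)) velDeriv where
  symm j a b := by
    simp only [inner_toL2, velMul_apply, map_mul, Complex.conj_ofReal]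
    congr with v
    ring
  skew j a b := lineDeriv_skew _ a b
  comm j k a := velMul_comm j k a
  ccr j k a := velDeriv_velMul j k a

lemma posDeriv_velMul (j k : Fin n) (u : 𝓢(PhaseN n, ℂ)) :
    posDeriv j (velMul k u) = velMul k (posDeriv j u) := by
  ext p
  have h1 : (⇑(velMul k u) : PhaseN n → ℂ) = fun p ↦ (p.2 k : ℂ) * u p :=
    funext fun p ↦ velMul_apply k u p
  rw [velMul_apply, coe_posDeriv, coe_posDeriv, dxjN, h1,
    ((hasFDerivAt_vel k p).fun_mul (u.hasFDerivAt p)).fderiv]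
  simp [dxjN]

lemma transport_skew (a b : 𝓢(PhaseN n, ℂ)) :
    inner ℂ (toL2 (transport a)) (toL2 b) = -inner ℂ (toL2 a) (toL2 (transport b)) := by
  simp only [transport_apply, map_sum, sum_inner, inner_sum, isCCR_toL2.symm, posDeriv_eq,
    lineDeriv_skew]
  simp only [← posDeriv_eq, posDeriv_velMul, Finset.sum_neg_distrib]

/-- The free Kramers-Fokker-Planck operator is accretive. -/
theorem re_inner_kfp_nonneg (u : 𝓢(PhaseN n, ℂ)) :
    0 ≤ (inner ℂ (toL2 (kfp u)) (toL2 u)).re := by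
  have h1 := congrArg Complex.re (transport_skew u u)
  rw [← inner_conj_symm (toL2 u)] at h1
  simp only [Complex.neg_re, Complex.conj_re] at h1
  have h2 := isCCR_toL2.accretive u
  have h3 : (inner ℂ (toL2 ((n / 2 : ℂ) • u)) (toL2 u)).re = n / 2 * ‖toL2 u‖ ^ 2 := by
    rw [map_smul, inner_smul_left, inner_self_eq_norm_sq_to_K]
    have : (starRingEnd ℂ) (n / 2 : ℂ) = ((n / 2 : ℝ) : ℂ) := by
      rw [← Complex.conj_ofReal]; simp
    rw [this, Complex.re_ofReal_mul]
    simp [← Complex.ofReal_pow]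
  rw [kfp_eq, map_sub, map_add, inner_sub_left, inner_add_left, Complex.sub_re, Complex.add_re, h3]
  linarith

theorem integral_kfp_mul_conj_re_nonneg (u : 𝓢(PhaseN n, ℂ)) :
    0 ≤ (∫ p : PhaseN n, KFP0N n (⇑u) p * (starRingEnd ℂ) (u p)).re := by
  have h := re_inner_kfp_nonneg u
  rw [← inner_conj_symm, Complex.conj_re, inner_toL2] at h
  simpa only [kfp_apply, mul_comm] using h

end Accretivity

section Gaussian

open scoped SchwartzMap ContDiff Nat

variable {n : ℕ}

lemma one_add_pow_mul_exp_le {a : ℝ} (ha : 0 < a) (N : ℕ) {r : ℝ} (hr : 0 ≤ r) :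
    (1 + r) ^ N * Real.exp (-a * r ^ 2) ≤ N ! * Real.exp (1 + 1 / (4 * a)) := by
  have h1 : (1 + r) ^ N ≤ N ! * Real.exp (1 + r) := by
    have := Real.pow_div_factorial_le_exp (1 + r) (by positivity) N
    rwa [div_le_iff₀ (by positivity), mul_comm] at this
  have h2 : 1 + r + -a * r ^ 2 ≤ 1 + 1 / (4 * a) := by
    have : 1 / (4 * a) - r + a * r ^ 2 = (2 * a * r - 1) ^ 2 / (4 * a) := by field_simp; ring
    have : 0 ≤ (2 * a * r - 1) ^ 2 / (4 * a) := by positivity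
    linarith
  calc _ ≤ N ! * Real.exp (1 + r) * Real.exp (-a * r ^ 2) := by gcongr
    _ = N ! * Real.exp (1 + r + -a * r ^ 2) := by rw [mul_assoc, ← Real.exp_add]
    _ ≤ _ := by gcongr

lemma exists_norm_iteratedFDeriv_gaussian_le {a : ℝ} (ha : 0 < a) (k m : ℕ) :
    ∃ C, ∀ v : En n, ‖v‖ ^ k *
      ‖iteratedFDeriv ℝ m (fun v : En n ↦ Real.exp (-a * ‖v‖ ^ 2)) v‖ ≤ C := by
  have hf : Function.HasTemperateGrowth fun v : En n ↦ -a * ‖v‖ ^ 2 :=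
    (Function.HasTemperateGrowth.const (-a)).mul (Function.hasTemperateGrowth_norm_sq (En n))
  obtain ⟨l, C, hC, hl⟩ := hf.norm_iteratedFDeriv_le_uniform m
  refine ⟨m ! * (1 + C) ^ m * ((k + l * m) ! * Real.exp (1 + 1 / (4 * a))), fun v ↦ ?_⟩
  have h1 := norm_iteratedFDeriv_comp_le (𝕜 := ℝ) (g := Real.exp) (f := fun v : En n ↦ -a * ‖v‖ ^ 2)
    (n := m) (N := ∞) Real.contDiff_exp hf.1 (by exact_mod_cast le_top) v
    (C := Real.exp (-a * ‖v‖ ^ 2)) (D := (1 + C) * (1 + ‖v‖) ^ l)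
    (fun i _ ↦ by
      rw [norm_iteratedFDeriv_eq_norm_iteratedDeriv, iteratedDeriv_eq_iterate, Real.iter_deriv_exp,
        Real.norm_eq_abs, Real.abs_exp])
    (fun i hi1 hi ↦ (hl i hi v).trans <| by
      calc C * (1 + ‖v‖) ^ l ≤ (1 + C) * (1 + ‖v‖) ^ l := by gcongr; linarith
        _ ≤ _ := le_self_pow₀ (one_le_mul_of_one_le_of_one_le (by linarith)
          (one_le_pow₀ (by simp))) (by lia))
  have h2 := one_add_pow_mul_exp_le ha (k + l * m) (norm_nonneg v)
  calc _ ≤ (1 + ‖v‖) ^ k * (m ! * Real.exp (-a * ‖v‖ ^ 2) * ((1 + C) * (1 + ‖v‖) ^ l) ^ m) := by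
        refine mul_le_mul ?_ h1 (norm_nonneg _) (by positivity)
        gcongr
        linarith
    _ = m ! * (1 + C) ^ m * ((1 + ‖v‖) ^ (k + l * m) * Real.exp (-a * ‖v‖ ^ 2)) := by
      rw [mul_pow, ← pow_mul, pow_add]; ring
    _ ≤ _ := by gcongr

/-- The Gaussian `exp (-a ‖v‖²)` as a Schwartz function. -/
def gaussian {a : ℝ} (ha : 0 < a) : 𝓢(En n, ℂ) :=
  SchwartzMap.postcompCLM Complex.ofRealCLM
    { toFun := fun v ↦ Real.exp (-a * ‖v‖ ^ 2)
      smooth' := Real.contDiff_exp.comp (contDiff_const.mul (contDiff_norm_sq ℝ))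
      decay' := exists_norm_iteratedFDeriv_gaussian_le ha : 𝓢(En n, ℝ) }

lemma gaussian_apply {a : ℝ} (ha : 0 < a) (v : En n) :
    gaussian ha v = (Real.exp (-a * ‖v‖ ^ 2) : ℂ) := rfl

lemma hasTemperateGrowth_cexp_mul_I :
    Function.HasTemperateGrowth fun t : ℝ ↦ cexp (t * I) := by
  have h (m : ℕ) : iteratedDeriv m (fun t : ℝ ↦ cexp (t * I)) =
      fun t : ℝ ↦ I ^ m * cexp (t * I) := by
    induction m with
    | zero => ext; simp
    | succ m ih =>
      rw [iteratedDeriv_succ, ih]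
      ext t
      have : HasDerivAt (fun t : ℝ ↦ I ^ m * cexp (t * I)) (I ^ m * (cexp (t * I) * (1 * I))) t :=
        (((hasDerivAt_id (t : ℂ)).comp_ofReal.mul_const I).cexp).const_mul _
      rw [this.deriv]
      ring
  refine ⟨(Complex.ofRealCLM.contDiff.mul contDiff_const).cexp, fun m ↦ ⟨0, 1, fun t ↦ ?_⟩⟩
  rw [norm_iteratedFDeriv_eq_norm_iteratedDeriv, h]
  simp [Complex.norm_exp_ofReal_mul_I]

lemma hasTemperateGrowth_character (k : En n) :
    Function.HasTemperateGrowth fun y : En n ↦ cexp ((inner ℝ k y : ℝ) * I) :=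
  hasTemperateGrowth_cexp_mul_I.comp (Function.hasTemperateGrowth_inner_right k)

end Gaussian

section Shear

open scoped SchwartzMap LineDeriv ContDiff

variable {n : ℕ}

lemma exists_norm_iteratedFDeriv_comp_le (g : 𝓢(En n, ℂ)) (A : PhaseN n →L[ℝ] En n) (k m : ℕ) :
    ∃ C, 0 ≤ C ∧ ∀ i ≤ m, ∀ p : PhaseN n,
      (1 + ‖A p‖) ^ k * ‖iteratedFDeriv ℝ i (fun p ↦ g (A p)) p‖ ≤ C := by
  refine ⟨2 ^ k * ((Finset.Iic (k, m)).sup fun m ↦ SchwartzMap.seminorm ℂ m.1 m.2) g *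
    (1 + ‖A‖) ^ m, by positivity, fun i hi p ↦ ?_⟩
  have h := SchwartzMap.one_add_le_sup_seminorm_apply (𝕜 := ℂ) (m := (k, m))
      (k := k) (n := i) le_rfl hi g (A p)
  have h1 : ‖iteratedFDeriv ℝ i (fun p ↦ g (A p)) p‖ ≤ ‖iteratedFDeriv ℝ i g (A p)‖ * ‖A‖ ^ i := by
    have := A.iteratedFDeriv_comp_right (g.smooth ⊤) p (i := i) (by exact_mod_cast le_top)
    rw [show (fun p ↦ g (A p)) = g ∘ A from rfl, this]
    simpa using ContinuousMultilinearMap.norm_compContinuousLinearMap_le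
      (iteratedFDeriv ℝ i g (A p)) fun _ ↦ A
  have h2 : ‖A‖ ^ i ≤ (1 + ‖A‖) ^ m := by
    calc ‖A‖ ^ i ≤ (1 + ‖A‖) ^ i := by gcongr; linarith
      _ ≤ _ := pow_le_pow_right₀ (by simp) hi
  calc _ ≤ (1 + ‖A p‖) ^ k * (‖iteratedFDeriv ℝ i g (A p)‖ * (1 + ‖A‖) ^ m) := by
        gcongr
        exact h1.trans (by gcongr)
    _ = (1 + ‖A p‖) ^ k * ‖iteratedFDeriv ℝ i g (A p)‖ * (1 + ‖A‖) ^ m := by ring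
    _ ≤ _ := by gcongr

lemma exists_norm_iteratedFDeriv_shear_le (g h : 𝓢(En n, ℂ)) (k m : ℕ) :
    ∃ C, ∀ p : PhaseN n, ‖p‖ ^ k *
      ‖iteratedFDeriv ℝ m (fun p : PhaseN n ↦ g (p.1 - p.2) * h p.2) p‖ ≤ C := by
  set A : PhaseN n →L[ℝ] En n := ContinuousLinearMap.fst ℝ _ _ - ContinuousLinearMap.snd ℝ _ _
  set B : PhaseN n →L[ℝ] En n := ContinuousLinearMap.snd ℝ _ _
  obtain ⟨C₁, hC₁, h₁⟩ := exists_norm_iteratedFDeriv_comp_le g A k m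
  obtain ⟨C₂, hC₂, h₂⟩ := exists_norm_iteratedFDeriv_comp_le h B k m
  refine ⟨∑ i ∈ Finset.range (m + 1), m.choose i * (C₁ * C₂), fun p ↦ ?_⟩
  have hp : ‖p‖ ≤ (1 + ‖A p‖) * (1 + ‖B p‖) := by
    have h3 : ‖p.1‖ ≤ ‖A p‖ + ‖B p‖ := by
      simpa [A, B] using norm_add_le (p.1 - p.2) p.2
    have h4 : ‖p.2‖ = ‖B p‖ := rfl
    have h5 : 0 ≤ ‖A p‖ * ‖B p‖ := by positivity
    rw [Prod.norm_def, h4]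
    refine max_le ?_ ?_ <;> nlinarith [norm_nonneg (A p), norm_nonneg (B p)]
  have h6 := norm_iteratedFDeriv_mul_le (𝕜 := ℝ) (f := fun p ↦ g (A p)) (g := fun p ↦ h (B p))
    (N := ∞) ((g.smooth ⊤).comp A.contDiff) ((h.smooth ⊤).comp B.contDiff) p (n := m)
    (by exact_mod_cast le_top)
  calc _ ≤ ((1 + ‖A p‖) * (1 + ‖B p‖)) ^ k * ∑ i ∈ Finset.range (m + 1), m.choose i *
          ‖iteratedFDeriv ℝ i (fun p ↦ g (A p)) p‖ *
            ‖iteratedFDeriv ℝ (m - i) (fun p ↦ h (B p)) p‖ := by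
        refine mul_le_mul ?_ h6 (norm_nonneg _) (by positivity)
        gcongr
    _ = ∑ i ∈ Finset.range (m + 1), m.choose i *
          (((1 + ‖A p‖) ^ k * ‖iteratedFDeriv ℝ i (fun p ↦ g (A p)) p‖) *
            ((1 + ‖B p‖) ^ k * ‖iteratedFDeriv ℝ (m - i) (fun p ↦ h (B p)) p‖)) := by
      rw [Finset.mul_sum]
      refine Finset.sum_congr rfl fun i _ ↦ ?_
      rw [mul_pow]
      ring
    _ ≤ _ := by
      refine Finset.sum_le_sum fun i hi ↦ ?_
      have hi' : i ≤ m := by simpa [Nat.lt_succ_iff] using hi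
      gcongr
      · exact h₁ i hi' p
      · exact h₂ (m - i) (by lia) p

/-- The sheared tensor product `(x, v) ↦ g (x - v) h v`. -/
def shear : 𝓢(En n, ℂ) →ₗ[ℂ] 𝓢(En n, ℂ) →ₗ[ℂ] 𝓢(PhaseN n, ℂ) :=
  LinearMap.mk₂ ℂ
    (fun g h ↦
      { toFun := fun p ↦ g (p.1 - p.2) * h p.2
        smooth' := ((g.smooth ⊤).comp (contDiff_fst.sub contDiff_snd)).mul
          ((h.smooth ⊤).comp contDiff_snd)
        decay' := exists_norm_iteratedFDeriv_shear_le g h })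
    (fun _ _ _ ↦ by ext p; exact add_mul _ _ _)
    (fun _ _ _ ↦ by ext p; exact mul_assoc _ _ _)
    (fun _ _ _ ↦ by ext p; exact mul_add _ _ _)
    (fun _ _ _ ↦ by ext p; exact mul_left_comm _ _ _)

lemma shear_apply (g h : 𝓢(En n, ℂ)) (p : PhaseN n) : shear g h p = g (p.1 - p.2) * h p.2 := rfl

/-- Multiplication by a linear form `⟪η, ·⟫`. -/
def formMul (η : En n) : 𝓢(En n, ℂ) →ₗ[ℂ] 𝓢(En n, ℂ) :=
  (SchwartzMap.smulLeftCLM ℂ fun v : En n ↦ ((inner ℝ η v : ℝ) : ℂ)).toLinearMap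

lemma formMul_apply (η : En n) (h : 𝓢(En n, ℂ)) (v : En n) :
    formMul η h v = (inner ℝ η v : ℝ) * h v := by
  have : Function.HasTemperateGrowth fun v : En n ↦ ((inner ℝ η v : ℝ) : ℂ) := by fun_prop
  simp [formMul, SchwartzMap.smulLeftCLM_apply_apply this]

/-- The coordinate vectors. -/
abbrev coordDir (j : Fin n) : En n := EuclideanSpace.single j 1

lemma hasFDerivAt_shear (g h : 𝓢(En n, ℂ)) (p : PhaseN n) :
    HasFDerivAt (shear g h)
      (g (p.1 - p.2) • (fderiv ℝ h p.2).comp (.snd ℝ _ _) +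
        h p.2 • (fderiv ℝ g (p.1 - p.2)).comp (.fst ℝ _ _ - .snd ℝ _ _)) p := by
  have h1 : HasFDerivAt (fun p : PhaseN n ↦ g (p.1 - p.2))
      ((fderiv ℝ g (p.1 - p.2)).comp (.fst ℝ _ _ - .snd ℝ _ _)) p :=
    (g.hasFDerivAt (p.1 - p.2)).comp p (hasFDerivAt_fst.sub hasFDerivAt_snd)
  have h2 : HasFDerivAt (fun p : PhaseN n ↦ h p.2) ((fderiv ℝ h p.2).comp (.snd ℝ _ _)) p :=
    (h.hasFDerivAt p.2).comp p hasFDerivAt_snd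
  exact h1.mul h2

lemma velMul_shear (j : Fin n) (g h : 𝓢(En n, ℂ)) :
    velMul j (shear g h) = shear g (formMul (coordDir j) h) := by
  ext p
  simp only [velMul_apply, shear_apply, formMul_apply, EuclideanSpace.inner_single_left]
  simp
  ring

lemma posDeriv_shear (j : Fin n) (g h : 𝓢(En n, ℂ)) :
    posDeriv j (shear g h) = shear (∂_{coordDir j} g) h := by
  ext p
  rw [coe_posDeriv, dxjN, (hasFDerivAt_shear g h p).fderiv, shear_apply,
    SchwartzMap.lineDerivOp_apply_eq_fderiv]
  simp [mul_comm]

lemma velDeriv_shear (j : Fin n) (g h : 𝓢(En n, ℂ)) :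
    velDeriv j (shear g h) = shear g (∂_{coordDir j} h) - shear (∂_{coordDir j} g) h := by
  ext p
  rw [coe_velDeriv, dvjN, (hasFDerivAt_shear g h p).fderiv, sub_apply, shear_apply,
    shear_apply, SchwartzMap.lineDerivOp_apply_eq_fderiv, SchwartzMap.lineDerivOp_apply_eq_fderiv]
  simp [mul_comm, sub_eq_add_neg]

end Shear

section Resolvent

open scoped SchwartzMap LineDeriv Laplacian

variable {n : ℕ}

lemma smul_sub_laplacian_eq (c : ℝ) (f : 𝓢(En n, ℂ)) :
    c • f - Δ f = SchwartzMap.fourierMultiplierCLM ℂ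
      (fun ξ : En n ↦ c + (2 * π) ^ 2 * ‖ξ‖ ^ 2) f := by
  have h1 : Function.HasTemperateGrowth fun _ : En n ↦ c := .const c
  have h2 : Function.HasTemperateGrowth fun ξ : En n ↦ ‖ξ‖ ^ 2 :=
    Function.hasTemperateGrowth_norm_sq _
  have h3 : (fun ξ : En n ↦ c + (2 * π) ^ 2 * ‖ξ‖ ^ 2) =
      (fun _ ↦ c) + ((2 * π) ^ 2) • fun ξ : En n ↦ ‖ξ‖ ^ 2 := rfl
  have h4 := SchwartzMap.fourierMultiplierCLM_const (E := En n) (F := ℂ) c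
  rw [h3, SchwartzMap.fourierMultiplierCLM_apply, SchwartzMap.smulLeftCLM_add h1
    (by fun_prop), add_apply, FourierTransform.fourierInv_add,
    ← SchwartzMap.fourierMultiplierCLM_apply, ← SchwartzMap.fourierMultiplierCLM_apply,
    SchwartzMap.fourierMultiplierCLM_smul h2, h4, SchwartzMap.laplacian_eq_fourierMultiplierCLM]
  simp only [smul_apply, ContinuousLinearMap.id_apply, neg_smul, sub_neg_eq_add]

/-- For `c > 0`, the operator `c - Δ` maps the Schwartz space onto itself. -/
lemma exists_smul_sub_laplacian_eq {c : ℝ} (hc : 0 < c) (g : 𝓢(En n, ℂ)) :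
    ∃ f : 𝓢(En n, ℂ), c • f - Δ f = g := by
  set r : ℝ := 2 * π / √c
  set m : En n → ℝ := fun ξ ↦ c⁻¹ * (1 + ‖r • ξ‖ ^ 2) ^ (-1 : ℝ)
  have hm : m.HasTemperateGrowth :=
    (Function.HasTemperateGrowth.const _).mul
      ((Function.hasTemperateGrowth_one_add_norm_sq_rpow (En n) (-1)).comp
        (r • ContinuousLinearMap.id ℝ (En n)).hasTemperateGrowth)
  have hq : Function.HasTemperateGrowth fun ξ : En n ↦ c + (2 * π) ^ 2 * ‖ξ‖ ^ 2 :=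
    (Function.HasTemperateGrowth.const c).add
      ((Function.HasTemperateGrowth.const _).mul (Function.hasTemperateGrowth_norm_sq _))
  refine ⟨SchwartzMap.fourierMultiplierCLM ℂ m g, ?_⟩
  rw [smul_sub_laplacian_eq, SchwartzMap.fourierMultiplierCLM_fourierMultiplierCLM_apply hq hm]
  have : (fun ξ : En n ↦ c + (2 * π) ^ 2 * ‖ξ‖ ^ 2) * m = fun _ ↦ 1 := by
    ext ξ
    have h1 : r ^ 2 = (2 * π) ^ 2 / c := by rw [div_pow, Real.sq_sqrt hc.le]
    have h2 : 0 ≤ (2 * π) ^ 2 * ‖ξ‖ ^ 2 := by positivity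
    simp only [m, Pi.mul_apply, norm_smul, mul_pow, Real.norm_eq_abs, sq_abs, h1, Real.rpow_neg_one]
    have h3 : c + (2 * π) ^ 2 * ‖ξ‖ ^ 2 ≠ 0 := by positivity
    have h4 : 1 + (2 * π) ^ 2 / c * ‖ξ‖ ^ 2 = (c + (2 * π) ^ 2 * ‖ξ‖ ^ 2) / c := by field_simp
    rw [mul_pow] at *
    rw [h4]
    field_simp
  rw [this, SchwartzMap.fourierMultiplierCLM_const]
  simp

lemma exists_smul_sub_sum_eq {c : ℝ} (hc : 0 < c) (g : 𝓢(En n, ℂ)) :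
    ∃ f : 𝓢(En n, ℂ), (c : ℂ) • f - ∑ j : Fin n, ∂_{coordDir j} (∂_{coordDir j} f) = g := by
  obtain ⟨f, hf⟩ := exists_smul_sub_laplacian_eq hc g
  refine ⟨f, ?_⟩
  rw [← hf, SchwartzMap.laplacian_eq_sum (EuclideanSpace.basisFun (Fin n) ℝ)]
  simp only [EuclideanSpace.basisFun_apply]
  rfl

end Resolvent

section RangeOfKfp

open scoped SchwartzMap LineDeriv

variable {n : ℕ}

lemma kfp_shear (g h : 𝓢(En n, ℂ)) :
    kfp (shear g h) =
      ∑ j, (shear (∂_{coordDir j} g)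
          (formMul (coordDir j) h + (2 : ℂ) • ∂_{coordDir j} h) -
        shear (∂_{coordDir j} (∂_{coordDir j} g)) h +
        shear g ((1 / 4 : ℂ) • formMul (coordDir j) (formMul (coordDir j) h) -
          ∂_{coordDir j} (∂_{coordDir j} h) - (1 / 2 : ℂ) • h)) := by
  have h1 : (n / 2 : ℂ) • shear g h = ∑ _j : Fin n, (1 / 2 : ℂ) • shear g h := by
    rw [Finset.sum_const, Finset.card_univ, Fintype.card_fin, ← Nat.cast_smul_eq_nsmul ℂ, smul_smul]
    congr 1
    ring
  rw [kfp_eq, transport_apply, oscillator_apply, h1, Finset.smul_sum, ← Finset.sum_neg_distrib,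
    ← Finset.sum_add_distrib, ← Finset.sum_add_distrib, ← Finset.sum_sub_distrib]
  refine Finset.sum_congr rfl fun j _ ↦ ?_
  simp only [posDeriv_shear, velMul_shear, velDeriv_shear, map_sub, map_add, map_smul]
  module

lemma lineDeriv_formMul (η m : En n) (h : 𝓢(En n, ℂ)) :
    ∂_{m} (formMul η h) = formMul η (∂_{m} h) + ((inner ℝ η m : ℝ) : ℂ) • h := by
  ext v
  have h1 : (⇑(formMul η h) : En n → ℂ) = fun v ↦ ((inner ℝ η v : ℝ) : ℂ) * h v :=
    funext fun v ↦ formMul_apply η h v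
  have h2 : HasFDerivAt (fun v : En n ↦ ((inner ℝ η v : ℝ) : ℂ))
    (Complex.ofRealCLM ∘L innerSL ℝ η) v := (Complex.ofRealCLM ∘L innerSL ℝ η).hasFDerivAt
  rw [add_apply, smul_apply, formMul_apply,
    SchwartzMap.lineDerivOp_apply_eq_fderiv, SchwartzMap.lineDerivOp_apply_eq_fderiv, h1,
    (h2.fun_mul (h.hasFDerivAt v)).fderiv]
  simp [mul_comm]

lemma formMul_comm (η m : En n) (h : 𝓢(En n, ℂ)) :
    formMul η (formMul m h) = formMul m (formMul η h) := by
  ext v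
  simp only [formMul_apply]
  ring

/-- The functions `⟪η, v⟫ ^ k * exp (-‖v‖² / 4)`. -/
def hermite (η : En n) : ℕ → 𝓢(En n, ℂ)
  | 0 => gaussian (by norm_num : (0 : ℝ) < 1 / 4)
  | k + 1 => formMul η (hermite η k)

lemma hermite_apply (η : En n) (k : ℕ) (v : En n) :
    hermite η k v = ((inner ℝ η v : ℝ) : ℂ) ^ k * (Real.exp (-(1 / 4) * ‖v‖ ^ 2) : ℂ) := by
  induction k with
  | zero => rw [hermite, gaussian_apply]; simp
  | succ k ih => rw [hermite, formMul_apply, ih]; ring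

lemma lineDeriv_gaussian (η m : En n) :
    ∂_{m} (hermite η 0) = (-(1 / 2) : ℂ) • formMul m (hermite η 0) := by
  ext v
  have h1 : (⇑(hermite η 0) : En n → ℂ) = fun v ↦ ((Real.exp (-(1 / 4) * ‖v‖ ^ 2) : ℝ) : ℂ) := by
    ext v; rw [hermite_apply, pow_zero, one_mul]
  have h2 := ((hasFDerivAt_id (𝕜 := ℝ) v).norm_sq.const_mul (-(1 / 4) : ℝ)).exp
  have h3 := Complex.ofRealCLM.hasFDerivAt.comp v h2
  rw [Function.comp_def] at h3
  simp only [Complex.ofRealCLM_apply, id] at h3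
  rw [smul_apply, formMul_apply,
    SchwartzMap.lineDerivOp_apply_eq_fderiv, h1, h3.fderiv]
  simp [real_inner_comm m v]
  ring

lemma natCast_smul_formMul_hermite (η : En n) (k : ℕ) :
    (k : ℂ) • formMul η (hermite η (k - 1)) = (k : ℂ) • hermite η k := by
  cases k with
  | zero => simp
  | succ k => rfl

lemma lineDeriv_hermite (η m : En n) (k : ℕ) :
    ∂_{m} (hermite η k) = ((k : ℂ) * (inner ℝ η m : ℝ)) • hermite η (k - 1) -
      (1 / 2 : ℂ) • formMul m (hermite η k) := by
  induction k with
  | zero => rw [lineDeriv_gaussian]; simp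
  | succ k ih =>
    have h := natCast_smul_formMul_hermite η k
    rw [hermite, lineDeriv_formMul, ih, map_sub, map_smul, map_smul, formMul_comm η m, mul_comm,
      mul_smul, h, Nat.add_sub_cancel]
    push_cast
    module

lemma hermite_transport (η m : En n) (k : ℕ) :
    formMul m (hermite η k) + (2 : ℂ) • ∂_{m} (hermite η k) =
      (2 * k * (inner ℝ η m : ℝ) : ℂ) • hermite η (k - 1) := by
  rw [lineDeriv_hermite]
  module

lemma hermite_oscillator (η : En n) (j : Fin n) (k : ℕ) :
    (1 / 4 : ℂ) • formMul (coordDir j) (formMul (coordDir j) (hermite η k)) -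
        ∂_{coordDir j} (∂_{coordDir j} (hermite η k)) - (1 / 2 : ℂ) • hermite η k =
      (k * η j : ℂ) • formMul (coordDir j) (hermite η (k - 1)) -
        (k * (k - 1 : ℕ) * (η j) ^ 2 : ℂ) • hermite η (k - 2) := by
  have h1 : ((inner ℝ η (coordDir j) : ℝ) : ℂ) = η j := by
    simp [EuclideanSpace.inner_single_right]
  have h2 : ((inner ℝ (coordDir j) (coordDir j) : ℝ) : ℂ) = 1 := by simp
  have h3 (c : ℂ) (f : 𝓢(En n, ℂ)) : ∂_{coordDir j} (c • f) = c • ∂_{coordDir j} f :=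
    LineDeriv.lineDerivOp_smul _ _ _
  have h4 (a b : 𝓢(En n, ℂ)) : ∂_{coordDir j} (a - b) = ∂_{coordDir j} a - ∂_{coordDir j} b :=
    map_sub (LineDeriv.lineDerivOpCLM ℂ 𝓢(En n, ℂ) (coordDir j)) a b
  rw [lineDeriv_hermite, h4, h3, h3, lineDeriv_formMul,
    lineDeriv_hermite, lineDeriv_hermite, h1, h2, map_sub, map_smul, map_smul,
    Nat.sub_sub]
  module

/-- The action of `P₀ + 1` on the functions `g (x - v) * ⟪η, v⟫ ^ k * exp (-‖v‖² / 4)`. -/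
lemma kfp_shear_hermite (η : En n) (k : ℕ) (g : 𝓢(En n, ℂ)) :
    kfp (shear g (hermite η k)) + shear g (hermite η k) =
      shear (((k + 1 : ℝ) : ℂ) • g - ∑ j : Fin n, ∂_{coordDir j} (∂_{coordDir j} g)) (hermite η k) +
      (k : ℂ) • shear (∑ j : Fin n, (2 * η j : ℂ) • ∂_{coordDir j} g) (hermite η (k - 1)) -
      (k * (k - 1 : ℕ) * ∑ j, (η j : ℂ) ^ 2 : ℂ) • shear g (hermite η (k - 2)) := by
  have h1 (m : En n) (f : 𝓢(En n, ℂ)) : formMul m f =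
      ∑ j : Fin n, (m j : ℂ) • formMul (coordDir j) f := by
    ext v
    rw [sum_apply, formMul_apply]
    simp only [smul_apply, formMul_apply, EuclideanSpace.inner_single_left]
    rw [PiLp.inner_apply]
    push_cast
    rw [Finset.sum_mul]
    refine Finset.sum_congr rfl fun j _ ↦ ?_
    simp
    ring
  have h2 : (k : ℂ) • hermite η k =
      ∑ j : Fin n, (k * η j : ℂ) • formMul (coordDir j) (hermite η (k - 1)) := by
    rw [← natCast_smul_formMul_hermite, h1, Finset.smul_sum]
    simp only [smul_smul]
  have h3 : shear (((k + 1 : ℝ) : ℂ) • g) (hermite η k) =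
      shear g (∑ j : Fin n, (k * η j : ℂ) • formMul (coordDir j) (hermite η (k - 1))) +
        shear g (hermite η k) := by
    rw [← h2]
    push_cast
    simp only [map_smul, LinearMap.smul_apply]
    module
  rw [kfp_shear, map_sub, LinearMap.sub_apply, h3]
  simp only [hermite_transport, hermite_oscillator]
  simp only [map_sum, LinearMap.sum_apply, map_sub, map_smul, LinearMap.smul_apply,
    EuclideanSpace.inner_single_right, Finset.sum_add_distrib, Finset.sum_sub_distrib,
    Finset.mul_sum, Finset.sum_smul, Finset.smul_sum, smul_smul]
  simp only [mul_assoc, mul_left_comm (k : ℂ) 2, one_mul, starRingEnd_apply, star_trivial]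
  abel

/-- All functions `g (x - v) * ⟪η, v⟫ ^ k * exp (-‖v‖² / 4)` are in the range of `P₀ + 1`. -/
theorem exists_kfp_add_eq_shear (η : En n) (k : ℕ) (g : 𝓢(En n, ℂ)) :
    ∃ u, kfp u + u = shear g (hermite η k) := by
  suffices h : shear g (hermite η k) ∈ LinearMap.range (kfp (n := n) + LinearMap.id) from h
  induction k using Nat.strong_induction_on generalizing g with
  | _ k ih =>
    obtain ⟨f, hf⟩ := exists_smul_sub_sum_eq (n := n) (c := k + 1) (by positivity) g
    have h1 := kfp_shear_hermite η k f
    rw [hf, add_sub_assoc, ← sub_eq_iff_eq_add] at h1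
    rw [← h1]
    refine sub_mem ⟨_, rfl⟩ (sub_mem ?_ ?_)
    · rcases k with - | k
      · simp
      · exact Submodule.smul_mem _ _ (ih _ (by simp) _)
    · rcases k with - | - | k
      · simp
      · simp
      · exact Submodule.smul_mem _ _ (ih _ (by lia) _)

end RangeOfKfp

section FourierInjectivity

variable {E : Type*} [NormedAddCommGroup E] [NormedSpace ℝ E] [MeasurableSpace E] [BorelSpace E]
  {μ : Measure E}

lemma integrable_mul_cexp {B : E → ℂ} (hB : Integrable B μ) (L : StrongDual ℝ E) :
    Integrable (fun p ↦ B p * cexp (L p * I)) μ := by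
  refine hB.mul_bdd (c := 1) (by fun_prop) (.of_forall fun p ↦ ?_)
  rw [Complex.norm_exp_ofReal_mul_I]

variable [SecondCountableTopology E] [CompleteSpace E]

lemma ae_eq_zero_of_fourier_ofReal_eq_zero {r : E → ℝ} (hr : Integrable r μ)
    (h : ∀ L : StrongDual ℝ E, ∫ p, (r p : ℂ) * cexp (L p * I) ∂μ = 0) : r =ᵐ[μ] 0 := by
  have hfin := isFiniteMeasure_withDensity_ofReal hr.2
  have hfin' := isFiniteMeasure_withDensity_ofReal hr.neg.2
  have hm : AEMeasurable (fun p ↦ ENNReal.ofReal (r p)) μ := hr.1.aemeasurable.ennreal_ofReal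
  have hm' : AEMeasurable (fun p ↦ ENNReal.ofReal ((-r) p)) μ :=
    hr.neg.1.aemeasurable.ennreal_ofReal
  have key : μ.withDensity (fun p ↦ ENNReal.ofReal (r p)) =
      μ.withDensity (fun p ↦ ENNReal.ofReal ((-r) p)) := by
    refine Measure.ext_of_charFunDual (funext fun L ↦ ?_)
    rw [charFunDual_apply, charFunDual_apply,
      integral_withDensity_eq_integral_toReal_smul₀ hm (by simp),
      integral_withDensity_eq_integral_toReal_smul₀ hm' (by simp), ← sub_eq_zero, ← h L,
      ← integral_sub]
    · congr with p
      simp only [ENNReal.toReal_ofReal', Pi.neg_apply, ← sub_smul, max_zero_sub_eq_self]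
      rfl
    · simpa [ENNReal.toReal_ofReal'] using integrable_mul_cexp hr.pos_part.ofReal L
    · simpa [ENNReal.toReal_ofReal'] using integrable_mul_cexp hr.neg_part.ofReal L
  have h0 := (withDensity_eq_iff hm hm' hr.lintegral_lt_top.ne).1 key
  filter_upwards [h0] with p hp
  have := congrArg ENNReal.toReal hp
  simp only [ENNReal.toReal_ofReal', Pi.neg_apply] at this
  rcases le_total 0 (r p) with h1 | h1
  · rw [max_eq_left h1, max_eq_right (by linarith)] at this
    simpa using this
  · rw [max_eq_right h1, max_eq_left (by linarith)] at this
    simp; linarith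

/-- An integrable function with vanishing Fourier transform vanishes almost everywhere. -/
theorem ae_eq_zero_of_fourier_eq_zero {B : E → ℂ} (hB : Integrable B μ)
    (h : ∀ L : StrongDual ℝ E, ∫ p, B p * cexp (L p * I) ∂μ = 0) : B =ᵐ[μ] 0 := by
  have hconj (L : StrongDual ℝ E) : ∫ p, (starRingEnd ℂ) (B p) * cexp (L p * I) ∂μ = 0 := by
    rw [← map_zero (starRingEnd ℂ), ← h (-L), ← integral_conj]
    congr with p
    simp [← Complex.exp_conj]
  have hB' : Integrable (fun p ↦ (starRingEnd ℂ) (B p)) μ := by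
    exact Complex.conjCLE.toContinuousLinearMap.integrable_comp hB
  have hre := ae_eq_zero_of_fourier_ofReal_eq_zero (r := fun p ↦ (B p).re) hB.re fun L ↦ by
    have h1 : ∀ p, ((B p).re : ℂ) * cexp (L p * I) =
        (1 / 2 : ℂ) * (B p * cexp (L p * I) + (starRingEnd ℂ) (B p) * cexp (L p * I)) := fun p ↦ by
      rw [Complex.re_eq_add_conj]; ring
    simp only [h1]
    rw [integral_const_mul, integral_add (integrable_mul_cexp hB L) (integrable_mul_cexp hB' L),
      h, hconj]
    simp
  have him := ae_eq_zero_of_fourier_ofReal_eq_zero (r := fun p ↦ (B p).im) hB.im fun L ↦ by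
    have h1 : ∀ p, ((B p).im : ℂ) * cexp (L p * I) =
        (1 / (2 * I) : ℂ) *
          (B p * cexp (L p * I) - (starRingEnd ℂ) (B p) * cexp (L p * I)) := fun p ↦ by
      rw [Complex.im_eq_sub_conj]; ring
    simp only [h1]
    rw [integral_const_mul, integral_sub (integrable_mul_cexp hB L) (integrable_mul_cexp hB' L),
      h, hconj]
    simp
  filter_upwards [hre, him] with p h1 h2
  exact Complex.ext h1 h2

end FourierInjectivity

section Density

open scoped SchwartzMap LineDeriv ComplexConjugate Nat

variable {n : ℕ}

lemma inner_Lp_toL2 (f : HspN n) (s : 𝓢(PhaseN n, ℂ)) :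
    inner ℂ f (toL2 s) = ∫ p : PhaseN n, conj (f p) * s p := by
  rw [L2.inner_def]
  refine integral_congr_ae ?_
  filter_upwards [s.coeFn_toLp 2] with p h
  rw [toL2_eq, h, RCLike.inner_apply, mul_comm]

lemma integrable_conj_mul (f : HspN n) (s : 𝓢(PhaseN n, ℂ)) :
    Integrable fun p : PhaseN n ↦ conj (f p) * s p := by
  refine (L2.integrable_inner (𝕜 := ℂ) f (toL2 s)).congr ?_
  filter_upwards [s.coeFn_toLp 2] with p h
  rw [toL2_eq, h, RCLike.inner_apply, mul_comm]

lemma integral_norm_sq_eq_norm_sq (f : HspN n) : ∫ p : PhaseN n, ‖f p‖ ^ 2 = ‖f‖ ^ 2 := by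
  have h := inner_self_eq_norm_sq (𝕜 := ℂ) f
  rw [← h, L2.inner_def, ← integral_re (L2.integrable_inner f f)]
  simp only [inner_self_eq_norm_sq]

lemma integrable_bound (f : HspN n) (g : 𝓢(En n, ℂ)) (η : En n) :
    Integrable fun p : PhaseN n ↦
      ‖f p‖ * ‖g (p.1 - p.2)‖ * Real.exp (-(1 / 4) * ‖p.2‖ ^ 2) * Real.exp (‖η‖ * ‖p.2‖) := by
  have hG : (0 : ℝ) < 1 / 8 := by norm_num
  refine ((integrable_conj_mul f (shear g (gaussian hG))).norm.const_mul
    (Real.exp (2 * ‖η‖ ^ 2))).mono' ?_ (.of_forall fun p ↦ ?_)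
  · refine ((Lp.aestronglyMeasurable f).norm.mul ?_).mul ?_ |>.mul ?_
    all_goals
      refine Continuous.aestronglyMeasurable ?_
      have := g.continuous
      fun_prop
  · rw [Real.norm_of_nonneg (by positivity), shear_apply, gaussian_apply, norm_mul, norm_mul,
      RCLike.norm_conj, Complex.norm_real, Real.norm_of_nonneg (Real.exp_nonneg _)]
    have h : Real.exp (-(1 / 4) * ‖p.2‖ ^ 2) * Real.exp (‖η‖ * ‖p.2‖) ≤
        Real.exp (2 * ‖η‖ ^ 2) * Real.exp (-(1 / 8) * ‖p.2‖ ^ 2) := by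
      rw [← Real.exp_add, ← Real.exp_add]
      refine Real.exp_le_exp.2 ?_
      nlinarith [sq_nonneg (‖p.2‖ - 4 * ‖η‖)]
    calc _ = ‖f p‖ * ‖g (p.1 - p.2)‖ *
          (Real.exp (-(1 / 4) * ‖p.2‖ ^ 2) * Real.exp (‖η‖ * ‖p.2‖)) := by ring
      _ ≤ ‖f p‖ * ‖g (p.1 - p.2)‖ *
          (Real.exp (2 * ‖η‖ ^ 2) * Real.exp (-(1 / 8) * ‖p.2‖ ^ 2)) := by gcongr
      _ = _ := by ring

lemma integral_shear_mul_cexp_eq_zero {f : HspN n} {g : 𝓢(En n, ℂ)} {η : En n}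
    (h : ∀ k, ∫ p : PhaseN n, conj (f p) * shear g (hermite η k) p = 0) :
    ∫ p : PhaseN n, conj (f p) * shear g (hermite 0 0) p * cexp ((inner ℝ η p.2 : ℝ) * I) = 0 := by
  have hb (p : PhaseN n) : HasSum (fun k : ℕ ↦ ‖f p‖ * ‖g (p.1 - p.2)‖ *
      Real.exp (-(1 / 4) * ‖p.2‖ ^ 2) * ((‖η‖ * ‖p.2‖) ^ k / k !))
      (‖f p‖ * ‖g (p.1 - p.2)‖ * Real.exp (-(1 / 4) * ‖p.2‖ ^ 2) * Real.exp (‖η‖ * ‖p.2‖)) := by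
    rw [Real.exp_eq_exp_ℝ]
    exact (NormedSpace.expSeries_div_hasSum_exp (‖η‖ * ‖p.2‖)).mul_left _
  have key := hasSum_integral_of_dominated_convergence (μ := (volume : Measure (PhaseN n)))
    (F := fun (k : ℕ) p ↦ (I ^ k / k !) * (conj (f p) * shear g (hermite η k) p))
    (f := fun p ↦ conj (f p) * shear g (hermite 0 0) p * cexp ((inner ℝ η p.2 : ℝ) * I))
    (fun k p ↦ ‖f p‖ * ‖g (p.1 - p.2)‖ * Real.exp (-(1 / 4) * ‖p.2‖ ^ 2) *
      ((‖η‖ * ‖p.2‖) ^ k / k !))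
    (fun k ↦ ((integrable_conj_mul f _).const_mul _).1)
    (fun k ↦ .of_forall fun p ↦ ?_) (.of_forall fun p ↦ (hb p).summable) ?_
    (.of_forall fun p ↦ ?_)
  · simp only [integral_const_mul, h, mul_zero] at key
    exact key.unique hasSum_zero
  · rw [shear_apply, hermite_apply]
    simp only [norm_mul, norm_div, norm_pow, Complex.norm_I, one_pow, RCLike.norm_conj,
      Complex.norm_real, Complex.norm_natCast]
    rw [Real.norm_of_nonneg (Real.exp_nonneg _)]
    have := norm_inner_le_norm (𝕜 := ℝ) η p.2
    calc _ = ‖f p‖ * ‖g (p.1 - p.2)‖ * Real.exp (-(1 / 4) * ‖p.2‖ ^ 2) *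
          (‖(inner ℝ η p.2 : ℝ)‖ ^ k / k !) := by ring
      _ ≤ _ := by gcongr
  · simp only [(hb _).tsum_eq]
    exact integrable_bound f g η
  · have h1 := NormedSpace.expSeries_div_hasSum_exp (((inner ℝ η p.2 : ℝ) : ℂ) * I)
    rw [← Complex.exp_eq_exp_ℂ] at h1
    convert! h1.mul_left (conj (f p) * shear g (hermite 0 0) p) using 2 with k
    rw [shear_apply, shear_apply, hermite_apply, hermite_apply, mul_pow]
    ring

/-- An element of `L²` orthogonal to all functions `g (x - v) * ⟪η, v⟫ ^ k * exp (-‖v‖² / 4)`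
vanishes. -/
lemma eq_zero_of_integral_shear_eq_zero {f : HspN n}
    (h : ∀ (η : En n) k g, ∫ p : PhaseN n, conj (f p) * shear g (hermite η k) p = 0) : f = 0 := by
  set G : 𝓢(En n, ℂ) := hermite 0 0
  have hB : (fun p : PhaseN n ↦ conj (f p) * shear G G p) =ᵐ[volume] 0 := by
    refine ae_eq_zero_of_fourier_eq_zero (integrable_conj_mul f _) fun L ↦ ?_
    obtain ⟨k, hk⟩ : ∃ k : En n, ∀ x, inner ℝ k x = L (x, 0) :=
      ⟨(InnerProductSpace.toDual ℝ (En n)).symm (L ∘L .inl ℝ _ _), fun x ↦ by simp⟩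
    obtain ⟨ζ, hζ⟩ : ∃ ζ : En n, ∀ v, inner ℝ ζ v = L (0, v) :=
      ⟨(InnerProductSpace.toDual ℝ (En n)).symm (L ∘L .inr ℝ _ _), fun x ↦ by simp⟩
    have h1 := integral_shear_mul_cexp_eq_zero (fun j ↦ h (ζ + k) j
      (SchwartzMap.smulLeftCLM ℂ (fun y : En n ↦ cexp ((inner ℝ k y : ℝ) * I)) G))
    rw [← h1]
    congr with p
    have h2 : L p = inner ℝ k (p.1 - p.2) + inner ℝ (ζ + k) p.2 := by
      have : L p = L (p.1, 0) + L (0, p.2) := by rw [← map_add]; simp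
      rw [this, ← hk, ← hζ, inner_sub_right, inner_add_left]
      ring
    rw [shear_apply, shear_apply,
      SchwartzMap.smulLeftCLM_apply_apply (hasTemperateGrowth_character k), h2, smul_eq_mul]
    push_cast
    rw [add_mul, Complex.exp_add]
    ring
  refine Lp.ext ?_
  filter_upwards [hB, Lp.coeFn_zero ℂ 2 volume] with p h1 h2
  rw [h2]
  have h3 (v : En n) : G v ≠ 0 := by
    rw [hermite_apply]
    simp
  simpa [shear_apply, h3] using h1

theorem dense_range_kfp_add_one (f : HspN n) (d : ℝ) (hd : 0 < d) :
    ∃ u : 𝓢(PhaseN n, ℂ), ∫ p : PhaseN n, ‖f p - (KFP0N n (⇑u) p + u p)‖ ^ 2 < d := by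
  set R : Submodule ℂ (HspN n) := LinearMap.range (toL2 ∘ₗ (kfp (n := n) + LinearMap.id))
  have hR : R.topologicalClosure = ⊤ := by
    rw [Submodule.topologicalClosure_eq_top_iff, Submodule.eq_bot_iff]
    intro f hf
    refine eq_zero_of_integral_shear_eq_zero fun η k g ↦ ?_
    obtain ⟨u, hu⟩ := exists_kfp_add_eq_shear η k g
    rw [← hu, ← inner_Lp_toL2]
    exact (Submodule.mem_orthogonal' R f).1 hf _ ⟨u, rfl⟩
  have hf : f ∈ closure (R : Set (HspN n)) := by
    rw [← Submodule.topologicalClosure_coe, hR]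
    trivial
  obtain ⟨_, ⟨u, rfl⟩, hu⟩ := Metric.mem_closure_iff.1 hf (√d) (Real.sqrt_pos.2 hd)
  refine ⟨u, ?_⟩
  have h1 : ∫ p : PhaseN n, ‖f p - (KFP0N n (⇑u) p + u p)‖ ^ 2 =
      ‖f - toL2 (kfp u + u)‖ ^ 2 := by
    rw [← integral_norm_sq_eq_norm_sq]
    refine integral_congr_ae ?_
    filter_upwards [Lp.coeFn_sub f (toL2 (kfp u + u)), (kfp u + u).coeFn_toLp 2] with p h1 h2
    rw [h1, Pi.sub_apply, toL2_eq, h2, add_apply, kfp_apply]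
  rw [h1, ← Real.sq_sqrt hd.le]
  have h2 : ‖f - toL2 (kfp u + u)‖ < √d := by rwa [← dist_eq_norm]
  gcongr

end Density

/-- **Corollary 2.4**.  There is C > 0 such that for all u ∈ 𝒮(ℝ^{2n}) and λ ∈ ℝ,
  |λ|‖u‖² + ‖Δᵥu‖² + ‖|v|²u‖² + ‖|D_x|^{2/3}u‖² ≤ C‖(P₀ + (n+2)/2 − iλ)u‖².
(The Fourier multiplier norm is computed via the partial Fourier transform in x and
Plancherel: ‖|D_x|^{2/3}u‖² = ∫ |2πξ|^{4/3}|û(ξ,v)|² dξ dv.)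
Moreover P₀, defined on 𝒮(ℝ^{2n}), is essentially maximally accretive: it is accretive
and, by the Lumer–Phillips theorem, its closure is maximally accretive iff the range of
P₀ + 1 on 𝒮 is dense in L²(ℝ^{2n}). -/
theorem statement6 (n : ℕ) (hn : 1 ≤ n) :
    -- the uniform subelliptic estimate :
    (∃ C > (0:ℝ), ∀ u : SchwartzMap (PhaseN n) ℂ, ∀ lam : ℝ,
      |lam| * (∫ p : PhaseN n, ‖u p‖ ^ 2)
        + (∫ p : PhaseN n, ‖lapvN n (⇑u) p‖ ^ 2)
        + (∫ p : PhaseN n, ‖p.2‖ ^ 4 * ‖u p‖ ^ 2)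
        + (∫ q : PhaseN n, ((2 * π) ^ 2 * ‖q.1‖ ^ 2) ^ ((2:ℝ)/3) * ‖pftxN n (⇑u) q‖ ^ 2)
      ≤ C * ∫ p : PhaseN n,
          ‖KFP0N n (⇑u) p + ((((n : ℝ) + 2) / 2 : ℝ) : ℂ) * u p
            - Complex.I * (lam : ℝ) * u p‖ ^ 2) ∧
    -- P₀ is accretive on 𝒮 :
    (∀ u : SchwartzMap (PhaseN n) ℂ,
      0 ≤ (∫ p : PhaseN n, KFP0N n (⇑u) p * (starRingEnd ℂ) (u p)).re) ∧
    -- and essentially maximally accretive: (P₀ + 1)(𝒮) is dense in L²(ℝ^{2n}) :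
    (∀ f : HspN n, ∀ d : ℝ, 0 < d → ∃ u : SchwartzMap (PhaseN n) ℂ,
      ∫ p : PhaseN n, ‖f p - (KFP0N n (⇑u) p + u p)‖ ^ 2 < d) := by
  exact ⟨⟨16 * (36 + n / 2) + 50, by positivity, fun u lam ↦ subelliptic_estimate u lam⟩,
    integral_kfp_mul_conj_re_nonneg, dense_range_kfp_add_one⟩

end
end
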